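/- In the one-boundary setting (ξ₂(t) ≡ X constant and u(X,t) ≠ 0 for all t ∈ [0,T]): if s ∈ (0,T) is a ZZZ-moment of w₁(t) := u(ξ₁(t),t), i.e. there exists ε₂ > 0 with u(ξ₁(t),t) = 0 for all t ∈ [s−ε₂, s+ε₂], and ξ₁ is C¹ on [s−ε₂, s+ε₂], then there exists ε > 0 such that on (s−ε, s+ε): Z(t) < ∞ for every t, Z(t) is non-increasing in t, and if u(·,τ) has a multiple zero in I(τ) for some τ ∈ (s−ε, s+ε) then Z(t₁) > Z(t₂) for all t₁, t₂ with s−ε < t₁ < τ < t₂ < s+ε. -/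

import Mathlib

open Set

/-- spatial partial derivative `u_x` -/
noncomputable def pdx (u : ℝ → ℝ → ℝ) (x t : ℝ) : ℝ := deriv (fun y => u y t) x

/-- second spatial partial derivative `u_xx` -/
noncomputable def pdxx (u : ℝ → ℝ → ℝ) (x t : ℝ) : ℝ := deriv (fun y => pdx u y t) x

/-- time partial derivative `u_t` -/
noncomputable def pdt (u : ℝ → ℝ → ℝ) (x t : ℝ) : ℝ := deriv (fun s => u x s) t

/-- the closure of the space-time domain `Ω` -/
def domCl (xi1 xi2 : ℝ → ℝ) (T : ℝ) : Set (ℝ × ℝ) :=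
  {p : ℝ × ℝ | p.2 ∈ Icc (0:ℝ) T ∧ p.1 ∈ Icc (xi1 p.2) (xi2 p.2)}

/-- the domain together with its lateral boundaries -/
def domLat (xi1 xi2 : ℝ → ℝ) (T : ℝ) : Set (ℝ × ℝ) :=
  {p : ℝ × ℝ | p.2 ∈ Ioc (0:ℝ) T ∧ p.1 ∈ Icc (xi1 p.2) (xi2 p.2)}

/-- `u` is a classical solution of `u_t = a u_xx + b u_x + c u` on
`Ω = {(x,t) : ξ₁(t) < x < ξ₂(t), 0 < t ≤ T}`: it is continuous on the closure, its
partial derivatives `u_t, u_x, u_xx` exist and are continuous up to the lateral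
boundaries, and the equation holds. -/
structure IsClassicalSolution (a b c : ℝ → ℝ → ℝ) (xi1 xi2 : ℝ → ℝ) (T : ℝ)
    (u : ℝ → ℝ → ℝ) : Prop where
  cont : ContinuousOn (fun p : ℝ × ℝ => u p.1 p.2) (domCl xi1 xi2 T)
  diff_x : ∀ p ∈ domLat xi1 xi2 T, DifferentiableAt ℝ (fun y => u y p.2) p.1
  diff_xx : ∀ p ∈ domLat xi1 xi2 T, DifferentiableAt ℝ (fun y => pdx u y p.2) p.1
  diff_t : ∀ p ∈ domLat xi1 xi2 T, DifferentiableAt ℝ (fun s => u p.1 s) p.2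
  cont_x : ContinuousOn (fun p : ℝ × ℝ => pdx u p.1 p.2) (domLat xi1 xi2 T)
  cont_xx : ContinuousOn (fun p : ℝ × ℝ => pdxx u p.1 p.2) (domLat xi1 xi2 T)
  cont_t : ContinuousOn (fun p : ℝ × ℝ => pdt u p.1 p.2) (domLat xi1 xi2 T)
  eqn : ∀ p ∈ domLat xi1 xi2 T,
    pdt u p.1 p.2 =
      a p.1 p.2 * pdxx u p.1 p.2 + b p.1 p.2 * pdx u p.1 p.2 + c p.1 p.2 * u p.1 p.2

/-- the regularity assumption (1.2): `a, a⁻¹, a_t, a_x, a_xx, b, b_t, b_x, c ∈ L^∞`,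
with `a > 0` -/
def Reg12 (a b c : ℝ → ℝ → ℝ) (xi1 xi2 : ℝ → ℝ) (T : ℝ) : Prop :=
  ∃ M : ℝ, ∀ p ∈ domLat xi1 xi2 T,
    0 < a p.1 p.2 ∧
    DifferentiableAt ℝ (fun y => a y p.2) p.1 ∧
    DifferentiableAt ℝ (fun y => pdx a y p.2) p.1 ∧
    DifferentiableAt ℝ (fun s => a p.1 s) p.2 ∧
    DifferentiableAt ℝ (fun y => b y p.2) p.1 ∧
    DifferentiableAt ℝ (fun s => b p.1 s) p.2 ∧
    |a p.1 p.2| ≤ M ∧ |(a p.1 p.2)⁻¹| ≤ M ∧ |pdt a p.1 p.2| ≤ M ∧ |pdx a p.1 p.2| ≤ M ∧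
    |pdxx a p.1 p.2| ≤ M ∧ |b p.1 p.2| ≤ M ∧ |pdt b p.1 p.2| ≤ M ∧ |pdx b p.1 p.2| ≤ M ∧
    |c p.1 p.2| ≤ M

/-- the set of zeroes of `u(·,t)` in `I(t) = [ξ₁(t), ξ₂(t)]` -/
def zeroSet (u : ℝ → ℝ → ℝ) (xi1 xi2 : ℝ → ℝ) (t : ℝ) : Set ℝ :=
  {x ∈ Icc (xi1 t) (xi2 t) | u x t = 0}

/-- `Z(t)`: the (extended-natural) number of zeroes of `u(·,t)` in `I(t)` -/
noncomputable def Znum (u : ℝ → ℝ → ℝ) (xi1 xi2 : ℝ → ℝ) (t : ℝ) : ℕ∞ :=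
  (zeroSet u xi1 xi2 t).encard

/-- `u(·,s)` has a multiple (degenerate) zero in `I(s)` -/
def HasMultipleZero (u : ℝ → ℝ → ℝ) (xi1 xi2 : ℝ → ℝ) (s : ℝ) : Prop :=
  ∃ x₀ ∈ Icc (xi1 s) (xi2 s), u x₀ s = 0 ∧ pdx u x₀ s = 0

/-- the boundary trace `wᵢ(t) := u(ξᵢ(t), t)` -/
def bdryTrace (u : ℝ → ℝ → ℝ) (xi : ℝ → ℝ) : ℝ → ℝ := fun t => u (xi t) t

/-- some left neighborhood of `s` consists entirely of N-moments -/
def leftN (w : ℝ → ℝ) (s : ℝ) : Prop := ∃ ε > 0, ∀ t ∈ Ioo (s - ε) s, w t ≠ 0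

/-- some left neighborhood of `s` consists entirely of Z-moments -/
def leftZ (w : ℝ → ℝ) (s : ℝ) : Prop := ∃ ε > 0, ∀ t ∈ Ioo (s - ε) s, w t = 0

/-- some right neighborhood of `s` consists entirely of N-moments -/
def rightN (w : ℝ → ℝ) (s : ℝ) : Prop := ∃ ε > 0, ∀ t ∈ Ioo s (s + ε), w t ≠ 0

/-- some right neighborhood of `s` consists entirely of Z-moments -/
def rightZ (w : ℝ → ℝ) (s : ℝ) : Prop := ∃ ε > 0, ∀ t ∈ Ioo s (s + ε), w t = 0

/-- `s` is an NZN-moment of `w` -/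
def IsNZN (w : ℝ → ℝ) (s : ℝ) : Prop := w s = 0 ∧ leftN w s ∧ rightN w s

/-- `s` is a ZZZ-moment of `w` -/
def IsZZZ (w : ℝ → ℝ) (s : ℝ) : Prop := w s = 0 ∧ leftZ w s ∧ rightZ w s

/-- `s` is an NZZ-moment of `w` -/
def IsNZZ (w : ℝ → ℝ) (s : ℝ) : Prop := w s = 0 ∧ leftN w s ∧ rightZ w s

/-- `s` is a ZZN-moment of `w` -/
def IsZZN (w : ℝ → ℝ) (s : ℝ) : Prop := w s = 0 ∧ leftZ w s ∧ rightN w s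

/-- `s` is an NZ*-moment of `w` -/
def IsNZstar (w : ℝ → ℝ) (s : ℝ) : Prop := w s = 0 ∧ leftN w s

/-- (H1): on every nondegenerate closed interval of Z-moments of the boundary trace `w`,
the boundary curve `ξ` is `C¹` -/
def H1cond (w xi : ℝ → ℝ) (T : ℝ) : Prop :=
  ∀ p q : ℝ, 0 ≤ p → p < q → q ≤ T → (∀ t ∈ Icc p q, w t = 0) → ContDiffOn ℝ 1 xi (Icc p q)

/-- (H2) at an NZ*-moment `s` of `u(ξ(·),·)`, with sign `σ = (-1)^i`:
`ξ'(s-0)` exists, and `σ · u_x(ξ(s),s) ≥ 0` (resp. `≤ 0`) if `u(ξ(t),t) > 0`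
(resp. `< 0`) shortly before `s`. -/
def H2at (u : ℝ → ℝ → ℝ) (xi : ℝ → ℝ) (σ s : ℝ) : Prop :=
  (∃ L : ℝ, HasDerivWithinAt xi L (Iio s) s) ∧
  ((∃ ε > 0, ∀ t ∈ Ioo (s - ε) s, 0 < u (xi t) t) → 0 ≤ σ * pdx u (xi s) s) ∧
  ((∃ ε > 0, ∀ t ∈ Ioo (s - ε) s, u (xi t) t < 0) → σ * pdx u (xi s) s ≤ 0)

/-- (H3) at a Z-moment `s` of `u(ξ(·),·)`, with sign `σ = (-1)^i`:
`σ · u(ξ(t),t) · u(x,s) ≤ 0` for `t` slightly after `s` and `x ∈ I(s)` near (but not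
equal to) `ξ(s)`. -/
def H3at (u : ℝ → ℝ → ℝ) (xi1 xi2 xi : ℝ → ℝ) (σ s : ℝ) : Prop :=
  ∃ ε > 0, ∃ δ > 0, ∀ t ∈ Ioo s (s + ε), ∀ x ∈ Icc (xi1 s) (xi2 s),
    x ≠ xi s → |x - xi s| < δ → σ * (u (xi t) t * u x s) ≤ 0

/-- (H3) at a Z-moment `s` for the left boundary (`i = 1`, one-boundary setting):
`-u(ξ₁(t),t) · u(x,s) ≤ 0` for `t` slightly after `s` and `x` slightly to the right
of `ξ₁(s)`. -/
def H3one (u : ℝ → ℝ → ℝ) (xi : ℝ → ℝ) (s : ℝ) : Prop :=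
  ∃ ε > 0, ∃ δ > 0, ∀ t ∈ Ioo s (s + ε), ∀ x : ℝ,
    xi s < x → x - xi s < δ → -(u (xi t) t) * u x s ≤ 0

open MeasureTheory ProbabilityTheory Filter Topology
open Real (exp sqrt)


/-- Gaussian measure with density `(4π)^{-1/2} e^{-z²/4}` -/
noncomputable abbrev gm : Measure ℝ := gaussianReal 0 2

/-- measurable and exponentially bounded -/
def EB (f : ℝ → ℝ) : Prop := Measurable f ∧ ∃ C k : ℝ, 0 ≤ C ∧ 0 ≤ k ∧ ∀ z, |f z| ≤ C * exp (k * |z|)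

lemma EB.mul {f g : ℝ → ℝ} (hf : EB f) (hg : EB g) : EB (fun z => f z * g z) := by
  obtain ⟨hfm, C, k, hC, hk, h1⟩ := hf
  obtain ⟨hgm, D, l, hD, hl, h2⟩ := hg
  refine ⟨hfm.mul hgm, C * D, k + l, by positivity, by positivity, fun z => ?_⟩
  rw [abs_mul, add_mul, Real.exp_add]
  calc |f z| * |g z| ≤ (C * exp (k * |z|)) * (D * exp (l * |z|)) :=
        mul_le_mul (h1 z) (h2 z) (abs_nonneg _) (by positivity)
    _ = _ := by ring

lemma EB.add {f g : ℝ → ℝ} (hf : EB f) (hg : EB g) : EB (fun z => f z + g z) := by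
  obtain ⟨hfm, C, k, hC, hk, h1⟩ := hf
  obtain ⟨hgm, D, l, hD, hl, h2⟩ := hg
  refine ⟨hfm.add hgm, C + D, k + l, by positivity, by positivity, fun z => ?_⟩
  have e1 : exp (k * |z|) ≤ exp ((k + l) * |z|) :=
    Real.exp_le_exp.2 (by nlinarith [abs_nonneg z])
  have e2 : exp (l * |z|) ≤ exp ((k + l) * |z|) :=
    Real.exp_le_exp.2 (by nlinarith [abs_nonneg z])
  calc |f z + g z| ≤ |f z| + |g z| := abs_add_le _ _
    _ ≤ C * exp ((k + l) * |z|) + D * exp ((k + l) * |z|) :=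
        add_le_add ((h1 z).trans (mul_le_mul_of_nonneg_left e1 hC))
          ((h2 z).trans (mul_le_mul_of_nonneg_left e2 hD))
    _ = _ := by ring

lemma EB.of_bdd {f : ℝ → ℝ} (hf : Measurable f) (C : ℝ) (h : ∀ z, |f z| ≤ C) : EB f :=
  ⟨hf, C, 0, (abs_nonneg _).trans (h 0), le_rfl, fun z => by simpa using h z⟩

lemma EB.const (c : ℝ) : EB (fun _ => c) := EB.of_bdd measurable_const |c| fun _ => le_rfl

lemma EB.id : EB (fun z => z) :=
  ⟨measurable_id, 1, 1, zero_le_one, zero_le_one, fun z => by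
    have := Real.add_one_le_exp (1 * |z|); linarith⟩

lemma EB.smul {f : ℝ → ℝ} (c : ℝ) (hf : EB f) : EB (fun z => c * f z) := (EB.const c).mul hf

lemma EB.neg {f : ℝ → ℝ} (hf : EB f) : EB (fun z => -f z) := by simpa using hf.smul (-1)

lemma EB.sub {f g : ℝ → ℝ} (hf : EB f) (hg : EB g) : EB (fun z => f z - g z) := by
  simpa [sub_eq_add_neg] using hf.add hg.neg

lemma EB.sq {f : ℝ → ℝ} (hf : EB f) : EB (fun z => f z ^ 2) := by simpa [pow_two] using hf.mul hf

lemma EB.abs {f : ℝ → ℝ} (hf : EB f) : EB (fun z => |f z|) := by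
  obtain ⟨hm, C, k, hC, hk, h⟩ := hf
  exact ⟨by simpa using hm.norm, C, k, hC, hk, fun z => by simpa using h z⟩

lemma EB.mono {f g : ℝ → ℝ} (hf : Measurable f) (hg : EB g) (h : ∀ z, |f z| ≤ |g z|) : EB f := by
  obtain ⟨hm, C, k, hC, hk, h'⟩ := hg
  exact ⟨hf, C, k, hC, hk, fun z => (h z).trans (h' z)⟩

lemma EB.exp (k : ℝ) : EB (fun z => exp (k * |z|)) := by
  refine ⟨by fun_prop, 1, |k|, zero_le_one, abs_nonneg _, fun z => ?_⟩
  rw [abs_of_pos (Real.exp_pos _), one_mul]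
  exact Real.exp_le_exp.2 (mul_le_mul_of_nonneg_right (le_abs_self k) (abs_nonneg _))

lemma EB.comp {f : ℝ → ℝ} (hf : EB f) (p q : ℝ) : EB (fun z => f (p * z + q)) := by
  obtain ⟨hm, C, k, hC, hk, h⟩ := hf
  refine ⟨hm.comp (by fun_prop), C * Real.exp (k * |q|), k * |p|, by positivity, by positivity,
    fun z => (h _).trans ?_⟩
  rw [mul_assoc, ← Real.exp_add]
  refine mul_le_mul_of_nonneg_left (Real.exp_le_exp.2 ?_) hC
  have : |p * z + q| ≤ |p| * |z| + |q| := (abs_add_le _ _).trans (by rw [abs_mul])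
  nlinarith

lemma exp_abs_integrable (k : ℝ) : Integrable (fun z : ℝ => exp (k * |z|)) gm := by
  have h1 := (integrable_exp_mul_gaussianReal (μ := 0) (v := 2) k).add
    (integrable_exp_mul_gaussianReal (μ := 0) (v := 2) (-k))
  refine h1.mono' (by fun_prop) (Eventually.of_forall fun z => ?_)
  rw [Real.norm_of_nonneg (Real.exp_pos _).le]
  simp only [Pi.add_apply]
  rcases abs_cases z with ⟨h, _⟩ | ⟨h, _⟩ <;> rw [h]
  · linarith [Real.exp_pos (-k * z)]
  · rw [show k * -z = -k * z by ring]; linarith [Real.exp_pos (k * z)]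

lemma EB.int {f : ℝ → ℝ} (hf : EB f) : Integrable f gm := by
  obtain ⟨hm, C, k, hC, hk, h⟩ := hf
  exact ((exp_abs_integrable k).const_mul C).mono' hm.aestronglyMeasurable
    (Eventually.of_forall h)

noncomputable def gd (z : ℝ) : ℝ := (sqrt (4 * Real.pi))⁻¹ * exp (-z ^ 2 / 4)

lemma gd_eq : gaussianPDFReal 0 2 = gd := by
  ext z
  rw [gaussianPDFReal_def]
  simp only [gd, sub_zero]
  have e : ((2 : NNReal) : ℝ) = 2 := rfl
  rw [e]
  ring_nf

lemma gd_pos (z : ℝ) : 0 < gd z := by unfold gd; positivity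

lemma gm_integral (f : ℝ → ℝ) : ∫ z, f z ∂gm = ∫ z, gd z * f z := by
  rw [integral_gaussianReal_eq_integral_smul (by norm_num), gd_eq]; rfl

lemma gm_integrable {f : ℝ → ℝ} (h : Integrable f gm) : Integrable (fun z => gd z * f z) := by
  rw [gm, gaussianReal_of_var_ne_zero _ (by norm_num)] at h
  have h2 := (integrable_withDensity_iff_integrable_smul₀' (by
    exact (measurable_gaussianPDF 0 2).aemeasurable)
    (Eventually.of_forall fun x => gaussianPDF_lt_top)).1 h
  refine h2.congr (Eventually.of_forall fun z => ?_)
  simp only [toReal_gaussianPDF, gd_eq, smul_eq_mul]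

lemma gd_deriv (z : ℝ) : HasDerivAt gd (-(z / 2) * gd z) z := by
  have h : HasDerivAt (fun z : ℝ => -z ^ 2 / 4) (-(z/2)) z := by
    have := ((hasDerivAt_pow 2 z).neg).div_const 4
    exact this.congr_deriv (by norm_num; ring)
  exact ((h.exp).const_mul _).congr_deriv (by unfold gd; ring)

lemma gd_tendsto {f : ℝ → ℝ} (hf : EB f) :
    Tendsto (fun n : ℝ => gd n * f n) atTop (𝓝 0) ∧ Tendsto (fun n : ℝ => gd (-n) * f (-n)) atTop (𝓝 0) := by
  obtain ⟨hm, C, k, hC, hk, h⟩ := hf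
  have key : Tendsto (fun n : ℝ => (sqrt (4 * Real.pi))⁻¹ * C * exp (n * (k - n / 4))) atTop (𝓝 0) := by
    have h1 : Tendsto (fun n : ℝ => k - n / 4) atTop atBot := by
      have := tendsto_atBot_add_const_left atTop k
        (tendsto_neg_atTop_atBot.comp (tendsto_id.atTop_div_const (show (0:ℝ) < 4 by norm_num)))
      refine this.congr fun n => ?_
      simp [sub_eq_add_neg]
    have h2 := Real.tendsto_exp_atBot.comp (tendsto_id.atTop_mul_atBot₀ h1)
    simpa using h2.const_mul ((sqrt (4 * Real.pi))⁻¹ * C)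
  have bd : ∀ z : ℝ, |gd z * f z| ≤ (sqrt (4 * Real.pi))⁻¹ * C * exp (|z| * (k - |z| / 4)) := by
    intro z
    rw [abs_mul, abs_of_pos (gd_pos z)]
    calc gd z * |f z| ≤ gd z * (C * exp (k * |z|)) := mul_le_mul_of_nonneg_left (h z) (gd_pos z).le
      _ = (sqrt (4 * Real.pi))⁻¹ * C * (exp (-z ^ 2 / 4) * exp (k * |z|)) := by
        unfold gd; ring
      _ = _ := by rw [← Real.exp_add, ← sq_abs z]; ring_nf
  constructor
  · refine squeeze_zero_norm' ?_ key
    filter_upwards [eventually_ge_atTop 0] with n hn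
    simpa [abs_of_nonneg hn] using bd n
  · refine squeeze_zero_norm' ?_ key
    filter_upwards [eventually_ge_atTop 0] with n hn
    simpa [abs_of_nonneg hn] using bd (-n)

lemma ibp {φ φ' : ℝ → ℝ} (S : Set ℝ) (hS : S.Countable) (hc : Continuous φ)
    (hd : ∀ z, z ∉ S → HasDerivAt φ (φ' z) z) (h1 : EB φ) (h2 : EB φ') :
    ∫ z, φ' z ∂gm = ∫ z, z / 2 * φ z ∂gm := by
  have hz : EB (fun z : ℝ => z / 2) := by simpa [div_eq_inv_mul] using EB.id.smul 2⁻¹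
  have h3 := h2.sub (hz.mul h1)
  have hI := gm_integrable h3.int
  have hcg : Continuous gd := continuous_iff_continuousAt.2 fun z => (gd_deriv z).continuousAt
  have ftc : ∀ n : ℝ, ∫ z in (-n)..n, gd z * (φ' z - z / 2 * φ z) = gd n * φ n - gd (-n) * φ (-n) := by
    intro n
    refine integral_eq_of_hasDerivAt_off_countable (fun z => gd z * φ z) _ hS
      (hcg.mul hc).continuousOn ?_ hI.intervalIntegrable
    intro z hz
    exact ((gd_deriv z).mul (hd z hz.2)).congr_deriv (by ring)
  have t1 := intervalIntegral_tendsto_integral (μ := volume) hI tendsto_neg_atTop_atBot tendsto_id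
  have t2 := (gd_tendsto h1).1.sub (gd_tendsto h1).2
  have e := tendsto_nhds_unique t1 (t2.congr fun n => (ftc n).symm)
  rw [← gm_integral, integral_sub h2.int (hz.mul h1).int] at e
  linarith

lemma gm_shift (g : ℝ → ℝ) (η : ℝ) :
    ∫ z, g (z + η) ∂gm = ∫ z, g z * exp (η * z / 2 - η ^ 2 / 4) ∂gm := by
  rw [gm_integral, gm_integral, ← integral_add_right_eq_self (fun z => gd z * (g z * _)) η]
  refine integral_congr_ae (Eventually.of_forall fun z => ?_)
  simp only [gd]
  rw [show exp (-z ^ 2 / 4) = exp (-(z + η) ^ 2 / 4) * exp (η * (z + η) / 2 - η ^ 2 / 4) by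
    rw [← Real.exp_add]; ring_nf]
  ring

lemma gm_dilate {φ : ℝ → ℝ} (h : EB φ) (h0 : ∀ z, 0 ≤ φ z) {κ : ℝ} (hκ : 1 ≤ κ) :
    κ⁻¹ * ∫ z, φ z ∂gm ≤ ∫ z, φ (κ * z) ∂gm := by
  have hκ0 : 0 < κ := by linarith
  have e : ∫ z, φ (κ * z) ∂gm = κ⁻¹ * ∫ z, gd (κ⁻¹ * z) * φ z := by
    rw [gm_integral]
    have := Measure.integral_comp_mul_left (fun z => gd (κ⁻¹ * z) * φ z) κ
    rw [abs_of_pos (by positivity), smul_eq_mul] at this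
    rw [← this]
    refine integral_congr_ae (Eventually.of_forall fun z => ?_)
    simp only [inv_mul_cancel_left₀ hκ0.ne']
  rw [e, gm_integral]
  refine mul_le_mul_of_nonneg_left ?_ (by positivity)
  have hi : Integrable (fun z => gd (κ⁻¹ * z) * φ z) := by
    have h1 : EB (fun z => φ (κ * z)) := by simpa using h.comp κ 0
    have h2 := (gm_integrable h1.int).comp_mul_left' (inv_ne_zero hκ0.ne')
    refine h2.congr (Eventually.of_forall fun z => ?_)
    simp only [mul_inv_cancel_left₀ hκ0.ne']
  refine integral_mono (gm_integrable h.int) hi fun z => ?_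
  refine mul_le_mul_of_nonneg_right ?_ (h0 z)
  unfold gd
  refine mul_le_mul_of_nonneg_left (Real.exp_le_exp.2 ?_) (by positivity)
  have : (κ⁻¹ * z) ^ 2 ≤ z ^ 2 := by
    rw [mul_pow]
    have : κ⁻¹ ^ 2 ≤ 1 := pow_le_one₀ (by positivity) (inv_le_one_of_one_le₀ hκ)
    nlinarith [sq_nonneg z]
  linarith

lemma gm_cs {f g : ℝ → ℝ} (hf : EB f) (hg : EB g) :
    (∫ z, f z * g z ∂gm) ^ 2 ≤ (∫ z, f z ^ 2 ∂gm) * ∫ z, g z ^ 2 ∂gm := by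
  have h : ∀ x : ℝ, 0 ≤ (∫ z, f z ^ 2 ∂gm) * (x * x) + (2 * ∫ z, f z * g z ∂gm) * x + ∫ z, g z ^ 2 ∂gm := by
    intro x
    have : ∫ z, (x * f z + g z) ^ 2 ∂gm = (∫ z, f z ^ 2 ∂gm) * (x * x) + (2 * ∫ z, f z * g z ∂gm) * x + ∫ z, g z ^ 2 ∂gm := by
      have e : (fun z => (x * f z + g z) ^ 2) = fun z => (x * x) * f z ^ 2 + (2 * x) * (f z * g z) + g z ^ 2 := by
        ext z; ring
      rw [e, integral_add ((hf.sq.smul _).add ((hf.mul hg).smul _)).int hg.sq.int,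
        integral_add (hf.sq.smul _).int ((hf.mul hg).smul _).int, integral_const_mul, integral_const_mul]
      ring
    rw [← this]
    exact integral_nonneg fun z => sq_nonneg _
  have := discrim_le_zero h
  unfold discrim at this
  nlinarith

lemma gm_abs_cs {f g : ℝ → ℝ} (hf : EB f) (hg : EB g) :
    |∫ z, f z * g z ∂gm| ≤ sqrt (∫ z, f z ^ 2 ∂gm) * sqrt (∫ z, g z ^ 2 ∂gm) := by
  rw [← Real.sqrt_mul (integral_nonneg fun z => sq_nonneg _)]
  exact Real.abs_le_sqrt (gm_cs hf hg)

lemma gm_int_le {f g : ℝ → ℝ} (hf : EB f) (hg : EB g) (h : ∀ z, f z ≤ g z) :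
    ∫ z, f z ∂gm ≤ ∫ z, g z ∂gm := integral_mono hf.int hg.int h

lemma gm_Ici_pos (r : ℝ) : 0 < gm.real (Ici r) := by
  have h : gm (Ici r) ≠ 0 := fun h0 => by
    have := gaussianReal_absolutelyContinuous' 0 (v := 2) (by norm_num) h0
    simp at this
  exact ENNReal.toReal_pos h (measure_ne_top _ _)

lemma chain2 {f fx : ℝ → ℝ → ℝ} {ft ω j : ℝ} {p q : ℝ → ℝ} {p' q' s0 : ℝ}
    (hx : ∀ᶠ z : ℝ × ℝ in 𝓝 (ω, j), HasDerivAt (fun y => f y z.2) (fx z.1 z.2) z.1)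
    (hc : ContinuousAt (fun z : ℝ × ℝ => fx z.1 z.2) (ω, j))
    (ht : HasDerivAt (fun t => f ω t) ft j)
    (hp : HasDerivAt p p' s0) (hq : HasDerivAt q q' s0) (hp0 : p s0 = ω) (hq0 : q s0 = j) :
    HasDerivAt (fun s => f (p s) (q s)) (fx ω j * p' + ft * q') s0 := by
  have h2 : HasDerivAt (fun s => f ω (q s)) (ft * q') s0 := by
    subst hq0; exact ht.comp s0 hq
  have h1 : HasDerivAt (fun s => f (p s) (q s) - f ω (q s)) (fx ω j * p') s0 := by
    have e0 : (fun s => (f (p s) (q s) - f ω (q s)) - fx ω j * (p s - ω)) =o[𝓝 s0] fun s => s - s0 := by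
      have hpO : (fun s => p s - ω) =O[𝓝 s0] fun s => s - s0 := by
        subst hp0; exact hp.isBigO_sub
      refine Asymptotics.IsLittleO.trans_isBigO ?_ hpO
      rw [Asymptotics.isLittleO_iff]
      intro ε hε
      have hev : ∀ᶠ z : ℝ × ℝ in 𝓝 (ω, j), HasDerivAt (fun y => f y z.2) (fx z.1 z.2) z.1 ∧
          |fx z.1 z.2 - fx ω j| ≤ ε := by
        refine hx.and ?_
        filter_upwards [Metric.tendsto_nhds.1 hc ε hε] with z hz
        exact (Real.dist_eq _ _ ▸ hz).le
      obtain ⟨δ, hδ, hball⟩ := Metric.eventually_nhds_iff.1 hev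
      have c1 := Metric.tendsto_nhds.1 hp.continuousAt δ hδ
      have c2 := Metric.tendsto_nhds.1 hq.continuousAt δ hδ
      rw [hp0] at c1; rw [hq0] at c2
      filter_upwards [c1, c2] with s hs1 hs2
      have hin : ∀ y ∈ Metric.ball ω δ, HasDerivAt (fun y => f y (q s)) (fx y (q s)) y ∧ |fx y (q s) - fx ω j| ≤ ε :=
        fun y hy => hball (y := (y, q s)) (by rw [Prod.dist_eq]; exact max_lt hy hs2)
      have := (convex_ball ω δ).norm_image_sub_le_of_norm_hasDerivWithin_le
        (f := fun y => f y (q s) - fx ω j * y) (f' := fun y => fx y (q s) - fx ω j) (C := ε)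
        (fun y hy => ((((hin y hy).1).sub ((hasDerivAt_id y).const_mul (fx ω j))).congr_deriv (by ring)).hasDerivWithinAt)
        (fun y hy => (hin y hy).2) (Metric.mem_ball_self hδ) hs1
      refine le_trans (le_of_eq ?_) this
      congr 1; ring
    rw [hasDerivAt_iff_isLittleO]
    have e1 : (fun s => fx ω j * (p s - ω - p' * (s - s0))) =o[𝓝 s0] fun s => s - s0 := by
      refine Asymptotics.IsLittleO.const_mul_left ?_ _
      have := hasDerivAt_iff_isLittleO.1 hp
      rw [hp0] at this
      refine this.congr_left fun s => ?_
      simp [mul_comm]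
    refine (e0.add e1).congr_left fun s => ?_
    rw [hp0, hq0]; simp; ring
  refine (h1.add h2).congr_of_eventuallyEq (Eventually.of_forall fun s => ?_)
  simp

structure Slice (W W1 W2 : ℝ → ℝ) (k : ℝ) : Prop where
  d1 : ∀ z, HasDerivAt W (W1 z) z
  d2 : ∀ z, z ≠ k → HasDerivAt W1 (W2 z) z
  c1 : Continuous W1
  e0 : EB W
  e1 : EB W1
  e2 : EB W2

namespace Slice
variable {W W1 W2 V V1 V2 : ℝ → ℝ} {k l : ℝ}

lemma c0 (S : Slice W W1 W2 k) : Continuous W :=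
  continuous_iff_continuousAt.2 fun z => (S.d1 z).continuousAt

lemma hz2 : EB (fun z : ℝ => z / 2) := by simpa [div_eq_inv_mul] using EB.id.smul 2⁻¹

lemma eQ (S : Slice W W1 W2 k) : EB (fun z => W2 z - z / 2 * W1 z) := S.e2.sub (hz2.mul S.e1)

lemma bil (S : Slice W W1 W2 k) (S' : Slice V V1 V2 l) :
    ∫ z, V z * (W2 z - z / 2 * W1 z) ∂gm = -∫ z, V1 z * W1 z ∂gm := by
  have h := ibp (φ := fun z => V z * W1 z) (φ' := fun z => V1 z * W1 z + V z * W2 z) {k}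
    (countable_singleton k) (S'.c0.mul S.c1)
    (fun z hz => (S'.d1 z).mul (S.d2 z hz)) (S'.e0.mul S.e1)
    ((S'.e1.mul S.e1).add (S'.e0.mul S.e2))
  rw [integral_add (S'.e1.mul S.e1).int (S'.e0.mul S.e2).int] at h
  have e : (fun z => V z * (W2 z - z / 2 * W1 z)) = fun z => V z * W2 z - z / 2 * (V z * W1 z) := by
    ext z; ring
  rw [e, integral_sub (S'.e0.mul S.e2).int (hz2.mul (S'.e0.mul S.e1)).int]
  linarith

lemma one : Slice (fun _ => 1) (fun _ => 0) (fun _ => 0) 0 :=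
  ⟨fun z => hasDerivAt_const z 1, fun z _ => hasDerivAt_const z 0, continuous_const,
    EB.const 1, EB.const 0, EB.const 0⟩

lemma idn : Slice (fun z => z) (fun _ => 1) (fun _ => 0) 0 :=
  ⟨fun z => hasDerivAt_id z, fun z _ => hasDerivAt_const z 1, continuous_const,
    EB.id, EB.const 1, EB.const 0⟩

lemma intQ (S : Slice W W1 W2 k) : ∫ z, (W2 z - z / 2 * W1 z) ∂gm = 0 := by
  simpa using S.bil one

lemma intzQ (S : Slice W W1 W2 k) : ∫ z, z * (W2 z - z / 2 * W1 z) ∂gm = -∫ z, W1 z ∂gm := by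
  simpa using S.bil idn

lemma intW1 (S : Slice W W1 W2 k) : ∫ z, W1 z ∂gm = 2⁻¹ * ∫ z, z * W z ∂gm := by
  rw [ibp ∅ countable_empty S.c0 (fun z _ => S.d1 z) S.e0 S.e1, ← integral_const_mul]
  congr 1; ext z; ring

lemma moment (S : Slice W W1 W2 k) :
    ∫ z, z ^ 2 * W z ^ 2 ∂gm ≤ 4 * ∫ z, W z ^ 2 ∂gm + 16 * ∫ z, W1 z ^ 2 ∂gm := by
  have hb : EB (fun z => z * W z * W1 z) := (EB.id.mul S.e0).mul S.e1
  have h := ibp (φ := fun z => z * W z ^ 2) (φ' := fun z => W z ^ 2 + 2 * (z * W z * W1 z)) ∅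
    countable_empty (by have := S.c0; fun_prop)
    (fun z _ => ((hasDerivAt_id z).mul ((S.d1 z).pow 2)).congr_deriv (by simp; ring))
    (EB.id.mul S.e0.sq) (S.e0.sq.add (hb.smul 2))
  rw [integral_add S.e0.sq.int (hb.smul 2).int, integral_const_mul] at h
  have e : (fun z => z / 2 * (z * W z ^ 2)) = fun z => 2⁻¹ * (z ^ 2 * W z ^ 2) := by ext z; ring
  rw [e, integral_const_mul] at h
  have h2 : ∫ z, 4 * (z * W z * W1 z) ∂gm ≤ ∫ z, (2⁻¹ * (z ^ 2 * W z ^ 2) + 8 * W1 z ^ 2) ∂gm := by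
    refine gm_int_le (hb.smul 4) (((EB.id.sq.mul S.e0.sq).smul _).add (S.e1.sq.smul _)) fun z => ?_
    nlinarith [sq_nonneg (z * W z - 4 * W1 z)]
  rw [integral_add ((EB.id.sq.mul S.e0.sq).smul _).int (S.e1.sq.smul _).int,
    integral_const_mul, integral_const_mul, integral_const_mul] at h2
  linarith

end Slice

/-- model parabolic inequality on the line -/
structure PMod (v vy vyy vt : ℝ → ℝ → ℝ) (ta tb M B R : ℝ) : Prop where
  hM : 0 ≤ M
  hB : 0 ≤ B
  hR : 0 ≤ R
  dy : ∀ t ∈ Ioo ta tb, ∀ y, HasDerivAt (fun y => v y t) (vy y t) y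
  dyy : ∀ t ∈ Ioo ta tb, ∀ y, y ≠ 0 → HasDerivAt (fun y => vy y t) (vyy y t) y
  dt : ∀ t ∈ Ioo ta tb, ∀ y, HasDerivAt (fun t => v y t) (vt y t) t
  cy : ContinuousOn (fun p : ℝ × ℝ => vy p.1 p.2) {p | p.2 ∈ Ioo ta tb}
  cyy : ContinuousOn (fun p : ℝ × ℝ => vyy p.1 p.2) {p | p.1 ≠ 0 ∧ p.2 ∈ Ioo ta tb}
  bv : ∀ t ∈ Ioo ta tb, ∀ y, |v y t| ≤ B
  bvy : ∀ t ∈ Ioo ta tb, ∀ y, |vy y t| ≤ B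
  bvyy : ∀ t ∈ Ioo ta tb, ∀ y, |vyy y t| ≤ B
  bvt : ∀ t ∈ Ioo ta tb, ∀ y, |vt y t| ≤ B
  eqn : ∀ t ∈ Ioo ta tb, ∀ y, y ≠ 0 → |vt y t - vyy y t| ≤ M * (|vy y t| + |v y t|)
  far : ∀ t ∈ Ioo ta tb, ∀ y, R ≤ |y| → |v y t| = 1
  zero : ∀ t ∈ Ioo ta tb, v 0 t = 0

namespace PMod
variable {v vy vyy vt : ℝ → ℝ → ℝ} {ta tb M B R : ℝ}

lemma lip (m : PMod v vy vyy vt ta tb M B R) {y y' t t' : ℝ} (ht : t ∈ Ioo ta tb) (ht' : t' ∈ Ioo ta tb) :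
    |v y t - v y' t'| ≤ B * |y - y'| + B * |t - t'| := by
  have h1 := convex_univ.norm_image_sub_le_of_norm_hasDerivWithin_le (f := fun y => v y t)
    (fun y _ => (m.dy t ht y).hasDerivWithinAt) (fun y _ => m.bvy t ht y) (mem_univ y') (mem_univ y)
  have h2 := (convex_Ioo ta tb).norm_image_sub_le_of_norm_hasDerivWithin_le (f := fun t => v y' t)
    (fun t ht => (m.dt t ht y').hasDerivWithinAt) (fun t ht => m.bvt t ht y') ht' ht
  calc |v y t - v y' t'| = |(v y t - v y' t) + (v y' t - v y' t')| := by congr 1; ring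
    _ ≤ _ := (abs_add_le _ _).trans (add_le_add h1 h2)

lemma open' : IsOpen {p : ℝ × ℝ | p.2 ∈ Ioo ta tb} := isOpen_Ioo.preimage continuous_snd

lemma tot (m : PMod v vy vyy vt ta tb M B R) {p q : ℝ → ℝ} {p' q' s : ℝ} (hs : q s ∈ Ioo ta tb)
    (hp : HasDerivAt p p' s) (hq : HasDerivAt q q' s) :
    HasDerivAt (fun s => v (p s) (q s)) (vy (p s) (q s) * p' + vt (p s) (q s) * q') s := by
  have hn : {p : ℝ × ℝ | p.2 ∈ Ioo ta tb} ∈ 𝓝 (p s, q s) := open'.mem_nhds hs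
  exact chain2 (by filter_upwards [hn] with z hz using m.dy z.2 hz z.1) (m.cy.continuousAt hn)
    (m.dt _ hs _) hp hq rfl rfl

lemma cv (m : PMod v vy vyy vt ta tb M B R) {t : ℝ} (ht : t ∈ Ioo ta tb) : Continuous fun y => v y t :=
  continuous_iff_continuousAt.2 fun z => (m.dy t ht z).continuousAt

lemma cvy (m : PMod v vy vyy vt ta tb M B R) {t : ℝ} (ht : t ∈ Ioo ta tb) : Continuous fun y => vy y t :=
  continuous_iff_continuousAt.2 fun z =>
    ((m.cy.continuousAt (open'.mem_nhds (show (z, t).2 ∈ Ioo ta tb from ht)))).comp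
      (f := fun y : ℝ => (y, t)) (by fun_prop)

lemma mvyy (m : PMod v vy vyy vt ta tb M B R) {t : ℝ} (ht : t ∈ Ioo ta tb) : Measurable fun y => vyy y t := by
  have h : (fun y => vyy y t) = fun y => if y ∈ ({0} : Set ℝ) then vyy 0 t else deriv (fun y => vy y t) y := by
    ext y
    by_cases hy : y = 0
    · simp [hy]
    · simp [hy, (m.dyy t ht y hy).deriv]
  rw [h]
  exact Measurable.ite (measurableSet_singleton 0) measurable_const (measurable_deriv _)

lemma mvt (m : PMod v vy vyy vt ta tb M B R) {t : ℝ} (ht : t ∈ Ioo ta tb) : Measurable fun y => vt y t := by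
  have hk : ∀ n : ℕ, t + (tb - t) / 2 / (n + 1) ∈ Ioo ta tb := by
    intro n
    have h0 : 0 < (tb - t) / 2 := by linarith [ht.2]
    have h1 : 0 < (tb - t) / 2 / (n + 1) := by positivity
    have h2 : (tb - t) / 2 / (n + 1) ≤ (tb - t) / 2 := div_le_self h0.le (by linarith [Nat.cast_nonneg (α := ℝ) n])
    exact ⟨by linarith [ht.1], by linarith⟩
  have h0 : 0 < (tb - t) / 2 := by linarith [ht.2]
  refine measurable_of_tendsto_metrizable (f := fun (n : ℕ) y =>
    ((tb - t) / 2 / (n + 1))⁻¹ • (v y (t + (tb - t) / 2 / (n + 1)) - v y t)) ?_ ?_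
  · intro n
    exact (((m.cv (hk n)).sub (m.cv ht)).const_smul ((tb - t) / 2 / ((n:ℝ) + 1))⁻¹).measurable
  · rw [tendsto_pi_nhds]
    intro y
    refine (hasDerivAt_iff_tendsto_slope_zero.1 (m.dt t ht y)).comp
      (f := fun n : ℕ => (tb - t) / 2 / ((n : ℝ) + 1)) ?_
    refine tendsto_nhdsWithin_iff.2 ⟨?_, Eventually.of_forall fun n => ?_⟩
    · have := (tendsto_one_div_add_atTop_nhds_zero_nat (𝕜 := ℝ)).const_mul ((tb - t) / 2)
      simpa [div_eq_mul_inv] using this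
    · have : 0 < (tb - t) / 2 / ((n : ℝ) + 1) := by positivity
      exact this.ne'

lemma slice (m : PMod v vy vyy vt ta tb M B R) {t : ℝ} (ht : t ∈ Ioo ta tb) (y σ : ℝ) (hσ : 0 < σ) :
    Slice (fun z => v (y + σ * z) t) (fun z => σ * vy (y + σ * z) t)
      (fun z => σ ^ 2 * vyy (y + σ * z) t) (-y / σ) := by
  have ha : ∀ z, HasDerivAt (fun z => y + σ * z) σ z := fun z =>
    (((hasDerivAt_id z).const_mul σ).const_add y).congr_deriv (by simp)
  refine ⟨fun z => ?_, fun z hz => ?_, ?_, ?_, ?_, ?_⟩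
  · exact (HasDerivAt.comp z (m.dy t ht (y + σ * z)) (ha z)).congr_deriv (mul_comm _ _)
  · have : y + σ * z ≠ 0 := by
      intro h; apply hz; field_simp; linarith
    exact ((HasDerivAt.comp z (m.dyy t ht _ this) (ha z)).const_mul σ).congr_deriv (show σ * (vyy (y + σ * z) t * σ) = σ ^ 2 * vyy (y + σ * z) t by ring)
  · have := m.cvy ht; fun_prop
  · exact EB.of_bdd ((m.cv ht).measurable.comp (by fun_prop)) B fun z => m.bv t ht _
  · exact (EB.of_bdd (f := fun z => vy (y + σ * z) t) ((m.cvy ht).measurable.comp (by fun_prop)) B fun z => m.bvy t ht _).smul _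
  · exact (EB.of_bdd (f := fun z => vyy (y + σ * z) t) ((m.mvyy ht).comp (by fun_prop)) B fun z => m.bvyy t ht _).smul _

end PMod

noncomputable def gH (v : ℝ → ℝ → ℝ) (Q j σ : ℝ) : ℝ := ∫ z, v (Q + σ * z) (j - σ ^ 2) ^ 2 ∂gm
noncomputable def gP (vy : ℝ → ℝ → ℝ) (Q j σ : ℝ) : ℝ := ∫ z, (σ * vy (Q + σ * z) (j - σ ^ 2)) ^ 2 ∂gm
noncomputable def gQ (vy vyy : ℝ → ℝ → ℝ) (Q j σ z : ℝ) : ℝ :=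
  σ ^ 2 * vyy (Q + σ * z) (j - σ ^ 2) - z / 2 * (σ * vy (Q + σ * z) (j - σ ^ 2))
noncomputable def gS (vy vt : ℝ → ℝ → ℝ) (Q j σ z : ℝ) : ℝ :=
  vy (Q + σ * z) (j - σ ^ 2) * z + vt (Q + σ * z) (j - σ ^ 2) * (-(2 * σ))
noncomputable def gg (vyy vt : ℝ → ℝ → ℝ) (Q j σ z : ℝ) : ℝ :=
  2 * σ * (vt (Q + σ * z) (j - σ ^ 2) - vyy (Q + σ * z) (j - σ ^ 2))

namespace PMod
variable {v vy vyy vt : ℝ → ℝ → ℝ} {ta tb M B R : ℝ} {Q j σ : ℝ}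

lemma nbhd (hσ : 0 < σ) (ht : j - σ ^ 2 ∈ Ioo ta tb) :
    {s : ℝ | 0 < s ∧ s < σ + 1 ∧ j - s ^ 2 ∈ Ioo ta tb} ∈ 𝓝 σ := by
  refine inter_mem (lt_mem_nhds hσ) (inter_mem (gt_mem_nhds (by linarith)) ?_)
  have hc : Continuous fun s : ℝ => j - s ^ 2 := by fun_prop
  exact hc.continuousAt (isOpen_Ioo.mem_nhds ht)

lemma eW (m : PMod v vy vyy vt ta tb M B R) (hσ : 0 < σ) (ht : j - σ ^ 2 ∈ Ioo ta tb) :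
    EB fun z => v (Q + σ * z) (j - σ ^ 2) := (m.slice ht Q σ hσ).e0

lemma eW1 (m : PMod v vy vyy vt ta tb M B R) (hσ : 0 < σ) (ht : j - σ ^ 2 ∈ Ioo ta tb) :
    EB fun z => σ * vy (Q + σ * z) (j - σ ^ 2) := (m.slice ht Q σ hσ).e1

lemma eQ (m : PMod v vy vyy vt ta tb M B R) (hσ : 0 < σ) (ht : j - σ ^ 2 ∈ Ioo ta tb) :
    EB (gQ vy vyy Q j σ) := (m.slice ht Q σ hσ).eQ

lemma eS (m : PMod v vy vyy vt ta tb M B R) (ht : j - σ ^ 2 ∈ Ioo ta tb) :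
    EB (gS vy vt Q j σ) :=
  ((EB.of_bdd (f := fun z => vy (Q + σ * z) (j - σ ^ 2)) ((m.cvy ht).measurable.comp (by fun_prop)) B
    fun z => m.bvy _ ht _).mul EB.id).add ((EB.of_bdd (f := fun z => vt (Q + σ * z) (j - σ ^ 2))
      ((m.mvt ht).comp (by fun_prop)) B fun z => m.bvt _ ht _).mul (EB.const _))

lemma eg (m : PMod v vy vyy vt ta tb M B R) (ht : j - σ ^ 2 ∈ Ioo ta tb) :
    EB (gg vyy vt Q j σ) :=
  ((EB.of_bdd (f := fun z => vt (Q + σ * z) (j - σ ^ 2)) ((m.mvt ht).comp (by fun_prop)) B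
    fun z => m.bvt _ ht _).sub (EB.of_bdd (f := fun z => vyy (Q + σ * z) (j - σ ^ 2))
      ((m.mvyy ht).comp (by fun_prop)) B fun z => m.bvyy _ ht _)).smul _

lemma dW (m : PMod v vy vyy vt ta tb M B R) (ht : j - σ ^ 2 ∈ Ioo ta tb) (z : ℝ) :
    HasDerivAt (fun s => v (Q + s * z) (j - s ^ 2)) (gS vy vt Q j σ z) σ := by
  refine m.tot (p := fun s => Q + s * z) (q := fun s => j - s ^ 2) ht ?_ ?_
  · simpa using ((hasDerivAt_id σ).mul_const z).const_add Q
  · simpa using (hasDerivAt_pow 2 σ).const_sub j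

lemma bS (m : PMod v vy vyy vt ta tb M B R) {s : ℝ} (hs : 0 < s) (hs1 : s < σ + 1) (ht : j - s ^ 2 ∈ Ioo ta tb) (z : ℝ) :
    |gS vy vt Q j s z| ≤ B * |z| + B * (2 * (σ + 1)) := by
  refine (abs_add_le _ _).trans ?_
  rw [abs_mul, abs_mul, abs_neg, abs_of_pos (by positivity : 0 < 2 * s)]
  have := m.hB
  gcongr
  · exact m.bvy _ ht _
  · exact m.bvt _ ht _

lemma dH (m : PMod v vy vyy vt ta tb M B R) (hσ : 0 < σ) (ht : j - σ ^ 2 ∈ Ioo ta tb) :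
    HasDerivAt (gH v Q j) (∫ z, 2 * (v (Q + σ * z) (j - σ ^ 2) * gS vy vt Q j σ z) ∂gm) σ := by
  have hb : EB fun z : ℝ => 2 * B * (B * |z| + B * (2 * (σ + 1))) :=
    ((EB.id.abs.smul B).add (EB.const _)).smul _
  refine (hasDerivAt_integral_of_dominated_loc_of_deriv_le (F := fun s z => v (Q + s * z) (j - s ^ 2) ^ 2)
    (F' := fun s z => 2 * (v (Q + s * z) (j - s ^ 2) * gS vy vt Q j s z))
    (nbhd hσ ht) ?_ (m.eW hσ ht).sq.int (((m.eW hσ ht).mul (m.eS ht)).smul 2).1.aestronglyMeasurable ?_ hb.int ?_).2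
  · filter_upwards [nbhd hσ ht] with s hs using (m.eW hs.1 hs.2.2).sq.1.aestronglyMeasurable
  · refine Eventually.of_forall fun z s hs => ?_
    rw [Real.norm_eq_abs, abs_mul, abs_mul, abs_two, mul_assoc]
    have := m.hB
    gcongr
    · exact m.bv _ hs.2.2 _
    · exact m.bS hs.1 hs.2.1 hs.2.2 z
  · refine Eventually.of_forall fun z s hs => ?_
    exact ((m.dW hs.2.2 z).pow 2).congr_deriv (by ring)

lemma dm (m : PMod v vy vyy vt ta tb M B R) (hσ : 0 < σ) (ht : j - σ ^ 2 ∈ Ioo ta tb) :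
    HasDerivAt (fun s => ∫ z, v (Q + s * z) (j - s ^ 2) ∂gm) (∫ z, gS vy vt Q j σ z ∂gm) σ := by
  have hb : EB fun z : ℝ => B * |z| + B * (2 * (σ + 1)) :=
    (EB.id.abs.smul B).add (EB.const _)
  refine (hasDerivAt_integral_of_dominated_loc_of_deriv_le (F := fun s z => v (Q + s * z) (j - s ^ 2))
    (F' := fun s z => gS vy vt Q j s z)
    (nbhd hσ ht) ?_ (m.eW hσ ht).int (m.eS ht).1.aestronglyMeasurable ?_ hb.int ?_).2
  · filter_upwards [nbhd hσ ht] with s hs using (m.eW hs.1 hs.2.2).1.aestronglyMeasurable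
  · exact Eventually.of_forall fun z s hs => m.bS hs.1 hs.2.1 hs.2.2 z
  · exact Eventually.of_forall fun z s hs => m.dW hs.2.2 z

lemma bQ (m : PMod v vy vyy vt ta tb M B R) {s : ℝ} (hs : 0 < s) (hs1 : s < σ + 1) (ht : j - s ^ 2 ∈ Ioo ta tb) (z : ℝ) :
    |gQ vy vyy Q j s z| ≤ (σ + 1) ^ 2 * B + |z| / 2 * ((σ + 1) * B) := by
  refine (abs_sub _ _).trans ?_
  rw [abs_mul, abs_mul, abs_mul, abs_of_pos hs, abs_of_pos (by positivity : 0 < s ^ 2), abs_div, abs_two]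
  have := m.hB
  gcongr
  · exact m.bvyy _ ht _
  · linarith
  · exact m.bvy _ ht _

lemma tQ (m : PMod v vy vyy vt ta tb M B R) (hσ : 0 < σ) (ht : j - σ ^ 2 ∈ Ioo ta tb) {z : ℝ} (hz : z ≠ -Q / σ) :
    ContinuousAt (fun s => gQ vy vyy Q j s z) σ := by
  have hne : Q + σ * z ≠ 0 := by
    intro h; apply hz; field_simp; linarith
  have hc : ContinuousAt (fun s : ℝ => (Q + s * z, j - s ^ 2)) σ := by fun_prop
  have h1 : ContinuousAt (fun s => vy (Q + s * z) (j - s ^ 2)) σ :=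
    ContinuousAt.comp (f := fun s : ℝ => (Q + s * z, j - s ^ 2))
      (m.cy.continuousAt (open'.mem_nhds (show j - σ ^ 2 ∈ Ioo ta tb from ht))) hc
  have ho : IsOpen {p : ℝ × ℝ | p.1 ≠ 0 ∧ p.2 ∈ Ioo ta tb} :=
    (isOpen_ne.preimage continuous_fst).inter open'
  have h2 : ContinuousAt (fun s => vyy (Q + s * z) (j - s ^ 2)) σ :=
    ContinuousAt.comp (f := fun s : ℝ => (Q + s * z, j - s ^ 2))
      (m.cyy.continuousAt (ho.mem_nhds ⟨hne, ht⟩)) hc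
  unfold gQ
  exact ((continuousAt_id.pow 2).mul h2).sub (continuousAt_const.mul (continuousAt_id.mul h1))

lemma dP (m : PMod v vy vyy vt ta tb M B R) (hσ : 0 < σ) (ht : j - σ ^ 2 ∈ Ioo ta tb) :
    HasDerivAt (gP vy Q j) (∫ z, -(2 * (gS vy vt Q j σ z * gQ vy vyy Q j σ z)) ∂gm) σ := by
  rw [hasDerivAt_iff_tendsto_slope]
  have hev : ∀ᶠ s in 𝓝[≠] σ, slope (gP vy Q j) σ s =
      ∫ z, -((s - σ)⁻¹ * (v (Q + s * z) (j - s ^ 2) - v (Q + σ * z) (j - σ ^ 2)) *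
        (gQ vy vyy Q j s z + gQ vy vyy Q j σ z)) ∂gm := by
    filter_upwards [nhdsWithin_le_nhds (nbhd hσ ht)] with s hs
    have S := m.slice ht Q σ hσ
    have S' := m.slice hs.2.2 Q s hs.1
    have b1 := S.bil S
    have b2 := S.bil S'
    have b3 := S'.bil S
    have b4 := S'.bil S'
    have c : ∀ z, σ * vy (Q + σ * z) (j - σ ^ 2) * (s * vy (Q + s * z) (j - s ^ 2)) =
      s * vy (Q + s * z) (j - s ^ 2) * (σ * vy (Q + σ * z) (j - σ ^ 2)) := fun z => mul_comm _ _
    simp only [c] at b3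
    have e : (fun z => -((s - σ)⁻¹ * (v (Q + s * z) (j - s ^ 2) - v (Q + σ * z) (j - σ ^ 2)) *
        (gQ vy vyy Q j s z + gQ vy vyy Q j σ z))) = fun z => -(s - σ)⁻¹ *
        (v (Q + s * z) (j - s ^ 2) * gQ vy vyy Q j s z + v (Q + s * z) (j - s ^ 2) * gQ vy vyy Q j σ z -
        (v (Q + σ * z) (j - σ ^ 2) * gQ vy vyy Q j s z + v (Q + σ * z) (j - σ ^ 2) * gQ vy vyy Q j σ z)) := by
      ext z; ring
    have i1 := (S'.e0.mul (m.eQ (Q := Q) hs.1 hs.2.2))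
    have i2 := (S'.e0.mul (m.eQ (Q := Q) hσ ht))
    have i3 := (S.e0.mul (m.eQ (Q := Q) hs.1 hs.2.2))
    have i4 := (S.e0.mul (m.eQ (Q := Q) hσ ht))
    rw [e, integral_const_mul, integral_sub (i1.add i2).int (i3.add i4).int, integral_add i1.int i2.int,
      integral_add i3.int i4.int]
    unfold gQ
    rw [b1, b2, b3, b4, slope_def_field, div_eq_inv_mul]
    unfold gP
    simp only [pow_two]
    ring
  refine Tendsto.congr' (EventuallyEq.symm hev) ?_
  have hb : EB fun z : ℝ => (B * |z| + B * (2 * σ + 1)) * (2 * ((σ + 1) ^ 2 * B + |z| / 2 * ((σ + 1) * B))) := by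
    refine ((EB.id.abs.smul B).add (EB.const _)).mul (((EB.const _).add ?_).smul 2)
    simpa [div_eq_inv_mul, mul_assoc, mul_comm, mul_left_comm] using EB.id.abs.smul (2⁻¹ * ((σ + 1) * B))
  refine tendsto_integral_filter_of_dominated_convergence _ ?_ ?_ hb.int ?_
  · filter_upwards [nhdsWithin_le_nhds (nbhd hσ ht)] with s hs
    exact (((((m.eW hs.1 hs.2.2).sub (m.eW hσ ht)).smul _).mul ((m.eQ hs.1 hs.2.2).add (m.eQ hσ ht))).neg).1.aestronglyMeasurable
  · filter_upwards [nhdsWithin_le_nhds (nbhd hσ ht), self_mem_nhdsWithin] with s hs hne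
    refine Eventually.of_forall fun z => ?_
    have hne' : 0 < |s - σ| := abs_pos.2 (sub_ne_zero.2 hne)
    rw [Real.norm_eq_abs, abs_neg, abs_mul, abs_mul, abs_inv]
    have hB := m.hB
    have l := m.lip (y := Q + s * z) (y' := Q + σ * z) hs.2.2 ht
    have l1 : |s - σ|⁻¹ * |v (Q + s * z) (j - s ^ 2) - v (Q + σ * z) (j - σ ^ 2)| ≤ B * |z| + B * (2 * σ + 1) := by
      rw [inv_mul_le_iff₀ hne']
      refine l.trans ?_
      rw [show Q + s * z - (Q + σ * z) = (s - σ) * z by ring,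
        show j - s ^ 2 - (j - σ ^ 2) = -((s - σ) * (s + σ)) by ring, abs_neg, abs_mul, abs_mul,
        abs_of_pos (by linarith [hs.1] : 0 < s + σ)]
      have : |s - σ| * (s + σ) ≤ |s - σ| * (2 * σ + 1) := by
        refine mul_le_mul_of_nonneg_left ?_ (abs_nonneg _); linarith [hs.2.1]
      nlinarith
    have l2 : |gQ vy vyy Q j s z + gQ vy vyy Q j σ z| ≤ 2 * ((σ + 1) ^ 2 * B + |z| / 2 * ((σ + 1) * B)) := by
      refine (abs_add_le _ _).trans ?_
      have := m.bQ (Q := Q) hs.1 hs.2.1 hs.2.2 z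
      have := m.bQ (Q := Q) (s := σ) (σ := σ) hσ (by linarith) ht z
      linarith
    exact mul_le_mul l1 l2 (abs_nonneg _) (by positivity)
  · have hae : ∀ᵐ z ∂gm, z ≠ -Q / σ := by
      have := nullSingletonClass_gaussianReal (μ := 0) (v := 2) (by norm_num)
      exact (measure_eq_zero_iff_ae_notMem.1 (measure_singleton (μ := gm) (-Q / σ)))
    filter_upwards [hae] with z hz
    have t1 := hasDerivAt_iff_tendsto_slope.1 (m.dW (Q := Q) ht z)
    have t2 : Tendsto (fun s => gQ vy vyy Q j s z) (𝓝[≠] σ) (𝓝 (gQ vy vyy Q j σ z)) :=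
      (m.tQ hσ ht hz).tendsto.mono_left nhdsWithin_le_nhds
    have t3 := (t1.mul (t2.add_const (gQ vy vyy Q j σ z))).neg
    have e2 : gS vy vt Q j σ z * (gQ vy vyy Q j σ z + gQ vy vyy Q j σ z) = 2 * (gS vy vt Q j σ z * gQ vy vyy Q j σ z) := by ring
    rw [e2] at t3
    refine t3.congr fun s => ?_
    rw [slope_def_field, div_eq_inv_mul]

end PMod

noncomputable def gN (v vy : ℝ → ℝ → ℝ) (Q j σ : ℝ) : ℝ := gP vy Q j σ / gH v Q j σ
noncomputable def gq (v vy vyy : ℝ → ℝ → ℝ) (Q j σ z : ℝ) : ℝ :=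
  gQ vy vyy Q j σ z + gN v vy Q j σ * v (Q + σ * z) (j - σ ^ 2)
noncomputable def gD (v vy vyy : ℝ → ℝ → ℝ) (Q j σ : ℝ) : ℝ := ∫ z, gq v vy vyy Q j σ z ^ 2 ∂gm

namespace PMod
variable {v vy vyy vt : ℝ → ℝ → ℝ} {ta tb M B R : ℝ} {Q j σ : ℝ}

lemma eq (m : PMod v vy vyy vt ta tb M B R) (hσ : 0 < σ) (ht : j - σ ^ 2 ∈ Ioo ta tb) :
    EB (gq v vy vyy Q j σ) := (m.eQ hσ ht).add ((m.eW hσ ht).smul _)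

lemma gP_nonneg : 0 ≤ gP vy Q j σ := integral_nonneg fun _ => sq_nonneg _
lemma gH_nonneg : 0 ≤ gH v Q j σ := integral_nonneg fun _ => sq_nonneg _
lemma gD_nonneg : 0 ≤ gD v vy vyy Q j σ := integral_nonneg fun _ => sq_nonneg _
lemma gN_nonneg : 0 ≤ gN v vy Q j σ := div_nonneg gP_nonneg gH_nonneg

lemma H_low (m : PMod v vy vyy vt ta tb M B R) (hσ : 0 < σ) (ht : j - σ ^ 2 ∈ Ioo ta tb) :
    gm.real (Ici (R / σ)) ≤ gH v Q j σ := by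
  have key : ∀ A : Set ℝ, MeasurableSet A → (∀ z ∈ A, R ≤ |Q + σ * z|) → gm.real A ≤ gH v Q j σ := by
    intro A hA h
    rw [← integral_indicator_one hA]
    refine gm_int_le (EB.of_bdd (measurable_const.indicator hA) 1 fun z => ?_) (m.eW hσ ht).sq fun z => ?_
    · by_cases hz : z ∈ A <;> simp [hz]
    · by_cases hz : z ∈ A
      · have := m.far _ ht _ (h z hz)
        rw [← sq_abs, this]; simp [hz]
      · simp [hz, sq_nonneg]
  rcases le_total 0 Q with h | h
  · refine key _ measurableSet_Ici fun z hz => ?_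
    have : R ≤ σ * z := by rw [mul_comm]; exact (div_le_iff₀ hσ).1 hz
    exact le_trans (by linarith) (le_abs_self _)
  · have e : gm.real (Ici (R / σ)) = gm.real (Iic (-(R / σ))) := by
      have h1 : gm.map (fun x => -x) = gm := by
        rw [gaussianReal_map_neg, neg_zero]
      rw [← h1, map_measureReal_apply measurable_neg measurableSet_Ici, h1]
      congr 1; ext z; simp [le_neg]
    rw [e]
    refine key _ measurableSet_Iic fun z hz => ?_
    have : R ≤ σ * (-z) := by rw [mul_comm]; exact (div_le_iff₀ hσ).1 (by simpa [le_neg] using hz)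
    exact le_trans (by linarith) (neg_le_abs _)

lemma H_pos (m : PMod v vy vyy vt ta tb M B R) (hσ : 0 < σ) (ht : j - σ ^ 2 ∈ Ioo ta tb) :
    0 < gH v Q j σ := (gm_Ici_pos _).trans_le (m.H_low hσ ht)

lemma P_eq (m : PMod v vy vyy vt ta tb M B R) (hσ : 0 < σ) (ht : j - σ ^ 2 ∈ Ioo ta tb) :
    gP vy Q j σ = gN v vy Q j σ * gH v Q j σ :=
  (div_mul_cancel₀ _ (m.H_pos hσ ht).ne').symm

lemma S_eq (hσ : 0 < σ) (z : ℝ) :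
    gS vy vt Q j σ z = -(2 / σ) * gQ vy vyy Q j σ z - gg vyy vt Q j σ z := by
  unfold gS gQ gg; field_simp; ring

lemma ae_ne (c : ℝ) : ∀ᵐ z ∂gm, z ≠ c := by
  have := nullSingletonClass_gaussianReal (μ := 0) (v := 2) (by norm_num)
  exact (measure_eq_zero_iff_ae_notMem.1 (measure_singleton (μ := gm) c))

lemma bg (m : PMod v vy vyy vt ta tb M B R) (hσ : 0 < σ) (ht : j - σ ^ 2 ∈ Ioo ta tb) :
    ∀ᵐ z ∂gm, |gg vyy vt Q j σ z| ≤
      2 * M * (|σ * vy (Q + σ * z) (j - σ ^ 2)| + σ * |v (Q + σ * z) (j - σ ^ 2)|) := by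
  filter_upwards [ae_ne (-Q / σ)] with z hz
  have hne : Q + σ * z ≠ 0 := by
    intro h; apply hz; field_simp; linarith
  have := m.eqn _ ht _ hne
  unfold gg
  rw [abs_mul, abs_of_pos (by positivity : 0 < 2 * σ), abs_mul, abs_of_pos hσ]
  nlinarith

lemma intg (m : PMod v vy vyy vt ta tb M B R) (hσ : 0 < σ) (ht : j - σ ^ 2 ∈ Ioo ta tb) :
    ∫ z, gg vyy vt Q j σ z ^ 2 ∂gm ≤ 8 * M ^ 2 * (gP vy Q j σ + σ ^ 2 * gH v Q j σ) := by
  unfold gP gH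
  rw [← integral_const_mul, ← integral_add (m.eW1 hσ ht).sq.int ((m.eW hσ ht).sq.smul _).int, ← integral_const_mul]
  refine integral_mono_ae (m.eg ht).sq.int (((m.eW1 hσ ht).sq.add ((m.eW hσ ht).sq.smul _)).smul _).int ?_
  filter_upwards [m.bg (Q := Q) hσ ht] with z hz
  have h2 := pow_le_pow_left₀ (abs_nonneg _) hz 2
  rw [sq_abs] at h2
  refine h2.trans ?_
  set p := |σ * vy (Q + σ * z) (j - σ ^ 2)| with hp
  set w := |v (Q + σ * z) (j - σ ^ 2)| with hw
  have e1 : (σ * vy (Q + σ * z) (j - σ ^ 2)) ^ 2 = p ^ 2 := by rw [hp, sq_abs]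
  have e2 : (v (Q + σ * z) (j - σ ^ 2)) ^ 2 = w ^ 2 := by rw [hw, sq_abs]
  rw [e1, e2]
  nlinarith [mul_nonneg (sq_nonneg M) (sq_nonneg (p - σ * w))]

lemma intWq (m : PMod v vy vyy vt ta tb M B R) (hσ : 0 < σ) (ht : j - σ ^ 2 ∈ Ioo ta tb) :
    ∫ z, v (Q + σ * z) (j - σ ^ 2) * gq v vy vyy Q j σ z ∂gm = 0 := by
  have S := m.slice ht Q σ hσ
  have b := S.bil S
  have e : (fun z => v (Q + σ * z) (j - σ ^ 2) * gq v vy vyy Q j σ z) = fun z =>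
      v (Q + σ * z) (j - σ ^ 2) * gQ vy vyy Q j σ z + gN v vy Q j σ * v (Q + σ * z) (j - σ ^ 2) ^ 2 := by
    ext z; unfold gq; ring
  rw [e, integral_add (S.e0.mul (m.eQ hσ ht)).int (S.e0.sq.smul _).int, integral_const_mul]
  have p := m.P_eq (Q := Q) hσ ht
  unfold gQ
  rw [b]
  simp only [← pow_two]
  unfold gH gP at p
  linarith

lemma dN (m : PMod v vy vyy vt ta tb M B R) (hσ : 0 < σ) (ht : j - σ ^ 2 ∈ Ioo ta tb) :
    ∃ n', HasDerivAt (gN v vy Q j) n' σ ∧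
      (2 / σ) * (gD v vy vyy Q j σ / gH v Q j σ) - 4 * M ^ 2 * σ * (gN v vy Q j σ + σ ^ 2) ≤ n' := by
  have hp := m.H_pos (Q := Q) hσ ht
  have hd := (m.dP (Q := Q) hσ ht).div (m.dH (Q := Q) hσ ht) hp.ne'
  refine ⟨_, hd, ?_⟩
  have eS := m.eS (Q := Q) ht
  have eQ := m.eQ (Q := Q) hσ ht
  have eW := m.eW (Q := Q) hσ ht
  have eq := m.eq (Q := Q) hσ ht
  have eg := m.eg (Q := Q) ht
  set N := gN v vy Q j σ with hN
  set H := gH v Q j σ with hH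
  have hP : gP vy Q j σ = N * H := m.P_eq hσ ht
  have e1 : ∫ z, -2 * (gS vy vt Q j σ z * gq v vy vyy Q j σ z) ∂gm =
      (∫ z, -(2 * (gS vy vt Q j σ z * gQ vy vyy Q j σ z)) ∂gm) -
      N * ∫ z, 2 * (v (Q + σ * z) (j - σ ^ 2) * gS vy vt Q j σ z) ∂gm := by
    rw [← integral_const_mul, ← integral_sub ((eS.mul eQ).smul 2).neg.int (((eW.mul eS).smul 2).smul N).int]
    congr 1; ext z; unfold gq; ring
  have e2 : (2 / σ) * gD v vy vyy Q j σ - 4 * N / σ * 0 - σ / 2 * ∫ z, gg vyy vt Q j σ z ^ 2 ∂gm ≤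
      ∫ z, -2 * (gS vy vt Q j σ z * gq v vy vyy Q j σ z) ∂gm := by
    rw [← m.intWq (Q := Q) hσ ht]
    unfold gD
    rw [← integral_const_mul, ← integral_const_mul, ← integral_const_mul,
      ← integral_sub (eq.sq.smul _).int ((eW.mul eq).smul _).int,
      ← integral_sub ((eq.sq.smul _).sub ((eW.mul eq).smul _)).int (eg.sq.smul _).int]
    refine gm_int_le (((eq.sq.smul _).sub ((eW.mul eq).smul _)).sub (eg.sq.smul _)) ((eS.mul eq).smul _) fun z => ?_
    rw [S_eq (vyy := vyy) hσ z]
    have hq : gQ vy vyy Q j σ z = gq v vy vyy Q j σ z - N * v (Q + σ * z) (j - σ ^ 2) := by unfold gq; ring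
    rw [hq]
    generalize gq v vy vyy Q j σ z = q
    generalize gg vyy vt Q j σ z = g
    generalize v (Q + σ * z) (j - σ ^ 2) = w
    have : -2 * ((-(2 / σ) * (q - N * w) - g) * q) - (2 / σ * q ^ 2 - 4 * N / σ * (w * q) - σ / 2 * g ^ 2) =
        1 / (2 * σ) * (2 * q + σ * g) ^ 2 := by field_simp; ring
    have h2 : 0 ≤ 1 / (2 * σ) * (2 * q + σ * g) ^ 2 := by positivity
    linarith
  have e3 := m.intg (Q := Q) hσ ht
  rw [hP, ← hH] at e3
  rw [hP]
  set X := ∫ z, -(2 * (gS vy vt Q j σ z * gQ vy vyy Q j σ z)) ∂gm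
  set Y := ∫ z, 2 * (v (Q + σ * z) (j - σ ^ 2) * gS vy vt Q j σ z) ∂gm
  have e4 : (X * H - N * H * Y) / H ^ 2 = (X - N * Y) / H := by field_simp
  rw [e4, ← e1, le_div_iff₀ hp]
  refine le_trans ?_ e2
  have e5 : (2 / σ * (gD v vy vyy Q j σ / H) - 4 * M ^ 2 * σ * (N + σ ^ 2)) * H =
    2 / σ * gD v vy vyy Q j σ - σ / 2 * (8 * M ^ 2 * (N * H + σ ^ 2 * H)) := by
    field_simp; ring
  rw [e5]
  have := mul_le_mul_of_nonneg_left e3 (by positivity : 0 ≤ σ / 2)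
  linarith

noncomputable def gE (v vy : ℝ → ℝ → ℝ) (M Q j σ : ℝ) : ℝ := exp (4 * M ^ 2 * σ) * (gN v vy Q j σ + 1)

lemma dE (m : PMod v vy vyy vt ta tb M B R) (hσ : 0 < σ) (h1 : σ ≤ 1) (ht : j - σ ^ 2 ∈ Ioo ta tb) :
    ∃ e', HasDerivAt (gE v vy M Q j) e' σ ∧ (2 / σ) * (gD v vy vyy Q j σ / gH v Q j σ) ≤ e' := by
  obtain ⟨n', h, hn⟩ := m.dN (Q := Q) hσ ht
  have hx : HasDerivAt (fun s : ℝ => exp (4 * M ^ 2 * s)) (exp (4 * M ^ 2 * σ) * (4 * M ^ 2)) σ := by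
    simpa using ((hasDerivAt_id σ).const_mul (4 * M ^ 2)).exp
  refine ⟨_, hx.mul (h.add_const 1), ?_⟩
  have hN : 0 ≤ gN v vy Q j σ := gN_nonneg
  have hD : 0 ≤ (2 / σ) * (gD v vy vyy Q j σ / gH v Q j σ) :=
    mul_nonneg (by positivity) (div_nonneg gD_nonneg gH_nonneg)
  set D := (2 / σ) * (gD v vy vyy Q j σ / gH v Q j σ)
  have he : 1 ≤ exp (4 * M ^ 2 * σ) := Real.one_le_exp (by positivity)
  have : D ≤ n' + 4 * M ^ 2 * (gN v vy Q j σ + 1) := by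
    have h2 : σ * (gN v vy Q j σ + σ ^ 2) ≤ gN v vy Q j σ + 1 := by nlinarith
    nlinarith [mul_le_mul_of_nonneg_left h2 (by positivity : 0 ≤ 4 * M ^ 2)]
  calc D ≤ exp (4 * M ^ 2 * σ) * D := le_mul_of_one_le_left hD he
    _ ≤ exp (4 * M ^ 2 * σ) * (n' + 4 * M ^ 2 * (gN v vy Q j σ + 1)) := by gcongr
    _ = _ := by ring

lemma dH_le (m : PMod v vy vyy vt ta tb M B R) (hσ : 0 < σ) (h1 : σ ≤ 1) (ht : j - σ ^ 2 ∈ Ioo ta tb) :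
    ∃ h', HasDerivAt (gH v Q j) h' σ ∧
      h' ≤ (4 * gN v vy Q j σ / σ + 2 * M * (3 + gN v vy Q j σ)) * gH v Q j σ ∧
      -(M ^ 2 + 4 * M) * gH v Q j σ ≤ h' := by
  refine ⟨_, m.dH hσ ht, ?_⟩
  have S := m.slice ht Q σ hσ
  have b := S.bil S
  have hM := m.hM
  have eW := S.e0
  have eW1 := S.e1
  have eg := m.eg (Q := Q) ht
  have eQ := m.eQ (Q := Q) hσ ht
  have hP := m.P_eq (Q := Q) hσ ht
  have hbg := m.bg (Q := Q) hσ ht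
  have e1 : ∫ z, 2 * (v (Q + σ * z) (j - σ ^ 2) * gS vy vt Q j σ z) ∂gm =
      4 / σ * gP vy Q j σ - 2 * ∫ z, v (Q + σ * z) (j - σ ^ 2) * gg vyy vt Q j σ z ∂gm := by
    have : 4 / σ * gP vy Q j σ = -(4 / σ) * ∫ z, v (Q + σ * z) (j - σ ^ 2) * gQ vy vyy Q j σ z ∂gm := by
      unfold gQ gP; rw [b]; simp only [← pow_two]; ring
    rw [this, ← integral_const_mul, ← integral_const_mul, ← integral_sub ((eW.mul eQ).smul _).int ((eW.mul eg).smul _).int]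
    congr 1; ext z; rw [S_eq (vyy := vyy) hσ z]; field_simp; ring
  have hH : 0 ≤ gH v Q j σ := gH_nonneg
  rw [e1]
  constructor
  · have : -2 * ∫ z, v (Q + σ * z) (j - σ ^ 2) * gg vyy vt Q j σ z ∂gm ≤
        2 * M * (3 * gH v Q j σ + gP vy Q j σ) := by
      unfold gH gP
      rw [← integral_const_mul, ← integral_const_mul, ← integral_add (eW.sq.smul _).int eW1.sq.int, ← integral_const_mul]
      refine integral_mono_ae ((eW.mul eg).smul _).int (((eW.sq.smul _).add eW1.sq).smul _).int ?_
      filter_upwards [hbg] with z hz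
      have h3 : -2 * (v (Q + σ * z) (j - σ ^ 2) * gg vyy vt Q j σ z) ≤
        2 * (|v (Q + σ * z) (j - σ ^ 2)| * |gg vyy vt Q j σ z|) := by
        rw [← abs_mul]; linarith [neg_le_abs (v (Q + σ * z) (j - σ ^ 2) * gg vyy vt Q j σ z)]
      have h4 := mul_le_mul_of_nonneg_left hz (abs_nonneg (v (Q + σ * z) (j - σ ^ 2)))
      set p := |σ * vy (Q + σ * z) (j - σ ^ 2)| with hp
      set w := |v (Q + σ * z) (j - σ ^ 2)| with hw
      have e1 : (σ * vy (Q + σ * z) (j - σ ^ 2)) ^ 2 = p ^ 2 := by rw [hp, sq_abs]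
      have e2 : (v (Q + σ * z) (j - σ ^ 2)) ^ 2 = w ^ 2 := by rw [hw, sq_abs]
      rw [e1, e2]
      have h5 : M * (2 * (w * p)) ≤ M * (w ^ 2 + p ^ 2) :=
        mul_le_mul_of_nonneg_left (by nlinarith [sq_nonneg (w - p)]) hM
      have h6 : M * (σ * w ^ 2) ≤ M * w ^ 2 := mul_le_mul_of_nonneg_left (by nlinarith [sq_nonneg w]) hM
      nlinarith
    rw [hP] at this ⊢
    have e3 : 4 / σ * (gN v vy Q j σ * gH v Q j σ) = 4 * gN v vy Q j σ / σ * gH v Q j σ := by ring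
    rw [e3]; linarith
  · have : -(M ^ 2 + 4 * M) * gH v Q j σ - 4 / σ * gP vy Q j σ ≤
        -2 * ∫ z, v (Q + σ * z) (j - σ ^ 2) * gg vyy vt Q j σ z ∂gm := by
      unfold gH gP
      rw [← integral_const_mul, ← integral_const_mul, ← integral_const_mul, ← integral_sub (eW.sq.smul _).int (eW1.sq.smul _).int]
      refine integral_mono_ae ((eW.sq.smul _).sub (eW1.sq.smul _)).int ((eW.mul eg).smul _).int ?_
      filter_upwards [hbg] with z hz
      have h3 : -(2 * (|v (Q + σ * z) (j - σ ^ 2)| * |gg vyy vt Q j σ z|)) ≤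
          -2 * (v (Q + σ * z) (j - σ ^ 2) * gg vyy vt Q j σ z) := by
        rw [← abs_mul]; linarith [le_abs_self (v (Q + σ * z) (j - σ ^ 2) * gg vyy vt Q j σ z)]
      have h4 := mul_le_mul_of_nonneg_left hz (abs_nonneg (v (Q + σ * z) (j - σ ^ 2)))
      refine le_trans ?_ h3
      set p := |σ * vy (Q + σ * z) (j - σ ^ 2)| with hp
      set w := |v (Q + σ * z) (j - σ ^ 2)| with hw
      have e1 : (σ * vy (Q + σ * z) (j - σ ^ 2)) ^ 2 = p ^ 2 := by rw [hp, sq_abs]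
      have e2 : (v (Q + σ * z) (j - σ ^ 2)) ^ 2 = w ^ 2 := by rw [hw, sq_abs]
      rw [e1, e2]
      have h5 : 4 * M * (w * p) ≤ M ^ 2 * σ * w ^ 2 + 4 / σ * p ^ 2 := by
        have : M ^ 2 * σ * w ^ 2 + 4 / σ * p ^ 2 - 4 * M * (w * p) = 1 / σ * (M * σ * w - 2 * p) ^ 2 := by
          field_simp; ring
        have : 0 ≤ 1 / σ * (M * σ * w - 2 * p) ^ 2 := by positivity
        linarith
      have h6 : M * (σ * w ^ 2) ≤ M * w ^ 2 := mul_le_mul_of_nonneg_left (by nlinarith [sq_nonneg w]) hM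
      have h7 : M ^ 2 * (σ * w ^ 2) ≤ M ^ 2 * w ^ 2 := mul_le_mul_of_nonneg_left (by nlinarith [sq_nonneg w]) (sq_nonneg M)
      nlinarith
    linarith

end PMod

lemma gron_le {f f' : ℝ → ℝ} {a b c : ℝ} (hab : a ≤ b) (h : ∀ s ∈ Icc a b, HasDerivAt f (f' s) s)
    (h2 : ∀ s ∈ Icc a b, f' s ≤ c * f s) : f b ≤ exp (c * (b - a)) * f a := by
  have hd : ∀ s ∈ Icc a b, HasDerivAt (fun s => exp (-(c * (s - a))) * f s)
      (exp (-(c * (s - a))) * (-c) * f s + exp (-(c * (s - a))) * f' s) s := by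
    intro s hs
    have : HasDerivAt (fun s : ℝ => -(c * (s - a))) (-c) s := by
      exact ((((hasDerivAt_id s).sub_const a).const_mul c).fun_neg).congr_deriv (by simp)
    exact this.exp.mul (h s hs)
  have anti : AntitoneOn (fun s => exp (-(c * (s - a))) * f s) (Icc a b) := by
    refine antitoneOn_of_deriv_nonpos (convex_Icc a b) (fun s hs => (hd s hs).continuousAt.continuousWithinAt) ?_ ?_
    · intro s hs; rw [interior_Icc] at hs
      exact (hd s (Ioo_subset_Icc_self hs)).differentiableAt.differentiableWithinAt
    · intro s hs; rw [interior_Icc] at hs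
      have hs' := Ioo_subset_Icc_self hs
      rw [(hd s hs').deriv]
      nlinarith [h2 s hs', Real.exp_pos (-(c * (s - a)))]
  have := anti (left_mem_Icc.2 hab) (right_mem_Icc.2 hab) hab
  simp only [sub_self, mul_zero, neg_zero, Real.exp_zero, one_mul] at this
  rw [Real.exp_neg, inv_mul_le_iff₀ (Real.exp_pos _)] at this
  exact this

lemma gron_ge {f f' : ℝ → ℝ} {a b c : ℝ} (hab : a ≤ b) (h : ∀ s ∈ Icc a b, HasDerivAt f (f' s) s)
    (h2 : ∀ s ∈ Icc a b, -c * f s ≤ f' s) : f a ≤ exp (c * (b - a)) * f b := by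
  have := gron_le (f := fun s => f (-s)) (f' := fun s => -f' (-s)) (a := -b) (b := -a) (c := c) (by linarith)
    (fun s hs => by
      have h3 := h (-s) ⟨by linarith [hs.2], by linarith [hs.1]⟩
      exact (HasDerivAt.comp s h3 (hasDerivAt_neg s)).congr_deriv (by ring))
    (fun s hs => by have := h2 (-s) ⟨by linarith [hs.2], by linarith [hs.1]⟩; linarith)
  simp only [neg_neg] at this
  rwa [show -a - -b = b - a by ring] at this

namespace PMod
variable {v vy vyy vt : ℝ → ℝ → ℝ} {ta tb M B R : ℝ} {Q j σ J : ℝ}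

lemma tmem (h1 : j ∈ Ioo (ta + J ^ 2) tb) (hs : σ ∈ Ioc 0 J) : j - σ ^ 2 ∈ Ioo ta tb := by
  have : σ ^ 2 ≤ J ^ 2 := pow_le_pow_left₀ hs.1.le hs.2 2
  have : 0 < σ ^ 2 := pow_pos hs.1 2
  exact ⟨by linarith [h1.1], by linarith [h1.2]⟩

lemma monoE (m : PMod v vy vyy vt ta tb M B R) (hσ1 : J ≤ 1) (h1 : j ∈ Ioo (ta + J ^ 2) tb) :
    MonotoneOn (gE v vy M Q j) (Ioc 0 J) := by
  have hd : ∀ s ∈ Ioc 0 J, ∃ e', HasDerivAt (gE v vy M Q j) e' s ∧ 0 ≤ e' := by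
    intro s hs
    obtain ⟨e', h, he⟩ := m.dE (Q := Q) hs.1 (hs.2.trans hσ1) (tmem h1 hs)
    have := hs.1
    exact ⟨e', h, le_trans (mul_nonneg (by positivity) (div_nonneg gD_nonneg gH_nonneg)) he⟩
  refine monotoneOn_of_deriv_nonneg (convex_Ioc 0 J) (fun s hs => ?_) ?_ ?_
  · obtain ⟨e', h, he⟩ := hd s hs
    exact h.continuousAt.continuousWithinAt
  · intro s hs
    obtain ⟨e', h, he⟩ := hd s (interior_subset hs)
    exact h.differentiableAt.differentiableWithinAt
  · intro s hs
    obtain ⟨e', h, he⟩ := hd s (interior_subset hs)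
    rw [h.deriv]; exact he

lemma exists_K (m : PMod v vy vyy vt ta tb M B R) (h0 : 0 < J) (hσ1 : J ≤ 1) :
    ∃ K : ℕ, ∀ Q, ∀ j ∈ Ioo (ta + J ^ 2) tb, ∀ σ ∈ Ioc 0 J, gN v vy Q j σ ≤ K := by
  obtain ⟨K, hK⟩ := exists_nat_ge (exp (4 * M ^ 2 * J) * (B ^ 2 / gm.real (Ici (R / J)) + 1))
  refine ⟨K, fun Q j ht σ hs => le_trans ?_ hK⟩
  have hm := m.monoE (Q := Q) hσ1 ht hs ⟨h0, le_rfl⟩ hs.2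
  have hN : 0 ≤ gN v vy Q j σ := gN_nonneg
  have e1 : gN v vy Q j σ ≤ gE v vy M Q j σ := by
    unfold gE
    have : 1 ≤ exp (4 * M ^ 2 * σ) := Real.one_le_exp (by have := hs.1; positivity)
    nlinarith
  refine e1.trans (hm.trans ?_)
  unfold gE
  have ht1 := tmem ht ⟨h0, le_rfl⟩
  gcongr
  unfold gN
  have hp : gP vy Q j J ≤ B ^ 2 := by
    have := gm_int_le (m.eW1 (Q := Q) h0 ht1).sq (EB.const (B ^ 2)) fun z => by
      rw [← sq_abs]
      refine pow_le_pow_left₀ (abs_nonneg _) ?_ 2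
      rw [abs_mul, abs_of_pos h0]
      have := m.bvy _ ht1 (Q + J * z)
      nlinarith [abs_nonneg (vy (Q + J * z) (j - J ^ 2))]
    unfold gP; simpa using this
  exact div_le_div₀ (by positivity) hp (gm_Ici_pos _) (m.H_low h0 ht1)
end PMod

structure Ctx (v vy vyy vt : ℝ → ℝ → ℝ) (ta tb M B R J : ℝ) (K : ℕ) : Prop where
  m : PMod v vy vyy vt ta tb M B R
  p1 : 0 < J
  l1 : J ≤ 1
  hN : ∀ Q, ∀ j ∈ Ioo (ta + J ^ 2) tb, ∀ σ ∈ Ioc 0 J, gN v vy Q j σ ≤ K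

namespace Ctx
open PMod
variable {v vy vyy vt : ℝ → ℝ → ℝ} {ta tb M B R : ℝ} {Q j σ σ' J : ℝ} {K : ℕ}

lemma doub (c : Ctx v vy vyy vt ta tb M B R J K) (ht : j ∈ Ioo (ta + J ^ 2) tb) {p : ℕ}
    (h0 : 0 < σ) (h1 : σ ≤ σ') (h2 : σ' ≤ J) (hN : ∀ s ∈ Icc σ σ', gN v vy Q j s ≤ p / 4) :
    (σ / σ') ^ p * gH v Q j σ' ≤ exp (2 * M * (3 + p / 4)) * gH v Q j σ := by
  have m := c.m
  have hM := m.hM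
  have hd : ∀ s ∈ Icc σ σ', ∃ h', HasDerivAt (gH v Q j) h' s ∧ h' ≤ (p / s + 2 * M * (3 + p / 4)) * gH v Q j s := by
    intro s hs
    have hs0 : 0 < s := h0.trans_le hs.1
    obtain ⟨h', hh, hl, -⟩ := m.dH_le (Q := Q) hs0 ((hs.2.trans h2).trans c.l1) (tmem ht ⟨hs0, hs.2.trans h2⟩)
    refine ⟨h', hh, hl.trans (mul_le_mul_of_nonneg_right ?_ gH_nonneg)⟩
    have h3 := hN s hs
    have : 4 * gN v vy Q j s / s ≤ p / s := by gcongr; linarith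
    have : 2 * M * (3 + gN v vy Q j s) ≤ 2 * M * (3 + p / 4) := by gcongr
    linarith
  choose! h' hh hl using hd
  have hpd : ∀ s ∈ Icc σ σ', HasDerivAt (fun s => (s ^ p)⁻¹ * gH v Q j s)
      (-(p * s ^ (p - 1)) / (s ^ p) ^ 2 * gH v Q j s + (s ^ p)⁻¹ * h' s) s := by
    intro s hs
    have hs0 : 0 < s := h0.trans_le hs.1
    exact ((hasDerivAt_pow p s).fun_inv (by positivity)).mul (hh s hs)
  have key := gron_le h1 hpd (c := 2 * M * (3 + p / 4)) (fun s hs => by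
    have hs0 : 0 < s := h0.trans_le hs.1
    have e : (p * s ^ (p - 1)) / (s ^ p) ^ 2 = (s ^ p)⁻¹ * (p / s) := by
      rcases Nat.eq_zero_or_pos p with hp | hp
      · simp [hp]
      · obtain ⟨q, rfl⟩ := Nat.exists_eq_add_of_lt hp
        field_simp
        simp
        ring
    rw [neg_div, e]
    have := mul_le_mul_of_nonneg_left (hl s hs) (by positivity : 0 ≤ (s ^ p)⁻¹)
    nlinarith)
  have hσ' : 0 < σ' := h0.trans_le h1
  have hH : 0 ≤ gH v Q j σ := gH_nonneg
  have e2 : exp (2 * M * (3 + p / 4) * (σ' - σ)) ≤ exp (2 * M * (3 + p / 4)) := by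
    refine Real.exp_le_exp.2 (mul_le_of_le_one_right (by positivity) ?_)
    linarith [c.l1]
  have key2 := key.trans (mul_le_mul_of_nonneg_right e2 (by positivity))
  have := mul_le_mul_of_nonneg_left key2 (by positivity : 0 ≤ σ ^ p)
  calc (σ / σ') ^ p * gH v Q j σ' = σ ^ p * ((σ' ^ p)⁻¹ * gH v Q j σ') := by rw [div_pow]; ring
    _ ≤ _ := this
    _ = _ := by field_simp

lemma Hmono (c : Ctx v vy vyy vt ta tb M B R J K) (ht : j ∈ Ioo (ta + J ^ 2) tb)
    (h0 : 0 < σ) (h1 : σ ≤ σ') (h2 : σ' ≤ J) :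
    gH v Q j σ ≤ exp (M ^ 2 + 4 * M) * gH v Q j σ' := by
  have m := c.m
  have hM := m.hM
  have hd : ∀ s ∈ Icc σ σ', ∃ h', HasDerivAt (gH v Q j) h' s ∧ -(M ^ 2 + 4 * M) * gH v Q j s ≤ h' := by
    intro s hs
    have hs0 : 0 < s := h0.trans_le hs.1
    obtain ⟨h', hh, -, hl⟩ := m.dH_le (Q := Q) hs0 ((hs.2.trans h2).trans c.l1) (tmem ht ⟨hs0, hs.2.trans h2⟩)
    exact ⟨h', hh, hl⟩
  choose! h' hh hl using hd
  refine (gron_ge h1 hh hl).trans (mul_le_mul_of_nonneg_right (Real.exp_le_exp.2 ?_) gH_nonneg)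
  refine mul_le_of_le_one_right (by positivity) ?_
  linarith [c.l1]

lemma lip0 (c : Ctx v vy vyy vt ta tb M B R J K) (ht : j ∈ Ioo (ta + J ^ 2) tb)
    (hs : σ ∈ Ioc 0 J) (z : ℝ) : |v (Q + σ * z) (j - σ ^ 2) - v Q j| ≤ B * σ * (|z| + 1) := by
  have m := c.m
  have ht0 : j ∈ Ioo ta tb := ⟨by nlinarith [ht.1, sq_nonneg J], ht.2⟩
  refine (m.lip (tmem ht hs) ht0).trans ?_
  rw [show Q + σ * z - Q = σ * z by ring, show j - σ ^ 2 - j = -(σ ^ 2) by ring, abs_neg, abs_mul,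
    abs_of_pos hs.1, abs_of_pos (pow_pos hs.1 2)]
  have h1 : σ ^ 2 ≤ σ := by nlinarith [hs.1, hs.2.trans c.l1]
  nlinarith [mul_le_mul_of_nonneg_left h1 m.hB]

lemma point (c : Ctx v vy vyy vt ta tb M B R J K) (ht : j ∈ Ioo (ta + J ^ 2) tb) (hs : σ ∈ Ioc 0 J) :
    v Q j ^ 2 ≤ exp (M ^ 2 + 4 * M) * gH v Q j σ := by
  have m := c.m
  have ht0 : j ∈ Ioo ta tb := ⟨by nlinarith [ht.1, sq_nonneg J], ht.2⟩
  set A := ∫ z, 2 * B * (B * (|z| + 1)) ∂gm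
  have hA : EB fun z : ℝ => 2 * B * (B * (|z| + 1)) := ((EB.id.abs.add (EB.const 1)).smul B).smul _
  have key : ∀ s ∈ Ioc 0 σ, v Q j ^ 2 ≤ exp (M ^ 2 + 4 * M) * gH v Q j σ + A * s := by
    intro s hs'
    have hs1 : s ∈ Ioc 0 J := ⟨hs'.1, hs'.2.trans hs.2⟩
    have hW := m.eW (Q := Q) hs'.1 (tmem ht hs1)
    have h1 := gm_int_le (EB.const (v Q j ^ 2)) (hW.sq.add (hA.smul s)) fun z => by
      have l := c.lip0 (Q := Q) ht hs1 z
      have b1 := m.bv _ ht0 Q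
      have b2 := m.bv _ (tmem ht hs1) (Q + s * z)
      set w := v (Q + s * z) (j - s ^ 2)
      have : v Q j ^ 2 - w ^ 2 ≤ |w - v Q j| * (2 * B) := by
        have e : v Q j ^ 2 - w ^ 2 = -(w - v Q j) * (w + v Q j) := by ring
        rw [e]
        refine (le_abs_self _).trans ?_
        rw [abs_mul, abs_neg]
        refine mul_le_mul_of_nonneg_left ?_ (abs_nonneg _)
        exact (abs_add_le _ _).trans (by linarith)
      nlinarith [mul_le_mul_of_nonneg_right l (by linarith [m.hB] : 0 ≤ 2 * B)]
    rw [integral_add hW.sq.int (hA.smul s).int, integral_const_mul] at h1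
    have h2 := c.Hmono (Q := Q) ht hs'.1 hs'.2 hs.2
    have h3 : v Q j ^ 2 ≤ gH v Q j s + s * A := by simpa [gH] using h1
    linarith
  have ht2 : Tendsto (fun s : ℝ => exp (M ^ 2 + 4 * M) * gH v Q j σ + A * s) (𝓝[>] 0)
      (𝓝 (exp (M ^ 2 + 4 * M) * gH v Q j σ)) := by
    have : ContinuousAt (fun s : ℝ => exp (M ^ 2 + 4 * M) * gH v Q j σ + A * s) 0 := by fun_prop
    simpa [ContinuousAt] using this.tendsto.mono_left (nhdsWithin_le_nhds (s := Ioi 0))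
  refine ge_of_tendsto ht2 ?_
  filter_upwards [Ioc_mem_nhdsGT hs.1] with s hs using key s hs

lemma dshift (m : PMod v vy vyy vt ta tb M B R) (hσ : 0 < σ) (ht : j - σ ^ 2 ∈ Ioo ta tb) (y : ℝ) :
    HasDerivAt (fun y => gH v y j σ) (∫ z, 2 * (v (y + σ * z) (j - σ ^ 2) * vy (y + σ * z) (j - σ ^ 2)) ∂gm) y := by
  refine (hasDerivAt_integral_of_dominated_loc_of_deriv_le (F := fun y z => v (y + σ * z) (j - σ ^ 2) ^ 2)
    (F' := fun y z => 2 * (v (y + σ * z) (j - σ ^ 2) * vy (y + σ * z) (j - σ ^ 2)))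
    (s := univ) univ_mem ?_ (m.eW hσ ht).sq.int ?_ ?_ (EB.const (2 * (B * B))).int ?_).2
  · exact Eventually.of_forall fun s => (m.eW hσ ht).sq.1.aestronglyMeasurable
  · refine Measurable.aestronglyMeasurable ?_
    have h1 : Measurable fun z => v (y + σ * z) (j - σ ^ 2) := (m.eW hσ ht).1
    have h2 : Measurable fun z => vy (y + σ * z) (j - σ ^ 2) := (m.cvy ht).measurable.comp (by fun_prop)
    exact (h1.mul h2).const_mul 2
  · refine Eventually.of_forall fun z s hs => ?_
    rw [Real.norm_eq_abs, abs_mul, abs_mul, abs_two]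
    have := m.hB
    gcongr
    · exact m.bv _ ht _
    · exact m.bvy _ ht _
  · refine Eventually.of_forall fun z s hs => ?_
    have := (m.tot (p := fun y => y + σ * z) (q := fun _ => j - σ ^ 2) (s := s) ht
      ((hasDerivAt_id s).add_const _) (hasDerivAt_const _ _)).pow 2
    exact this.congr_deriv (by simp; ring)

lemma shift (c : Ctx v vy vyy vt ta tb M B R J K) (ht : j ∈ Ioo (ta + J ^ 2) tb) (hs : σ ∈ Ioc 0 J) (y : ℝ) :
    gH v y j σ ≤ exp ((1 + K) * |y - Q| / σ) * gH v Q j σ := by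
  have m := c.m
  have h0 := hs.1
  have htm := tmem ht hs
  have hb : ∀ y, |∫ z, 2 * (v (y + σ * z) (j - σ ^ 2) * vy (y + σ * z) (j - σ ^ 2)) ∂gm| ≤ (1 + K) / σ * gH v y j σ := by
    intro y
    have hN := c.hN y j ht σ hs
    have hP := m.P_eq (Q := y) h0 htm
    have hH : 0 ≤ gH v y j σ := gH_nonneg
    have h1 : |∫ z, 2 * (v (y + σ * z) (j - σ ^ 2) * vy (y + σ * z) (j - σ ^ 2)) ∂gm| ≤ σ⁻¹ * (gH v y j σ + gP vy y j σ) := by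
      unfold gH gP
      rw [← integral_add (m.eW h0 htm).sq.int (m.eW1 h0 htm).sq.int, ← integral_const_mul]
      refine abs_integral_le_integral_abs.trans ?_
      have e1 : EB fun z => 2 * (v (y + σ * z) (j - σ ^ 2) * vy (y + σ * z) (j - σ ^ 2)) :=
        ((m.eW h0 htm).mul (EB.of_bdd (f := fun z => vy (y + σ * z) (j - σ ^ 2)) ((m.cvy htm).measurable.comp (by fun_prop)) B fun z => m.bvy _ htm _)).smul 2
      refine gm_int_le e1.abs (((m.eW h0 htm).sq.add (m.eW1 h0 htm).sq).smul _) fun z => ?_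
      generalize v (y + σ * z) (j - σ ^ 2) = a
      generalize vy (y + σ * z) (j - σ ^ 2) = b
      rw [le_inv_mul_iff₀ h0, ← abs_of_pos h0, ← abs_mul, abs_of_pos h0]
      refine abs_le.2 ⟨?_, ?_⟩ <;> nlinarith [sq_nonneg (a - σ * b), sq_nonneg (a + σ * b)]
    refine h1.trans ?_
    rw [hP, div_eq_inv_mul, mul_assoc]
    refine mul_le_mul_of_nonneg_left ?_ (by positivity)
    nlinarith
  rcases le_total Q y with h | h
  · have := gron_le h (fun s _ => dshift m h0 htm s) (fun s _ => (le_abs_self _).trans (hb s))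
    rw [abs_of_nonneg (by linarith)]
    rwa [div_mul_eq_mul_div] at this
  · have := gron_ge h (c := (1 + K) / σ) (fun s _ => dshift m h0 htm s) (fun s _ => by
      have := neg_le_of_abs_le (hb s); linarith)
    rw [abs_of_nonpos (by linarith), neg_sub]
    rwa [div_mul_eq_mul_div] at this

lemma dil (m : PMod v vy vyy vt ta tb M B R) {t0' ρ : ℝ} (hσ : 0 < σ) (hρ : σ ≤ ρ) (ht : j - σ ^ 2 ∈ Ioo ta tb)
    (he : t0' - ρ ^ 2 = j - σ ^ 2) : (σ / ρ) * gH v Q j σ ≤ gH v Q t0' ρ := by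
  have h := gm_dilate (φ := fun z => v (Q + σ * z) (j - σ ^ 2) ^ 2) (m.eW hσ ht).sq (fun z => sq_nonneg _)
    (κ := ρ / σ) ((one_le_div hσ).2 hρ)
  rw [inv_div] at h
  refine h.trans (le_of_eq ?_)
  unfold gH
  rw [he]
  congr 1; ext z
  rw [← mul_assoc, mul_div_cancel₀ _ hσ.ne']

noncomputable def C6 (M : ℝ) (K : ℕ) : ℝ := sqrt (8 * M ^ 2 * (K + 1) * exp (M ^ 2 + 4 * M))

lemma mean (c : Ctx v vy vyy vt ta tb M B R J K) (ht : j ∈ Ioo (ta + J ^ 2) tb) (hs : σ ∈ Ioc 0 J) :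
    |(∫ z, v (Q + σ * z) (j - σ ^ 2) ∂gm) - v Q j| ≤ C6 M K * σ * sqrt (gH v Q j σ) := by
  have m := c.m
  set mm : ℝ → ℝ := fun s => ∫ z, v (Q + s * z) (j - s ^ 2) ∂gm with hmm
  have hb : ∀ s ∈ Ioc 0 σ, |∫ z, gS vy vt Q j s z ∂gm| ≤ C6 M K * sqrt (gH v Q j σ) := by
    intro s hs'
    have hs1 : s ∈ Ioc 0 J := ⟨hs'.1, hs'.2.trans hs.2⟩
    have htm := tmem ht hs1
    have eQ := m.eQ (Q := Q) hs'.1 htm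
    have eg := m.eg (Q := Q) htm
    have e1 : ∫ z, gS vy vt Q j s z ∂gm = -∫ z, gg vyy vt Q j s z * 1 ∂gm := by
      have hq : ∫ z, gQ vy vyy Q j s z ∂gm = 0 := (m.slice htm Q s hs'.1).intQ
      simp only [S_eq (vyy := vyy) hs'.1, mul_one]
      rw [integral_sub (eQ.smul _).int eg.int, integral_const_mul, hq]; ring
    rw [e1, abs_neg]
    refine (gm_abs_cs eg (EB.const 1)).trans ?_
    simp only [one_pow, integral_const, probReal_univ, smul_eq_mul, mul_one, Real.sqrt_one]
    unfold C6
    rw [← Real.sqrt_mul (by positivity)]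
    refine Real.sqrt_le_sqrt ((m.intg hs'.1 htm).trans ?_)
    have hP := m.P_eq (Q := Q) hs'.1 htm
    have hN := c.hN Q j ht s hs1
    have hHm := c.Hmono (Q := Q) ht hs'.1 hs'.2 hs.2
    have hH : 0 ≤ gH v Q j s := gH_nonneg
    have h1 : gP vy Q j s + s ^ 2 * gH v Q j s ≤ (K + 1) * gH v Q j s := by
      rw [hP]
      have : s ^ 2 ≤ 1 := pow_le_one₀ hs'.1.le (hs1.2.trans c.l1)
      nlinarith
    calc 8 * M ^ 2 * (gP vy Q j s + s ^ 2 * gH v Q j s) ≤ 8 * M ^ 2 * ((K + 1) * gH v Q j s) := by gcongr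
      _ ≤ 8 * M ^ 2 * ((K + 1) * (exp (M ^ 2 + 4 * M) * gH v Q j σ)) := by gcongr
      _ = _ := by ring
  have hlip : ∀ s ∈ Ioc 0 σ, |mm σ - mm s| ≤ C6 M K * σ * sqrt (gH v Q j σ) := by
    intro s hs'
    have := (convex_Ioc 0 σ).norm_image_sub_le_of_norm_hasDerivWithin_le (f := mm)
      (fun s hs' => (m.dm (Q := Q) hs'.1 (tmem ht ⟨hs'.1, hs'.2.trans hs.2⟩)).hasDerivWithinAt) hb hs' ⟨hs.1, le_rfl⟩
    refine this.trans ?_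
    have h1 : ‖σ - s‖ ≤ σ := by rw [Real.norm_of_nonneg (by linarith [hs'.2])]; linarith [hs'.1]
    have : 0 ≤ C6 M K * sqrt (gH v Q j σ) := by unfold C6; positivity
    nlinarith
  have hlim : Tendsto mm (𝓝[>] 0) (𝓝 (v Q j)) := by
    have hA : EB fun z : ℝ => |z| + 1 := EB.id.abs.add (EB.const 1)
    rw [tendsto_iff_dist_tendsto_zero]
    have ht2 : Tendsto (fun s : ℝ => B * s * ∫ z, (|z| + 1) ∂gm) (𝓝[>] 0) (𝓝 0) := by
      have : ContinuousAt (fun s : ℝ => B * s * ∫ z, (|z| + 1) ∂gm) 0 := by fun_prop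
      simpa [ContinuousAt] using this.tendsto.mono_left (nhdsWithin_le_nhds (s := Ioi 0))
    refine squeeze_zero' (Eventually.of_forall fun _ => dist_nonneg) ?_ ht2
    filter_upwards [Ioc_mem_nhdsGT c.p1] with s hs'
    have hW := m.eW (Q := Q) hs'.1 (tmem ht hs')
    have e : mm s - v Q j = ∫ z, (v (Q + s * z) (j - s ^ 2) - v Q j) ∂gm := by
      rw [integral_sub hW.int (EB.const _).int]; simp [hmm]
    rw [Real.dist_eq, e, ← integral_const_mul]
    exact abs_integral_le_integral_abs.trans
      (gm_int_le (hW.sub (EB.const _)).abs (hA.smul _) fun z => c.lip0 ht hs' z)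
  refine le_of_tendsto ((tendsto_const_nhds (x := mm σ)).sub hlim).abs ?_
  filter_upwards [Ioc_mem_nhdsGT hs.1] with s hs' using hlip s hs'

lemma good (c : Ctx v vy vyy vt ta tb M B R J K) (ht : j ∈ Ioo (ta + J ^ 2) tb) {η : ℝ} (hη : 0 < η) :
    ∃ r0 > 0, 2 * r0 ≤ J ∧ ∀ r ∈ Ioc 0 r0, ∃ σ ∈ Ioo r (2 * r), gD v vy vyy Q j σ ≤ η * gH v Q j σ := by
  have m := c.m
  have mono := m.monoE (Q := Q) c.l1 ht
  set S := gE v vy M Q j '' Ioc 0 J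
  have hne : S.Nonempty := ⟨_, mem_image_of_mem _ ⟨c.p1, le_rfl⟩⟩
  have hbd : BddBelow S := ⟨0, by
    rintro _ ⟨s, -, rfl⟩
    have : 0 ≤ gN v vy Q j s := gN_nonneg
    unfold gE; positivity⟩
  obtain ⟨_, ⟨s, hs, rfl⟩, hlt⟩ := exists_lt_of_csInf_lt hne (lt_add_of_pos_right (sInf S) hη)
  refine ⟨s / 2, by linarith [hs.1], by linarith [hs.2], fun r hr => ?_⟩
  have hr2 : 2 * r ≤ s := by linarith [hr.2]
  have h2r : 2 * r ∈ Ioc 0 J := ⟨by linarith [hr.1], hr2.trans hs.2⟩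
  have hr1 : r ∈ Ioc 0 J := ⟨hr.1, by linarith [hr.1, h2r.2]⟩
  have hlt2 : gE v vy M Q j (2 * r) - gE v vy M Q j r < η := by
    have h1 := mono h2r hs hr2
    have h2 := csInf_le hbd (mem_image_of_mem (gE v vy M Q j) hr1)
    linarith
  have hd : ∀ x ∈ Icc r (2 * r), ∃ e', HasDerivAt (gE v vy M Q j) e' x ∧
      (2 / x) * (gD v vy vyy Q j x / gH v Q j x) ≤ e' := by
    intro x hx
    have hx1 : x ∈ Ioc 0 J := ⟨hr.1.trans_le hx.1, hx.2.trans h2r.2⟩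
    exact m.dE hx1.1 (hx1.2.trans c.l1) (tmem ht hx1)
  choose! e' he hl using hd
  obtain ⟨x, hx, hxe⟩ := exists_hasDerivAt_eq_slope (gE v vy M Q j) e' (by linarith [hr.1] : r < 2 * r)
    (fun x hx => (he x hx).continuousAt.continuousWithinAt) (fun x hx => he x (Ioo_subset_Icc_self hx))
  refine ⟨x, hx, ?_⟩
  have hx' := Ioo_subset_Icc_self hx
  have hx0 : 0 < x := hr.1.trans hx.1
  have hx1 : x ∈ Ioc 0 J := ⟨hx0, hx'.2.trans h2r.2⟩
  have hH := m.H_pos (Q := Q) hx0 (tmem ht hx1)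
  have h3 := hl x hx'
  rw [hxe, show 2 * r - r = r by ring, le_div_iff₀ hr.1] at h3
  have hq : 0 ≤ gD v vy vyy Q j x / gH v Q j x := div_nonneg gD_nonneg gH_nonneg
  have h4 : gD v vy vyy Q j x / gH v Q j x ≤ 2 / x * (gD v vy vyy Q j x / gH v Q j x) * r := by
    rw [mul_right_comm]
    refine le_mul_of_one_le_left hq ?_
    rw [div_mul_eq_mul_div, one_le_div hx0]; exact hx'.2
  rw [← div_le_iff₀ hH]
  linarith

end Ctx

namespace Ctx
open PMod
variable {v vy vyy vt : ℝ → ℝ → ℝ} {ta tb M B R : ℝ} {Q j σ σ' J : ℝ} {K : ℕ}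

lemma tmem0 (_c : Ctx v vy vyy vt ta tb M B R J K) (ht : j ∈ Ioo (ta + J ^ 2) tb) : j ∈ Ioo ta tb :=
  ⟨by nlinarith [ht.1, sq_nonneg J], ht.2⟩

lemma point' (c : Ctx v vy vyy vt ta tb M B R J K) (ht : j ∈ Ioo (ta + J ^ 2) tb) (hs : σ ∈ Ioc 0 J) (y : ℝ) :
    v y j ^ 2 ≤ exp (M ^ 2 + 4 * M) * (exp ((1 + K) * |y - Q| / σ) * gH v Q j σ) := by
  refine (c.point (Q := y) ht hs).trans ?_
  gcongr
  exact c.shift ht hs y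

lemma doubK (c : Ctx v vy vyy vt ta tb M B R J K) (ht : j ∈ Ioo (ta + J ^ 2) tb)
    (h0 : 0 < σ) (h1 : σ ≤ σ') (h2 : σ' ≤ J) :
    (σ / σ') ^ (4 * K) * gH v Q j σ' ≤ exp (2 * M * (3 + K)) * gH v Q j σ := by
  have e : ((4 * K : ℕ) : ℝ) / 4 = K := by push_cast; ring
  have := c.doub (Q := Q) ht (p := 4 * K) h0 h1 h2 (fun s hs => by
    rw [e]; exact c.hN _ _ ht s ⟨h0.trans_le hs.1, hs.2.trans h2⟩)
  rwa [e] at this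

/-- tail constant -/
noncomputable def ct (K : ℕ) : ℝ := ∫ z, (|z| ^ (4 * K + 1) * exp ((1 + K) * |z|)) ∂gm

lemma EBpow (n : ℕ) : EB (fun z => |z| ^ n) := by
  induction n with
  | zero => simpa using EB.const 1
  | succ n ih => simpa [pow_succ] using ih.mul EB.id.abs

lemma ebt (K : ℕ) : EB (fun z => |z| ^ (4 * K + 1) * exp ((1 + K) * |z|)) :=
  (EBpow _).mul (EB.exp _)

lemma ct_nonneg (K : ℕ) : 0 ≤ ct K := integral_nonneg fun z => by positivity

lemma up (c : Ctx v vy vyy vt ta tb M B R J K) (ht : j ∈ Ioo (ta + J ^ 2) tb) (hs : σ ∈ Ioc 0 J)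
    {y1 t1 κ w : ℝ} (hκ0 : 0 < κ) (hκ1 : κ ≤ 1) (hy1 : |y1 - Q| ≤ σ) (hw : ∀ y, |y - y1| ≤ σ / 4 → v y j ^ 2 ≤ w)
    (e1 : t1 - (κ * σ) ^ 2 = j) :
    gH v y1 t1 (κ * σ) ≤ w + exp (M ^ 2 + 4 * M) * exp (1 + K) * (4 * κ) ^ (4 * K + 1) * gH v Q j σ * ct K := by
  have hσ := hs.1
  set E0 := exp (M ^ 2 + 4 * M) with hE0
  have hEp : 0 < E0 := Real.exp_pos _
  set x := exp (1 + K) with hx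
  have hxp : 0 < x := Real.exp_pos _
  set H := gH v Q j σ with hH
  have hHp : 0 ≤ H := gH_nonneg
  clear_value H x E0
  have hw0 : 0 ≤ w := (sq_nonneg _).trans (hw y1 (by simp; positivity))
  have e2 : (w + E0 * x * (4 * κ) ^ (4 * K + 1) * H * ct K) =
      ∫ z, (w + E0 * x * (4 * κ) ^ (4 * K + 1) * H * (|z| ^ (4 * K + 1) * exp ((1 + K) * |z|))) ∂gm := by
    rw [integral_add (EB.const _).int ((ebt K).smul _).int, integral_const_mul]
    simp [ct]
  rw [e2]
  unfold gH
  simp only [e1]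
  refine gm_int_le ?_ ((EB.const _).add ((ebt K).smul _)) fun z => ?_
  · have := (c.m.eW (Q := y1) (j := t1) (σ := κ * σ) (by positivity) (by rw [e1]; exact c.tmem0 ht)).sq
    simpa only [e1] using this
  · by_cases hz : |κ * z| ≤ 1 / 4
    · refine (hw _ ?_).trans (le_add_of_nonneg_right (by positivity))
      rw [add_sub_cancel_left, show κ * σ * z = (κ * z) * σ by ring, abs_mul, abs_of_pos hσ]
      nlinarith
    · push Not at hz
      refine le_trans ?_ (le_add_of_nonneg_left hw0)
      refine (c.point' (Q := Q) ht hs _).trans ?_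
      rw [← hH, ← hE0]
      have hz' : 1 ≤ 4 * κ * |z| := by
        rw [abs_mul, abs_of_pos hκ0] at hz; linarith
      have hb : exp ((1 + K) * |y1 + κ * σ * z - Q| / σ) ≤ x * exp ((1 + K) * |z|) := by
        rw [hx, ← Real.exp_add, Real.exp_le_exp, div_le_iff₀ hσ]
        have : |y1 + κ * σ * z - Q| ≤ σ + |z| * σ := by
          rw [show y1 + κ * σ * z - Q = (y1 - Q) + κ * σ * z by ring]
          refine (abs_add_le _ _).trans ?_
          rw [abs_mul, abs_of_pos (show 0 < κ * σ by positivity)]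
          have := mul_le_mul_of_nonneg_right hκ1 (mul_nonneg hσ.le (abs_nonneg z))
          linarith
        calc (1 + (K : ℝ)) * |y1 + κ * σ * z - Q| ≤ (1 + K) * (σ + |z| * σ) := by gcongr
          _ = _ := by ring
      have h1 : (1 : ℝ) ≤ (4 * κ * |z|) ^ (4 * K + 1) := one_le_pow₀ hz'
      calc E0 * (exp ((1 + K) * |y1 + κ * σ * z - Q| / σ) * H)
          ≤ E0 * (x * exp ((1 + K) * |z|) * H) * 1 := by rw [mul_one]; gcongr
        _ ≤ E0 * (x * exp ((1 + K) * |z|) * H) * (4 * κ * |z|) ^ (4 * K + 1) := by gcongr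
        _ = _ := by rw [mul_pow]; ring

lemma low (c : Ctx v vy vyy vt ta tb M B R J K) : ∃ θ > 0, ∀ Q j σ y1 w, j ∈ Ioo (ta + J ^ 2) tb →
    0 < σ → 2 * σ ≤ J → j + σ ^ 2 < tb → |y1 - Q| ≤ σ → (∀ y, |y - y1| ≤ σ / 4 → v y j ^ 2 ≤ w) →
    θ * gH v Q j σ ≤ w := by
  set D := exp (2 * M * (3 + K)) with hD
  have hDp : 0 < D := Real.exp_pos _
  set E0 := exp (M ^ 2 + 4 * M) with hE0
  have hEp : 0 < E0 := Real.exp_pos _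
  set x := exp (1 + K) with hx
  have hxp : 0 < x := Real.exp_pos _
  set c1 : ℝ := (1 / 2) ^ (4 * K) * (1 / 2) / (D * x) with hc1
  have hc1p : 0 < c1 := by positivity
  set C2 : ℝ := E0 * x * 4 ^ (4 * K + 1) * ct K with hC2
  have hC2p : 0 ≤ C2 := by have := ct_nonneg K; positivity
  clear_value C2 c1 x E0 D
  obtain ⟨κ, hκ0, hκ1, hκ2⟩ : ∃ κ : ℝ, 0 < κ ∧ κ ≤ 1 ∧ C2 * κ ≤ c1 / 2 := by
    refine ⟨min 1 (c1 / (2 * (C2 + 1))), by positivity, min_le_left _ _, ?_⟩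
    calc C2 * min 1 (c1 / (2 * (C2 + 1))) ≤ (C2 + 1) * (c1 / (2 * (C2 + 1))) := by
          gcongr
          · linarith
          · exact min_le_right _ _
      _ = c1 / 2 := by field_simp
  refine ⟨c1 / 2 * κ ^ (4 * K), by positivity, ?_⟩
  intro Q j σ y1 w ht hσ h2σ htb hy1 hw
  have hs : σ ∈ Ioc 0 J := ⟨hσ, by linarith⟩
  set H := gH v Q j σ with hH
  have hHp : 0 ≤ H := gH_nonneg
  clear_value H
  set ρ := σ * sqrt (1 + κ ^ 2) with hρ
  have hq1 : 1 ≤ sqrt (1 + κ ^ 2) := Real.one_le_sqrt.2 (by nlinarith)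
  have hq2 : sqrt (1 + κ ^ 2) ≤ 2 := by
    rw [Real.sqrt_le_left (by norm_num)]; nlinarith
  have hρ2 : ρ ^ 2 = σ ^ 2 + κ ^ 2 * σ ^ 2 := by
    rw [hρ, mul_pow, Real.sq_sqrt (by positivity)]; ring
  have hρσ : σ ≤ ρ := by rw [hρ]; nlinarith
  have hρ2σ : ρ ≤ 2 * σ := by rw [hρ]; nlinarith
  have hρ0 : 0 < ρ := by linarith
  set t1 := j + κ ^ 2 * σ ^ 2 with ht1d
  have ht1 : t1 ∈ Ioo (ta + J ^ 2) tb := by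
    constructor
    · have := ht.1; have : 0 ≤ κ ^ 2 * σ ^ 2 := by positivity
      linarith
    · have : κ ^ 2 * σ ^ 2 ≤ 1 * σ ^ 2 := by gcongr; nlinarith
      linarith
  clear_value t1 ρ
  have hκσ : κ * σ ≤ σ := by nlinarith
  have a1 := c.doubK (Q := y1) ht1 (σ := κ * σ) (σ' := ρ) (by positivity) (by linarith) (by linarith)
  have a2 := dil c.m (Q := y1) (t0' := t1) (ρ := ρ) hσ hρσ (tmem ht hs) (by rw [hρ2, ht1d]; ring)
  have a3 : H ≤ x * gH v y1 j σ := by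
    rw [hH]
    refine (c.shift (Q := y1) ht hs Q).trans ?_
    have := gH_nonneg (v := v) (Q := y1) (j := j) (σ := σ)
    rw [hx]
    gcongr
    rw [div_le_iff₀ hσ, abs_sub_comm]
    gcongr
  have hσρ : 1 / 2 ≤ σ / ρ := by rw [div_le_div_iff₀ (by norm_num) hρ0]; linarith
  have hκρ : κ * (1 / 2) ≤ κ * σ / ρ := by rw [mul_div_assoc]; gcongr
  have hg1 := gH_nonneg (v := v) (Q := y1) (j := j) (σ := σ)
  have hg2 := gH_nonneg (v := v) (Q := y1) (j := t1) (σ := ρ)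
  have a4 : (κ * (1 / 2)) ^ (4 * K) * ((1 / 2) * gH v y1 j σ) ≤ D * gH v y1 t1 (κ * σ) := by
    rw [hD]; refine le_trans ?_ a1
    have : 1 / 2 * gH v y1 j σ ≤ gH v y1 t1 ρ := le_trans (by gcongr) a2
    gcongr
  have a5 : c1 * κ ^ (4 * K) * H ≤ gH v y1 t1 (κ * σ) := by
    have : c1 * κ ^ (4 * K) * H ≤ c1 * κ ^ (4 * K) * (x * gH v y1 j σ) := by gcongr
    refine this.trans ?_
    rw [mul_pow] at a4
    rw [hc1]
    rw [show (1 / 2 : ℝ) ^ (4 * K) * (1 / 2) / (D * x) * κ ^ (4 * K) * (x * gH v y1 j σ) =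
      (κ ^ (4 * K) * (1 / 2) ^ (4 * K) * ((1 / 2) * gH v y1 j σ)) / D by field_simp]
    rw [div_le_iff₀ hDp]; linarith
  have a6 : gH v y1 t1 (κ * σ) ≤ w + E0 * x * (4 * κ) ^ (4 * K + 1) * H * ct K := by
    rw [hE0, hx, hH]; exact c.up ht hs hκ0 hκ1 hy1 hw (by rw [ht1d]; ring)
  have a7 : E0 * x * (4 * κ) ^ (4 * K + 1) * H * ct K ≤ c1 / 2 * κ ^ (4 * K) * H := by
    calc E0 * x * (4 * κ) ^ (4 * K + 1) * H * ct K = (C2 * κ) * κ ^ (4 * K) * H := by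
          rw [hC2, mul_pow, pow_succ κ]; ring
      _ ≤ _ := by gcongr
  linarith

/-- exponential constant -/
noncomputable def ce : ℝ := ∫ z, exp (1 * |z|) ∂gm

lemma dU (m : PMod v vy vyy vt ta tb M B R) (hσ : 0 < σ) (ht : j - σ ^ 2 ∈ Ioo ta tb) (η : ℝ) :
    HasDerivAt (fun η => ∫ z, v (Q + σ * η + σ * z) (j - σ ^ 2) ∂gm)
      (∫ z, σ * vy (Q + σ * η + σ * z) (j - σ ^ 2) ∂gm) η := by
  refine (hasDerivAt_integral_of_dominated_loc_of_deriv_le (F := fun η z => v (Q + σ * η + σ * z) (j - σ ^ 2))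
    (F' := fun η z => σ * vy (Q + σ * η + σ * z) (j - σ ^ 2))
    (s := univ) univ_mem ?_ (m.eW hσ ht).int ?_ ?_ (EB.const (σ * B)).int ?_).2
  · exact Eventually.of_forall fun s => (m.eW hσ ht).1.aestronglyMeasurable
  · exact (m.eW1 hσ ht).1.aestronglyMeasurable
  · refine Eventually.of_forall fun z s hs => ?_
    rw [Real.norm_eq_abs, abs_mul, abs_of_pos hσ]
    gcongr
    exact m.bvy _ ht _
  · refine Eventually.of_forall fun z s hs => ?_
    have h1 : HasDerivAt (fun s : ℝ => Q + σ * s + σ * z) σ s :=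
      ((((hasDerivAt_id s).const_mul σ).const_add Q).add_const (σ * z)).congr_deriv (by simp)
    have := (m.dy _ ht (Q + σ * s + σ * z)).comp s h1
    exact this.congr_deriv (by ring)

lemma odeU (c : Ctx v vy vyy vt ta tb M B R J K) (ht : j ∈ Ioo (ta + J ^ 2) tb) (hs : σ ∈ Ioc 0 J)
    {η : ℝ} (hη : |η| ≤ 1) :
    |η * (∫ z, σ * vy (Q + σ * η + σ * z) (j - σ ^ 2) ∂gm)
      - 2 * gN v vy Q j σ * (∫ z, v (Q + σ * η + σ * z) (j - σ ^ 2) ∂gm)|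
      ≤ 2 * (sqrt (gD v vy vyy Q j σ) * sqrt ce) := by
  have hσ := hs.1
  have htm := tmem ht hs
  have S := c.m.slice htm (Q + σ * η) σ hσ
  have hpt : ∀ z, gq v vy vyy Q j σ (z + η) =
      ((σ ^ 2 * vyy (Q + σ * η + σ * z) (j - σ ^ 2) - z / 2 * (σ * vy (Q + σ * η + σ * z) (j - σ ^ 2)))
        - η / 2 * (σ * vy (Q + σ * η + σ * z) (j - σ ^ 2)))
        + gN v vy Q j σ * v (Q + σ * η + σ * z) (j - σ ^ 2) := by
    intro z
    unfold gq gQ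
    rw [show Q + σ * (z + η) = Q + σ * η + σ * z by ring]; ring
  have e1 : ∫ z, gq v vy vyy Q j σ (z + η) ∂gm =
      -(η / 2) * (∫ z, σ * vy (Q + σ * η + σ * z) (j - σ ^ 2) ∂gm)
      + gN v vy Q j σ * (∫ z, v (Q + σ * η + σ * z) (j - σ ^ 2) ∂gm) := by
    simp_rw [hpt]
    rw [integral_add (S.eQ.sub (S.e1.smul _)).int (S.e0.smul _).int,
      integral_sub S.eQ.int (S.e1.smul _).int, S.intQ, integral_const_mul (η / 2), integral_const_mul (gN v vy Q j σ)]
    ring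
  have e2 := gm_shift (gq v vy vyy Q j σ) η
  have hE : EB (fun z => exp (η * z / 2 - η ^ 2 / 4)) := by
    refine EB.mono (by fun_prop) (EB.exp 1) fun z => ?_
    rw [abs_of_pos (Real.exp_pos _), abs_of_pos (Real.exp_pos _), Real.exp_le_exp]
    have : η * z ≤ |z| := by
      calc η * z ≤ |η * z| := le_abs_self _
        _ = |η| * |z| := abs_mul _ _
        _ ≤ 1 * |z| := by gcongr
        _ = |z| := one_mul _
    nlinarith [abs_nonneg z, sq_nonneg η]
  have e3 := gm_abs_cs (c.m.eq (Q := Q) hσ htm) hE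
  have e4 : ∫ z, exp (η * z / 2 - η ^ 2 / 4) ^ 2 ∂gm ≤ ce := by
    refine gm_int_le hE.sq (EB.exp 1) fun z => ?_
    rw [← Real.exp_nat_mul, Real.exp_le_exp]
    have : η * z ≤ |z| := by
      calc η * z ≤ |η * z| := le_abs_self _
        _ = |η| * |z| := abs_mul _ _
        _ ≤ 1 * |z| := by gcongr
        _ = |z| := one_mul _
    push_cast
    nlinarith [abs_nonneg z, sq_nonneg η]
  have e5 : |∫ z, gq v vy vyy Q j σ (z + η) ∂gm| ≤ sqrt (gD v vy vyy Q j σ) * sqrt ce := by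
    rw [e2]
    refine e3.trans ?_
    unfold gD
    gcongr
  rw [e1] at e5
  rw [show η * (∫ z, σ * vy (Q + σ * η + σ * z) (j - σ ^ 2) ∂gm)
      - 2 * gN v vy Q j σ * (∫ z, v (Q + σ * η + σ * z) (j - σ ^ 2) ∂gm) =
      -2 * (-(η / 2) * (∫ z, σ * vy (Q + σ * η + σ * z) (j - σ ^ 2) ∂gm)
      + gN v vy Q j σ * (∫ z, v (Q + σ * η + σ * z) (j - σ ^ 2) ∂gm)) by ring, abs_mul, show |(-2 : ℝ)| = 2 by norm_num]
  linarith

lemma gron_abs {f f' : ℝ → ℝ} {L e : ℝ} (hL : 1 ≤ L) (he : 0 ≤ e)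
    (h : ∀ r ∈ Icc (0 : ℝ) 1, HasDerivAt f (f' r) r) (h2 : ∀ r ∈ Icc (0 : ℝ) 1, |f' r| ≤ L * |f r| + e)
    {r : ℝ} (hr : r ∈ Icc (0 : ℝ) 1) : |f r| ≤ exp L * (|f 0| + e) := by
  have := norm_le_gronwallBound_of_norm_deriv_right_le (f := f) (f' := f') (δ := |f 0|) (K := L) (ε := e)
    (a := 0) (b := 1) (fun r hr => (h r hr).continuousAt.continuousWithinAt)
    (fun r hr => (h r ⟨hr.1, hr.2.le⟩).hasDerivWithinAt) le_rfl
    (fun r hr => h2 r ⟨hr.1, hr.2.le⟩) r hr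
  rw [gronwallBound_of_K_ne_0 (by linarith)] at this
  refine this.trans ?_
  have h3 : exp (L * (r - 0)) ≤ exp L := Real.exp_le_exp.2 (by nlinarith [hr.1, hr.2])
  have h4 : e / L ≤ e := div_le_self he hL
  have h5 : 0 ≤ e / L := by positivity
  have h6 : 1 ≤ exp (L * (r - 0)) := Real.one_le_exp (by nlinarith [hr.1])
  calc |f 0| * exp (L * (r - 0)) + e / L * (exp (L * (r - 0)) - 1)
      ≤ |f 0| * exp L + e * exp L := by
        gcongr
        linarith
    _ = _ := by ring

lemma near (c : Ctx v vy vyy vt ta tb M B R J K) : ∃ C > 0, ∀ Q j σ δ s η0 η, j ∈ Ioo (ta + J ^ 2) tb →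
    σ ∈ Ioc 0 J → 0 ≤ δ → gD v vy vyy Q j σ ≤ δ ^ 2 * gH v Q j σ → (s = 1 ∨ s = -1) →
    s * η0 ∈ Icc (1/2 : ℝ) 1 → s * η ∈ Icc (1/2 : ℝ) 1 → v (Q + σ * η0) j = 0 →
    |v (Q + σ * η) j| ≤ C * (σ + δ) * sqrt (gH v Q j σ) := by
  set L : ℝ := 4 * K + 1 with hL
  set x := exp (1 + K) with hx
  have hxp : 0 < x := Real.exp_pos _
  have hC6 : 0 ≤ C6 M K := Real.sqrt_nonneg _
  set se := sqrt ce with hse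
  have hse0 : 0 ≤ se := Real.sqrt_nonneg _
  refine ⟨C6 M K * x + exp L * (C6 M K * x + 4 * se) + 1, by positivity, ?_⟩
  intro Q j σ δ s η0 η ht hs hδ hD hss hη0 hη hv0
  set rH := sqrt (gH v Q j σ) with hrH
  have hrH0 : 0 ≤ rH := Real.sqrt_nonneg _
  have habs : ∀ η, s * η ∈ Icc (1/2 : ℝ) 1 → |η| ∈ Icc (1/2 : ℝ) 1 := by
    intro η h
    rcases hss with rfl | rfl
    · rw [one_mul] at h; rwa [abs_of_pos (by linarith [h.1])]
    · rw [neg_one_mul] at h; rwa [abs_of_neg (by linarith [h.1])]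
  have htm := tmem ht hs
  set U : ℝ → ℝ := fun η => ∫ z, v (Q + σ * η + σ * z) (j - σ ^ 2) ∂gm with hU
  have mean' : ∀ η, s * η ∈ Icc (1/2 : ℝ) 1 → |U η - v (Q + σ * η) j| ≤ C6 M K * x * σ * rH := by
    intro η h
    refine (c.mean (Q := Q + σ * η) ht hs).trans ?_
    have h1 := c.shift (Q := Q) ht hs (Q + σ * η)
    have h2 : exp ((1 + K) * |Q + σ * η - Q| / σ) ≤ x ^ 2 := by
      rw [hx, ← Real.exp_nat_mul, Real.exp_le_exp, div_le_iff₀ hs.1, add_sub_cancel_left, abs_mul, abs_of_pos hs.1]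
      have h4 := (habs η h).2
      have h5 : (1 + (K : ℝ)) * (σ * |η|) ≤ (1 + K) * (σ * 1) := by have := hs.1; gcongr
      have h6 : 0 ≤ (1 + (K : ℝ)) * σ := by have := hs.1; positivity
      push_cast; nlinarith
    have h3 : sqrt (gH v (Q + σ * η) j σ) ≤ x * rH := by
      rw [hrH, Real.sqrt_le_left (by positivity), mul_pow, Real.sq_sqrt gH_nonneg]
      refine h1.trans ?_
      gcongr
      exact gH_nonneg
    have := hs.1
    calc C6 M K * σ * sqrt (gH v (Q + σ * η) j σ) ≤ C6 M K * σ * (x * rH) := by gcongr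
      _ = _ := by ring
  have key := gron_abs (f := fun r => U (η0 + r * (η - η0)))
    (f' := fun r => (∫ z, σ * vy (Q + σ * (η0 + r * (η - η0)) + σ * z) (j - σ ^ 2) ∂gm) * (η - η0))
    (L := L) (e := 4 * se * δ * rH) (r := 1) (by rw [hL]; linarith [(Nat.cast_nonneg K : (0:ℝ) ≤ K)]) (by positivity) ?_ ?_ (by simp)
  · simp only [one_mul, add_sub_cancel, zero_mul, add_zero] at key
    have m1 := mean' η hη
    have m0 := mean' η0 hη0
    rw [hv0, sub_zero] at m0
    have h0 : |v (Q + σ * η) j| ≤ C6 M K * x * σ * rH + |U η| := by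
      calc |v (Q + σ * η) j| = |U η - (U η - v (Q + σ * η) j)| := by congr 1; ring
        _ ≤ |U η| + |U η - v (Q + σ * η) j| := abs_sub _ _
        _ ≤ _ := by linarith
    have hσ := hs.1
    have hg : 0 ≤ C6 M K * x * rH * δ := by positivity
    have hg2 : 0 ≤ exp L * (C6 M K * x * rH * δ) := by positivity
    have hg3 : 0 ≤ exp L * (4 * se * σ * rH) := by positivity
    have hg4 : 0 ≤ (σ + δ) * rH := by positivity
    have : exp L * (|U η0| + 4 * se * δ * rH) ≤ exp L * (C6 M K * x * σ * rH + 4 * se * δ * rH) := by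
      gcongr
    linarith
  · intro r hr
    have h1 : HasDerivAt (fun r => η0 + r * (η - η0)) (η - η0) r :=
      (((hasDerivAt_id r).mul_const (η - η0)).const_add η0).congr_deriv (by simp)
    exact (dU (Q := Q) c.m hs.1 htm (η0 + r * (η - η0))).comp r h1
  · intro r hr
    set ζ := η0 + r * (η - η0) with hζ
    have hζm : s * ζ ∈ Icc (1/2 : ℝ) 1 := by
      rw [hζ, show s * (η0 + r * (η - η0)) = (1 - r) * (s * η0) + r * (s * η) by ring]
      have h1 := hr.1; have h2 := hr.2
      constructor
      · nlinarith [hη0.1, hη.1]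
      · nlinarith [hη0.2, hη.2]
    have hza := habs ζ hζm
    have o := c.odeU (Q := Q) ht hs hza.2
    set U' := ∫ z, σ * vy (Q + σ * ζ + σ * z) (j - σ ^ 2) ∂gm with hU'
    have hsD : sqrt (gD v vy vyy Q j σ) ≤ δ * rH := by
      rw [Real.sqrt_le_left (by positivity), mul_pow, hrH, Real.sq_sqrt gH_nonneg]; exact hD
    have hdiff : |η - η0| ≤ 1 / 2 := by
      rcases hss with rfl | rfl
      · rw [abs_le]; constructor <;> linarith [hη.1, hη.2, hη0.1, hη0.2]
      · rw [abs_le]; constructor <;> linarith [hη.1, hη.2, hη0.1, hη0.2]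
    have hN := c.hN Q j ht σ hs
    have hN0 := gN_nonneg (v := v) (vy := vy) (Q := Q) (j := j) (σ := σ)
    have hUU : (∫ z, v (Q + σ * ζ + σ * z) (j - σ ^ 2) ∂gm) = U ζ := rfl
    rw [hUU] at o
    have o2 : |ζ| * |U'| ≤ 2 * K * |U ζ| + 2 * (δ * rH * se) := by
      rw [← abs_mul]
      calc |ζ * U'| = |(ζ * U' - 2 * gN v vy Q j σ * U ζ) + 2 * gN v vy Q j σ * U ζ| := by congr 1; ring
        _ ≤ _ := abs_add_le _ _
        _ ≤ 2 * (δ * rH * se) + 2 * K * |U ζ| := by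
          gcongr
          · refine o.trans ?_; gcongr
          · rw [abs_mul, abs_of_nonneg (by positivity)]; gcongr
        _ = _ := by ring
    have o3 : |U'| ≤ 4 * K * |U ζ| + 4 * (δ * rH * se) := by
      have := mul_le_mul_of_nonneg_right hza.1 (abs_nonneg U')
      linarith
    rw [abs_mul]
    have : |U'| * |η - η0| ≤ |U'| * 1 := by gcongr; linarith
    rw [hL]
    linarith [abs_nonneg (U ζ)]

lemma isolated (c : Ctx v vy vyy vt ta tb M B R J K) (ht : j ∈ Ioo (ta + J ^ 2) tb) (Q : ℝ) :
    ∃ ρ > 0, ∀ y, 0 < |y - Q| → |y - Q| < ρ → v y j ≠ 0 := by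
  obtain ⟨θ, hθ, hlow⟩ := c.low
  obtain ⟨C, hC, hnear⟩ := c.near
  set δ := sqrt θ / (4 * C) with hδ
  have hsθ : 0 < sqrt θ := Real.sqrt_pos.2 hθ
  have hδp : 0 < δ := by positivity
  obtain ⟨r0, hr0, hr1, hgood⟩ := c.good (Q := Q) ht (η := δ ^ 2) (by positivity)
  have htb : 0 < tb - j := by linarith [ht.2]
  have hl := c.l1
  refine ⟨min (r0 / 2) (min (δ / 2) ((tb - j) / 4)), by positivity, ?_⟩
  intro y hy0 hy hv
  rw [lt_min_iff, lt_min_iff] at hy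
  obtain ⟨h1, h2, h3⟩ := hy
  set d := |y - Q| with hd
  obtain ⟨σ, hσ, hD⟩ := hgood d ⟨hy0, by linarith⟩
  have hσ0 : 0 < σ := hy0.trans hσ.1
  have hs : σ ∈ Ioc 0 J := ⟨hσ0, by linarith [hσ.2]⟩
  have hσ1 : σ ≤ 1 := hs.2.trans hl
  obtain ⟨s, hss, hsy⟩ : ∃ s : ℝ, (s = 1 ∨ s = -1) ∧ y - Q = s * d := by
    rcases le_total 0 (y - Q) with h | h
    · exact ⟨1, Or.inl rfl, by rw [hd, abs_of_nonneg h, one_mul]⟩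
    · exact ⟨-1, Or.inr rfl, by rw [hd, abs_of_nonpos h]; ring⟩
  have hs2 : s * s = 1 := by rcases hss with rfl | rfl <;> norm_num
  have hs1 : |s| = 1 := by rcases hss with rfl | rfl <;> norm_num
  have hη0 : s * (s * (d / σ)) ∈ Icc (1/2 : ℝ) 1 := by
    rw [← mul_assoc, hs2, one_mul]
    exact ⟨by rw [div_le_div_iff₀ (by norm_num) hσ0]; linarith [hσ.2], by rw [div_le_one hσ0]; exact hσ.1.le⟩
  set H := gH v Q j σ with hH
  have hHp : 0 < H := c.m.H_pos hσ0 (tmem ht hs)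
  have := hlow Q j σ (Q + s * (3 / 4 * σ)) ((C * (σ + δ) * sqrt H) ^ 2) ht hσ0 (by linarith [hσ.2])
    (by nlinarith [hσ.2]) (by
      rw [add_sub_cancel_left, abs_mul, hs1, abs_of_pos (by positivity)]; linarith) ?_
  · rw [mul_pow, Real.sq_sqrt hHp.le] at this
    have h4 : C * (σ + δ) < sqrt θ := by
      have h5 : σ < δ := by linarith [hσ.2]
      have h6 : C * (2 * δ) = sqrt θ / 2 := by rw [hδ]; field_simp; norm_num
      nlinarith
    have h7 : (C * (σ + δ)) ^ 2 < θ := by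
      calc (C * (σ + δ)) ^ 2 < sqrt θ ^ 2 := by gcongr
        _ = θ := Real.sq_sqrt hθ.le
    nlinarith
  · intro y' hy'
    rw [← sq_abs]
    refine pow_le_pow_left₀ (abs_nonneg _) ?_ 2
    have e1 : y' = Q + σ * ((y' - Q) / σ) := by field_simp; ring
    rw [e1]
    refine hnear Q j σ δ s (s * (d / σ)) _ ht hs hδp.le hD hss hη0 ?_ ?_
    · rw [abs_le] at hy'
      rw [← mul_div_assoc]
      constructor
      · rw [div_le_div_iff₀ (by norm_num) hσ0]
        rcases hss with rfl | rfl <;> linarith [hy'.1, hy'.2]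
      · rw [div_le_one hσ0]
        rcases hss with rfl | rfl <;> linarith [hy'.1, hy'.2]
    · rw [show Q + σ * (s * (d / σ)) = Q + s * d by field_simp, ← hsy]
      simpa using hv

lemma finite_zeros (c : Ctx v vy vyy vt ta tb M B R J K) (ht : j ∈ Ioo (ta + J ^ 2) tb) :
    {y | v y j = 0}.Finite := by
  have htm := c.tmem0 ht
  have hsub : {y | v y j = 0} ⊆ Icc (-R) R := by
    intro y hy
    by_contra h
    have : R ≤ |y| := by
      by_contra h2; push Not at h2
      exact h ⟨by linarith [neg_abs_le y], by linarith [le_abs_self y]⟩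
    have h3 := c.m.far _ htm y this
    rw [mem_ofPred_eq] at hy
    rw [hy] at h3; simp at h3
  by_contra hinf
  obtain ⟨x, hx, hacc⟩ := Set.Infinite.exists_accPt_of_subset_isCompact hinf isCompact_Icc hsub
  obtain ⟨ρ, hρ, h⟩ := c.isolated ht x
  rw [accPt_iff_nhds] at hacc
  obtain ⟨y, ⟨hy1, hy2⟩, hne⟩ := hacc (Metric.ball x ρ) (Metric.ball_mem_nhds x hρ)
  rw [Metric.mem_ball, Real.dist_eq] at hy1
  exact h y (abs_pos.2 (sub_ne_zero.2 hne)) hy1 hy2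
end Ctx

lemma gm_small (g η : ℝ) (hη : 0 ≤ η) : ∫ z, (Ioo (g - η) (g + η)).indicator (fun _ => (1 : ℝ)) z ∂gm ≤ 2 * η := by
  have hE : EB ((Ioo (g - η) (g + η)).indicator (fun _ => (1 : ℝ))) :=
    EB.of_bdd (measurable_const.indicator measurableSet_Ioo) 1 fun z => by
      by_cases h : z ∈ Ioo (g - η) (g + η) <;> simp [h]
  rw [gm_integral]
  have h1 : Integrable ((Ioo (g - η) (g + η)).indicator (fun _ => (1 : ℝ))) volume :=
    (integrable_indicator_iff measurableSet_Ioo).2 (by simp)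
  calc ∫ z, gd z * (Ioo (g - η) (g + η)).indicator (fun _ => (1 : ℝ)) z
      ≤ ∫ z, (Ioo (g - η) (g + η)).indicator (fun _ => (1 : ℝ)) z := by
        refine integral_mono (gm_integrable hE.int) h1 fun z => ?_
        have h2 : gd z ≤ 1 := by
          unfold gd
          have a1 : (sqrt (4 * Real.pi))⁻¹ ≤ 1 := by
            apply inv_le_one_of_one_le₀
            rw [Real.one_le_sqrt]; nlinarith [Real.pi_gt_three]
          have a2 : exp (-z ^ 2 / 4) ≤ 1 := Real.exp_le_one_iff.2 (by nlinarith [sq_nonneg z])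
          exact mul_le_one₀ a1 (Real.exp_pos _).le a2
        have h3 : 0 ≤ (Ioo (g - η) (g + η)).indicator (fun _ => (1 : ℝ)) z :=
          indicator_nonneg (fun _ _ => zero_le_one) _
        nlinarith
    _ = 2 * η := by
        rw [integral_indicator measurableSet_Ioo]
        simp [Measure.real]
        rw [ENNReal.toReal_ofReal (by linarith)]; ring

namespace Ctx
open PMod
variable {v vy vyy vt : ℝ → ℝ → ℝ} {ta tb M B R : ℝ} {Q j σ σ' J : ℝ} {K : ℕ}

lemma vyLip (m : PMod v vy vyy vt ta tb M B R) {t : ℝ} (ht : t ∈ Ioo ta tb) {x y : ℝ} (hxy : x ≤ y)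
    (h0 : (0 : ℝ) ∉ Ioo x y) : |vy y t - vy x t| ≤ B * (y - x) := by
  have hc := m.cvy ht
  rcases hxy.eq_or_lt with rfl | hlt
  · simp
  obtain ⟨z, hz, he⟩ := exists_hasDerivAt_eq_slope (fun y => vy y t) (fun y => vyy y t) hlt hc.continuousOn
    (fun z hz => m.dyy t ht z (fun h => h0 (h ▸ hz)))
  have hb := m.bvyy t ht z
  rw [he, abs_div, abs_of_pos (sub_pos.2 hlt), div_le_iff₀ (sub_pos.2 hlt)] at hb
  exact hb

lemma vyLip' (m : PMod v vy vyy vt ta tb M B R) {t : ℝ} (ht : t ∈ Ioo ta tb) (x y : ℝ) :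
    |vy y t - vy x t| ≤ B * |y - x| := by
  have key : ∀ x y, x ≤ y → |vy y t - vy x t| ≤ B * |y - x| := by
    intro x y hxy
    rw [abs_of_nonneg (sub_nonneg.2 hxy)]
    by_cases h0 : (0 : ℝ) ∈ Ioo x y
    · have h1 := vyLip m ht h0.1.le (by simp)
      have h2 := vyLip m ht h0.2.le (by simp)
      calc |vy y t - vy x t| = |(vy y t - vy 0 t) + (vy 0 t - vy x t)| := by congr 1; ring
        _ ≤ _ := abs_add_le _ _
        _ ≤ _ := by linarith
    · exact vyLip m ht hxy h0
  rcases le_total x y with h | h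
  · exact key x y h
  · rw [abs_sub_comm, abs_sub_comm y x]; exact key y x h

lemma Hquart (c : Ctx v vy vyy vt ta tb M B R J K) (ht : j ∈ Ioo (ta + J ^ 2) tb) (hv : v Q j = 0)
    (hvy : vy Q j = 0) : ∃ C, ∀ σ ∈ Ioc 0 J, gH v Q j σ ≤ C * σ ^ 4 := by
  have htm := c.tmem0 ht
  have hB := c.m.hB
  have q : ∀ h, |v (Q + h) j| ≤ B * h ^ 2 := by
    intro h
    have h1 : ∀ x ∈ uIcc Q (Q + h), ‖vy x j‖ ≤ B * |h| := by
      intro x hx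
      have := vyLip' c.m htm Q x
      rw [hvy, sub_zero] at this
      refine this.trans (mul_le_mul_of_nonneg_left ?_ hB)
      have := abs_sub_left_of_mem_uIcc hx
      simpa using this
    have := (convex_uIcc Q (Q + h)).norm_image_sub_le_of_norm_hasDerivWithin_le (f := fun y => v y j)
      (fun y _ => (c.m.dy j htm y).hasDerivWithinAt) h1 left_mem_uIcc right_mem_uIcc
    simp only [hv, sub_zero, add_sub_cancel_left, Real.norm_eq_abs] at this
    rw [← sq_abs h]; linarith
  refine ⟨∫ z, (B * (z ^ 2 + 1)) ^ 2 ∂gm, fun σ hs => ?_⟩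
  have hE : EB (fun z => (B * (z ^ 2 + 1)) ^ 2) := ((EB.id.sq.add (EB.const 1)).smul B).sq
  rw [← integral_mul_const]
  refine gm_int_le (c.m.eW hs.1 (tmem ht hs)).sq (by simpa [mul_comm] using hE.smul (σ ^ 4)) fun z => ?_
  rw [← sq_abs, show (B * (z ^ 2 + 1)) ^ 2 * σ ^ 4 = (B * (σ ^ 2 * z ^ 2) + B * σ ^ 2) ^ 2 by ring]
  refine pow_le_pow_left₀ (abs_nonneg _) ?_ 2
  have h1 := c.m.lip (y := Q + σ * z) (y' := Q + σ * z) (tmem ht hs) htm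
  have h2 := q (σ * z)
  rw [sub_self, abs_zero, mul_zero, zero_add, show j - σ ^ 2 - j = -(σ ^ 2) by ring, abs_neg,
    abs_of_nonneg (sq_nonneg σ)] at h1
  rw [mul_pow] at h2
  calc |v (Q + σ * z) (j - σ ^ 2)| = |(v (Q + σ * z) (j - σ ^ 2) - v (Q + σ * z) j) + v (Q + σ * z) j| := by
        congr 1; ring
    _ ≤ _ := abs_add_le _ _
    _ ≤ _ := by linarith

lemma N_low (c : Ctx v vy vyy vt ta tb M B R J K) (ht : j ∈ Ioo (ta + J ^ 2) tb) (hv : v Q j = 0)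
    (hvy : vy Q j = 0) : ∃ σ2 > 0, ∀ σ ∈ Ioc 0 σ2, σ ≤ J → 7 / 10 ≤ gN v vy Q j σ := by
  obtain ⟨C, hC⟩ := c.Hquart ht hv hvy
  have key : ∀ σ ∈ Ioc 0 J, ∃ s ∈ Ioc 0 σ, 3 / 4 < gN v vy Q j s := by
    intro σ hs
    by_contra hcon
    push Not at hcon
    have h0 : ∀ s ∈ Ioc 0 σ, gH v Q j σ ≤ (exp (2 * M * (3 + (3 : ℕ) / 4)) * C * σ ^ 3) * s := by
      intro s hs'
      have h1 := c.doub (Q := Q) ht (p := 3) hs'.1 hs'.2 hs.2 (fun r hr => by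
        have := hcon r ⟨hs'.1.trans_le hr.1, hr.2⟩; norm_num; exact this)
      have h2 := hC s ⟨hs'.1, hs'.2.trans hs.2⟩
      have h3 := h1.trans (mul_le_mul_of_nonneg_left h2 (Real.exp_pos _).le)
      rw [div_pow, div_mul_eq_mul_div, div_le_iff₀ (pow_pos hs.1 3)] at h3
      have h4 : 0 < s ^ 3 := pow_pos hs'.1 3
      refine le_of_mul_le_mul_left ?_ h4
      linarith
    have hlim : Tendsto (fun s => (exp (2 * M * (3 + (3 : ℕ) / 4)) * C * σ ^ 3) * s) (𝓝[>] 0) (𝓝 0) := by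
      have : ContinuousAt (fun s : ℝ => (exp (2 * M * (3 + (3 : ℕ) / 4)) * C * σ ^ 3) * s) 0 := by fun_prop
      have := this.tendsto
      rw [mul_zero] at this
      exact this.mono_left nhdsWithin_le_nhds
    have h5 := ge_of_tendsto hlim (by filter_upwards [Ioc_mem_nhdsGT hs.1] with s hs using h0 s hs)
    linarith [c.m.H_pos (Q := Q) hs.1 (tmem ht hs)]
  refine ⟨1 / (140 * M ^ 2 + 1), by positivity, fun σ hs hs1 => ?_⟩
  obtain ⟨s, hs', hN⟩ := key σ ⟨hs.1, hs1⟩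
  have hm := c.m.monoE (Q := Q) c.l1 ht ⟨hs'.1, hs'.2.trans hs1⟩ ⟨hs.1, hs1⟩ hs'.2
  have e1 : gN v vy Q j s + 1 ≤ gE v vy M Q j s := by
    unfold gE
    have := gN_nonneg (v := v) (vy := vy) (Q := Q) (j := j) (σ := s)
    exact le_mul_of_one_le_left (by linarith) (Real.one_le_exp (by have := hs'.1; positivity))
  have h2 : 7 / 4 ≤ exp (4 * M ^ 2 * σ) * (gN v vy Q j σ + 1) := by
    have : gE v vy M Q j σ = exp (4 * M ^ 2 * σ) * (gN v vy Q j σ + 1) := rfl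
    linarith
  have h3 : 7 / 4 * exp (-(4 * M ^ 2 * σ)) ≤ gN v vy Q j σ + 1 := by
    rw [Real.exp_neg, ← div_eq_mul_inv, div_le_iff₀ (Real.exp_pos _)]; linarith
  have h4 := Real.add_one_le_exp (-(4 * M ^ 2 * σ))
  have h5 : σ * (140 * M ^ 2 + 1) ≤ 1 := by
    have := hs.2; rwa [le_div_iff₀ (by positivity)] at this
  have := hs.1
  linarith

lemma moments (c : Ctx v vy vyy vt ta tb M B R J K) (ht : j ∈ Ioo (ta + J ^ 2) tb) (hs : σ ∈ Ioc 0 J)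
    {δ : ℝ} (hδ : 0 ≤ δ) (hD : gD v vy vyy Q j σ ≤ δ ^ 2 * gH v Q j σ) (hN : 7 / 10 ≤ gN v vy Q j σ) :
    |∫ z, v (Q + σ * z) (j - σ ^ 2) ∂gm| ≤ 2 * δ * sqrt (gH v Q j σ) ∧
    |∫ z, z * v (Q + σ * z) (j - σ ^ 2) ∂gm| ≤ 5 * sqrt (∫ z, z ^ 2 ∂gm) * δ * sqrt (gH v Q j σ) := by
  have htm := tmem ht hs
  have S := c.m.slice htm Q σ hs.1
  set N := gN v vy Q j σ with hNd
  set rH := sqrt (gH v Q j σ) with hrH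
  have hsD : sqrt (gD v vy vyy Q j σ) ≤ δ * rH := by
    rw [Real.sqrt_le_left (by positivity), mul_pow, hrH, Real.sq_sqrt gH_nonneg]; exact hD
  have hpt : ∀ z, gq v vy vyy Q j σ z = (σ ^ 2 * vyy (Q + σ * z) (j - σ ^ 2) - z / 2 * (σ * vy (Q + σ * z) (j - σ ^ 2)))
      + N * v (Q + σ * z) (j - σ ^ 2) := fun z => rfl
  have e1 : ∫ z, 1 * gq v vy vyy Q j σ z ∂gm = N * ∫ z, v (Q + σ * z) (j - σ ^ 2) ∂gm := by
    simp_rw [one_mul, hpt]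
    rw [integral_add S.eQ.int (S.e0.smul _).int, S.intQ, integral_const_mul, zero_add]
  have e2 : ∫ z, z * gq v vy vyy Q j σ z ∂gm = (N - 1 / 2) * ∫ z, z * v (Q + σ * z) (j - σ ^ 2) ∂gm := by
    have : ∀ z, z * gq v vy vyy Q j σ z = z * (σ ^ 2 * vyy (Q + σ * z) (j - σ ^ 2) - z / 2 * (σ * vy (Q + σ * z) (j - σ ^ 2)))
      + N * (z * v (Q + σ * z) (j - σ ^ 2)) := fun z => by rw [hpt]; ring
    simp_rw [this]
    rw [integral_add (EB.id.mul S.eQ).int ((EB.id.mul S.e0).smul _).int, S.intzQ, integral_const_mul N, S.intW1]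
    ring
  have f1 := gm_abs_cs (EB.const 1) (c.m.eq (Q := Q) hs.1 htm)
  have f2 := gm_abs_cs EB.id (c.m.eq (Q := Q) hs.1 htm)
  rw [e1, abs_mul, abs_of_pos (by linarith)] at f1
  rw [e2, abs_mul, abs_of_pos (by linarith)] at f2
  have f1' : N * |∫ z, v (Q + σ * z) (j - σ ^ 2) ∂gm| ≤ δ * rH := by
    refine f1.trans ?_
    simp only [one_pow, integral_const, probReal_univ, smul_eq_mul, mul_one, Real.sqrt_one, one_mul]
    exact hsD
  have f2' : (N - 1 / 2) * |∫ z, z * v (Q + σ * z) (j - σ ^ 2) ∂gm| ≤ sqrt (∫ z, z ^ 2 ∂gm) * (δ * rH) := by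
    refine f2.trans ?_
    gcongr
    exact hsD
  constructor
  · nlinarith [abs_nonneg (∫ z, v (Q + σ * z) (j - σ ^ 2) ∂gm)]
  · nlinarith [abs_nonneg (∫ z, z * v (Q + σ * z) (j - σ ^ 2) ∂gm)]

/-- pointwise constant -/
noncomputable def cp (M : ℝ) (K : ℕ) : ℝ :=
  exp (M ^ 2 + 4 * M) * 2 * 2 ^ (4 * K) * exp (2 * M * (3 + K))

lemma cp_pos (M : ℝ) (K : ℕ) : 0 < cp M K := by unfold cp; positivity

lemma pointW (c : Ctx v vy vyy vt ta tb M B R J K) (ht : j ∈ Ioo (ta + J ^ 2) tb) (hσ : 0 < σ)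
    (h2 : 2 * σ ≤ J) (ht' : ta + J ^ 2 < j - σ ^ 2) (z : ℝ) :
    v (Q + σ * z) (j - σ ^ 2) ^ 2 ≤ cp M K * exp ((1 + K) * |z|) * gH v Q j σ := by
  have hs : σ ∈ Ioc 0 J := ⟨hσ, by linarith⟩
  have ht1 : j - σ ^ 2 ∈ Ioo (ta + J ^ 2) tb := ⟨ht', by nlinarith [ht.2, sq_nonneg σ]⟩
  set y := Q + σ * z with hy
  have a1 := c.point (Q := y) ht1 hs
  set ρ := σ * sqrt 2 with hρ
  have hq1 : 1 ≤ sqrt 2 := Real.one_le_sqrt.2 (by norm_num)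
  have hq2 : sqrt 2 ≤ 2 := by rw [Real.sqrt_le_left (by norm_num)]; norm_num
  have hρ2 : ρ ^ 2 = σ ^ 2 * 2 := by rw [hρ, mul_pow, Real.sq_sqrt (by norm_num)]
  have hρσ : σ ≤ ρ := le_mul_of_one_le_right hσ.le hq1
  have hρ2σ : ρ ≤ 2 * σ := by rw [hρ]; nlinarith
  have hρ0 : 0 < ρ := by linarith
  clear_value ρ
  have a2 := dil c.m (Q := y) (t0' := j) (ρ := ρ) hσ hρσ (tmem ht1 hs) (by rw [hρ2]; ring)
  have a3 := c.doubK (Q := y) ht hσ hρσ (by linarith)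
  have a4 := c.shift (Q := Q) ht hs y
  have e : (1 + (K : ℝ)) * |y - Q| / σ = (1 + K) * |z| := by
    rw [hy, add_sub_cancel_left, abs_mul, abs_of_pos hσ]; field_simp
  rw [e] at a4
  have hσρ : 1 / 2 ≤ σ / ρ := by rw [div_le_div_iff₀ (by norm_num) hρ0]; linarith
  have g1 := gH_nonneg (v := v) (Q := y) (j := j - σ ^ 2) (σ := σ)
  have g2 := gH_nonneg (v := v) (Q := y) (j := j) (σ := ρ)
  have b2 : gH v y (j - σ ^ 2) σ ≤ 2 * gH v y j ρ := by
    have := mul_le_mul_of_nonneg_right hσρ g1; linarith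
  have b3 : gH v y j ρ ≤ 2 ^ (4 * K) * (exp (2 * M * (3 + K)) * gH v y j σ) := by
    have h5 : (1 / 2 : ℝ) ^ (4 * K) * gH v y j ρ ≤ exp (2 * M * (3 + K)) * gH v y j σ :=
      le_trans (by gcongr) a3
    rw [one_div, inv_pow, inv_mul_le_iff₀ (by positivity)] at h5
    exact h5
  calc v y (j - σ ^ 2) ^ 2 ≤ _ := a1
    _ ≤ exp (M ^ 2 + 4 * M) * (2 * (2 ^ (4 * K) * (exp (2 * M * (3 + K)) *
        (exp ((1 + K) * |z|) * gH v Q j σ)))) := by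
      gcongr
      refine b2.trans ?_
      gcongr
      refine b3.trans ?_
      gcongr
    _ = _ := by unfold cp; ring

lemma lowI (c : Ctx v vy vyy vt ta tb M B R J K) : ∃ θ > 0, ∀ Q j σ g, j ∈ Ioo (ta + J ^ 2) tb → 0 < σ →
    2 * σ ≤ J → ta + J ^ 2 < j - σ ^ 2 →
    θ * (1 + |g|) * sqrt (gH v Q j σ) ≤ ∫ z, |v (Q + σ * z) (j - σ ^ 2)| * |z - g| ∂gm := by
  obtain ⟨Z, hZ1, hZ2⟩ : ∃ Z : ℝ, 1 ≤ Z ∧ 4 * (4 + 16 * (K : ℝ)) ≤ Z ^ 2 := by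
    refine ⟨4 * (4 + 16 * K), ?_, ?_⟩ <;> nlinarith [(Nat.cast_nonneg K : (0:ℝ) ≤ K)]
  set A := cp M K * exp ((1 + K) * Z) with hA
  have hAp : 0 < A := mul_pos (cp_pos M K) (Real.exp_pos _)
  set η := 1 / (8 * A) with hη
  have hηp : 0 < η := by positivity
  set c0 := min (η / (1 + 2 * Z)) (1 / 4) with hc0
  have hc0p : 0 < c0 := by positivity
  have hsA : 0 < sqrt A := Real.sqrt_pos.2 hAp
  refine ⟨c0 / (2 * sqrt A), by positivity, ?_⟩
  intro Q j σ g ht hσ h2 ht'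
  have hs : σ ∈ Ioc 0 J := ⟨hσ, by linarith⟩
  have htm := tmem ht hs
  have S := c.m.slice htm Q σ hσ
  have hpW := c.pointW (Q := Q) ht hσ h2 ht'
  have hmom := S.moment
  have hP := c.m.P_eq (Q := Q) hσ htm
  have hN := c.hN Q j ht σ hs
  set W : ℝ → ℝ := fun z => v (Q + σ * z) (j - σ ^ 2) with hW
  have hHi : gH v Q j σ = ∫ z, W z ^ 2 ∂gm := rfl
  have hPi : gP vy Q j σ = ∫ z, (σ * vy (Q + σ * z) (j - σ ^ 2)) ^ 2 ∂gm := rfl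
  have hHp : 0 < gH v Q j σ := c.m.H_pos hσ htm
  rw [← hHi, ← hPi, hP] at hmom
  set H := gH v Q j σ with hH
  clear_value H A
  set rH := sqrt H with hrH
  have hrHp : 0 < rH := Real.sqrt_pos.2 hHp
  have hrH2 : rH ^ 2 = H := Real.sq_sqrt hHp.le
  set I := ∫ z, |W z| * |z - g| ∂gm with hI
  set c1 := c0 * (1 + |g|) with hc1
  have hc1p : 0 < c1 := by positivity
  have hIe : EB (fun z => |W z| * |z - g|) := S.e0.abs.mul ((EB.id.sub (EB.const g)).abs)
  have hXe : EB ((Ioo (g - η) (g + η)).indicator (fun _ => (1 : ℝ))) :=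
    EB.of_bdd (measurable_const.indicator measurableSet_Ioo) 1 fun z => by
      by_cases h : z ∈ Ioo (g - η) (g + η) <;> simp [h]
  have hze : EB (fun z => z ^ 2 * W z ^ 2) := EB.id.sq.mul S.e0.sq
  have key : ∀ z, W z ^ 2 ≤ ((Z ^ 2)⁻¹ * (z ^ 2 * W z ^ 2) + A * H * (Ioo (g - η) (g + η)).indicator (fun _ => (1 : ℝ)) z)
      + (sqrt A * rH / c1) * (|W z| * |z - g|) := by
    intro z
    have n1 : 0 ≤ (Z ^ 2)⁻¹ * (z ^ 2 * W z ^ 2) := by positivity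
    have n2 : 0 ≤ A * H * (Ioo (g - η) (g + η)).indicator (fun _ => (1 : ℝ)) z :=
      mul_nonneg (by positivity) (indicator_nonneg (fun _ _ => zero_le_one) _)
    have n3 : 0 ≤ (sqrt A * rH / c1) * (|W z| * |z - g|) := by positivity
    by_cases hz : Z ≤ |z|
    · have : W z ^ 2 ≤ (Z ^ 2)⁻¹ * (z ^ 2 * W z ^ 2) := by
        rw [← mul_assoc, inv_mul_eq_div]
        refine le_mul_of_one_le_left (sq_nonneg _) ?_
        rw [one_le_div (by positivity), ← sq_abs z]
        gcongr
      linarith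
    · push Not at hz
      have hw : W z ^ 2 ≤ A * H := by
        refine (hpW z).trans ?_
        rw [hA]
        have := (cp_pos M K).le
        gcongr
      by_cases hg : z ∈ Ioo (g - η) (g + η)
      · rw [indicator_of_mem hg, mul_one] at *
        linarith
      · have hzg : η ≤ |z - g| := by
          by_contra h; push Not at h
          rw [abs_lt] at h
          exact hg ⟨by linarith, by linarith⟩
        have hzc : c1 ≤ |z - g| := by
          by_cases hgZ : |g| ≤ 2 * Z
          · calc c1 ≤ η / (1 + 2 * Z) * (1 + 2 * Z) := by
                  rw [hc1]
                  have : c0 ≤ η / (1 + 2 * Z) := min_le_left _ _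
                  gcongr
              _ = η := by field_simp
              _ ≤ _ := hzg
          · push Not at hgZ
            have h3 : |g| ≤ |z - g| + |z| := by
              calc |g| = |-(z - g) + z| := by congr 1; ring
                _ ≤ |-(z - g)| + |z| := abs_add_le _ _
                _ = _ := by rw [abs_neg]
            have h4 : c0 ≤ 1 / 4 := min_le_right _ _
            have h5 : c1 ≤ 1 / 4 * (1 + |g|) := by rw [hc1]; gcongr
            linarith
        have hw2 : |W z| ≤ sqrt A * rH := by
          rw [hrH, ← Real.sqrt_mul hAp.le]
          exact Real.abs_le_sqrt hw
        have : W z ^ 2 ≤ (sqrt A * rH / c1) * (|W z| * |z - g|) := by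
          rw [← sq_abs, div_mul_eq_mul_div, le_div_iff₀ hc1p]
          calc |W z| ^ 2 * c1 = |W z| * |W z| * c1 := by ring
            _ ≤ (sqrt A * rH) * |W z| * |z - g| := by gcongr
            _ = _ := by ring
        linarith
  have hint := gm_int_le S.e0.sq (((hze.smul (Z ^ 2)⁻¹).add (hXe.smul (A * H))).add (hIe.smul (sqrt A * rH / c1))) key
  rw [integral_add ((hze.smul (Z ^ 2)⁻¹).add (hXe.smul (A * H))).int (hIe.smul _).int,
    integral_add (hze.smul (Z ^ 2)⁻¹).int (hXe.smul (A * H)).int, integral_const_mul, integral_const_mul,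
    integral_const_mul, ← hHi, ← hI] at hint
  have t1 : (Z ^ 2)⁻¹ * (∫ z, z ^ 2 * W z ^ 2 ∂gm) ≤ H / 4 := by
    rw [inv_mul_le_iff₀ (by positivity)]
    refine hmom.trans ?_
    have : 16 * (gN v vy Q j σ * H) ≤ 16 * (K * H) := by gcongr
    nlinarith
  have t2 : A * H * (∫ z, (Ioo (g - η) (g + η)).indicator (fun _ => (1 : ℝ)) z ∂gm) ≤ H / 4 := by
    calc _ ≤ A * H * (2 * η) := by gcongr; exact gm_small g η hηp.le
      _ = _ := by rw [hη]; field_simp; norm_num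
  have t3 : H / 2 ≤ sqrt A * rH / c1 * I := by linarith
  rw [div_mul_eq_mul_div, le_div_iff₀ hc1p, ← hrH2] at t3
  have t4 : rH * (rH * c1) ≤ rH * (2 * sqrt A * I) := by linarith
  have t5 := le_of_mul_le_mul_left t4 hrHp
  rw [show c0 / (2 * sqrt A) * (1 + |g|) * rH = (rH * c1) / (2 * sqrt A) by rw [hc1]; ring,
    div_le_iff₀ (by positivity)]
  linarith

set_option maxHeartbeats 400000 in
lemma not_single (c : Ctx v vy vyy vt ta tb M B R J K) (ht : j ∈ Ioo (ta + J ^ 2) tb) (hv : v Q j = 0)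
    (hvy : vy Q j = 0) {ρ τ : ℝ} (hρ : 0 < ρ) (hτ : τ < j)
    (h : ∀ t ∈ Ioo τ j, ∃ γ s : ℝ, (s = 1 ∨ s = -1) ∧ ∀ y ∈ Icc (Q - ρ) (Q + ρ), 0 ≤ s * (v y t * (y - γ))) :
    False := by
  obtain ⟨θ, hθ, hlow⟩ := c.lowI
  obtain ⟨σ2, hσ2, hN⟩ := c.N_low ht hv hvy
  set cz := sqrt (∫ z, z ^ 2 ∂gm) with hcz
  have hcz0 : 0 ≤ cz := Real.sqrt_nonneg _
  set kk := (1 + (K : ℝ)) with hkk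
  set cT := ∫ z, |z| * (1 + |z|) * exp (kk * |z|) ∂gm with hcT
  have hcT0 : 0 ≤ cT := integral_nonneg fun z => by positivity
  have hTe : EB (fun z => |z| * (1 + |z|) * exp (kk * |z|)) :=
    (EB.id.abs.mul ((EB.const 1).add EB.id.abs)).mul (EB.exp _)
  set sp := sqrt (cp M K) with hsp
  have hsp0 : 0 ≤ sp := Real.sqrt_nonneg _
  set C1 := 5 * cz + 2 with hC1
  set C2 := 2 * (sp * cT) / ρ with hC2
  have hC20 : 0 ≤ C2 := by positivity
  set δ := θ / (4 * C1) with hδ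
  have hδp : 0 < δ := by positivity
  obtain ⟨r0, hr0, hr1, hgood⟩ := c.good (Q := Q) ht (η := δ ^ 2) (by positivity)
  have ht2 : 0 < j - (ta + J ^ 2) := by linarith [ht.1]
  have ht3 : 0 < j - τ := by linarith
  have hl := c.l1
  set r := min (r0 / 2) (min (σ2 / 2) (min ((j - (ta + J ^ 2)) / 4) (min ((j - τ) / 4) (θ / (8 * (C2 + 1)))))) with hr
  have hrp : 0 < r := by positivity
  have q1 : r ≤ r0 / 2 := min_le_left _ _
  have q2 : r ≤ σ2 / 2 := (min_le_right _ _).trans (min_le_left _ _)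
  have q3 : r ≤ (j - (ta + J ^ 2)) / 4 := (min_le_right _ _).trans ((min_le_right _ _).trans (min_le_left _ _))
  have q4 : r ≤ (j - τ) / 4 :=
    (min_le_right _ _).trans ((min_le_right _ _).trans ((min_le_right _ _).trans (min_le_left _ _)))
  have q5 : r ≤ θ / (8 * (C2 + 1)) :=
    (min_le_right _ _).trans ((min_le_right _ _).trans ((min_le_right _ _).trans (min_le_right _ _)))
  clear_value r
  obtain ⟨σ, hσ, hD⟩ := hgood r ⟨hrp, by linarith⟩
  have hσ0 : 0 < σ := hrp.trans hσ.1
  have h2σ : 2 * σ ≤ J := by linarith [hσ.2]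
  have hs : σ ∈ Ioc 0 J := ⟨hσ0, by linarith⟩
  have hσ1 : σ ≤ 1 := hs.2.trans hl
  have hsq : σ ^ 2 ≤ σ := by nlinarith
  have hsq0 : 0 < σ ^ 2 := by positivity
  have ht' : ta + J ^ 2 < j - σ ^ 2 := by linarith [hσ.2]
  obtain ⟨γ, s, hss, hsign⟩ := h (j - σ ^ 2) ⟨by linarith [hσ.2], by linarith⟩
  have hs1 : |s| = 1 := by rcases hss with rfl | rfl <;> norm_num
  set g := (γ - Q) / σ with hg
  have hlo := hlow Q j σ g ht hσ0 h2σ ht'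
  obtain ⟨m0, m1⟩ := c.moments (Q := Q) ht hs hδp.le hD (hN σ ⟨hσ0, by linarith [hσ.2]⟩ hs.2)
  have hpW := c.pointW (Q := Q) ht hσ0 h2σ ht'
  have htm := tmem ht hs
  have S := c.m.slice htm Q σ hσ0
  set W : ℝ → ℝ := fun z => v (Q + σ * z) (j - σ ^ 2) with hW
  have hHp : 0 < gH v Q j σ := c.m.H_pos hσ0 htm
  set H := gH v Q j σ with hH
  clear_value H
  set rH := sqrt H with hrH
  have hrHp : 0 < rH := Real.sqrt_pos.2 hHp
  have hIe : EB (fun z => |W z| * |z - g|) := S.e0.abs.mul ((EB.id.sub (EB.const g)).abs)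
  set k2 := 2 * (σ / ρ * (sp * rH * (1 + |g|))) with hk2
  have hk20 : 0 ≤ k2 := by positivity
  have key : ∀ z, |W z| * |z - g| ≤ (s * (z * W z) - s * g * W z) + k2 * (|z| * (1 + |z|) * exp (kk * |z|)) := by
    intro z
    by_cases hz : σ * |z| ≤ ρ
    · have h1 : 0 ≤ s * (W z * (z - g)) := by
        have hm : σ * z ∈ Icc (-ρ) ρ := by
          rw [mem_Icc, ← abs_le, abs_mul, abs_of_pos hσ0]; exact hz
        have := hsign (Q + σ * z) ⟨by linarith [hm.1], by linarith [hm.2]⟩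
        have e : Q + σ * z - γ = σ * (z - g) := by rw [hg]; field_simp; ring
        rw [e, show s * (v (Q + σ * z) (j - σ ^ 2) * (σ * (z - g))) = σ * (s * (W z * (z - g))) by rw [hW]; ring] at this
        exact nonneg_of_mul_nonneg_right this hσ0
      have h2 : |W z| * |z - g| = s * (W z * (z - g)) := by
        rw [← abs_mul, ← one_mul |W z * (z - g)|, ← hs1, ← abs_mul, abs_of_nonneg h1]
      rw [h2]
      have : 0 ≤ k2 * (|z| * (1 + |z|) * exp (kk * |z|)) := by positivity
      linarith
    · push Not at hz
      have h1 : -(|W z| * |z - g|) ≤ s * (W z * (z - g)) := by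
        have := neg_abs_le (s * (W z * (z - g)))
        rwa [abs_mul, abs_mul, hs1, one_mul] at this
      have h2 : |W z| ≤ sp * exp (kk * |z|) * rH := by
        have h3 : W z ^ 2 ≤ (sp * exp (kk * |z|) * rH) ^ 2 := by
          refine (hpW z).trans ?_
          rw [mul_pow, mul_pow, hsp, hrH, Real.sq_sqrt (cp_pos M K).le, Real.sq_sqrt hHp.le]
          have := (cp_pos M K).le
          gcongr
          rw [← Real.exp_nat_mul, Real.exp_le_exp]
          have : 0 ≤ kk * |z| := by positivity
          push_cast; linarith
        exact abs_le_of_sq_le_sq h3 (by positivity)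
      have h4 : |z - g| ≤ (1 + |g|) * (1 + |z|) := by
        have := abs_sub z g
        linarith [mul_nonneg (abs_nonneg z) (abs_nonneg g)]
      have h5 : 1 ≤ σ / ρ * |z| := by
        rw [div_mul_eq_mul_div, one_le_div hρ]; exact hz.le
      have h6 : 2 * (|W z| * |z - g|) ≤ k2 * (|z| * (1 + |z|) * exp (kk * |z|)) := by
        calc 2 * (|W z| * |z - g|) ≤ 2 * (sp * exp (kk * |z|) * rH * ((1 + |g|) * (1 + |z|))) * 1 := by
              rw [mul_one]; gcongr
          _ ≤ 2 * (sp * exp (kk * |z|) * rH * ((1 + |g|) * (1 + |z|))) * (σ / ρ * |z|) := by gcongr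
          _ = _ := by rw [hk2]; ring
      linarith
  have hzW : EB (fun z => z * W z) := EB.id.mul S.e0
  have hint := gm_int_le hIe (((hzW.smul s).sub (S.e0.smul (s * g))).add (hTe.smul k2)) key
  rw [integral_add ((hzW.smul s).sub (S.e0.smul (s * g))).int (hTe.smul k2).int,
    integral_sub (hzW.smul s).int (S.e0.smul (s * g)).int, integral_const_mul, integral_const_mul,
    integral_const_mul, ← hcT] at hint
  have u1 : s * (∫ z, z * W z ∂gm) ≤ 5 * cz * δ * rH := by
    refine (le_abs_self _).trans ?_
    rw [abs_mul, hs1, one_mul]; exact m1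
  have u2 : -(s * g * (∫ z, W z ∂gm)) ≤ |g| * (2 * δ * rH) := by
    refine (neg_le_abs _).trans ?_
    rw [abs_mul, abs_mul, hs1, one_mul]; gcongr
  have u3 : θ * (1 + |g|) * rH ≤ (1 + |g|) * rH * (C1 * δ + C2 * σ) := by
    have e : k2 * cT = (1 + |g|) * rH * (C2 * σ) := by rw [hk2, hC2]; field_simp
    have p1 : 0 ≤ |g| * (cz * δ * rH) := by positivity
    have p2 : 0 ≤ δ * rH := by positivity
    rw [hC1]
    linarith
  have hgr : 0 < (1 + |g|) * rH := by positivity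
  have u4 : θ ≤ C1 * δ + C2 * σ := le_of_mul_le_mul_left (by linarith) hgr
  have hC1p : C1 ≠ 0 := by rw [hC1]; positivity
  have u5 : C1 * δ = θ / 4 := by rw [hδ]; field_simp
  have u6 : (C2 + 1) * σ ≤ θ / 4 := by
    rw [le_div_iff₀ (by positivity)] at q5
    have := mul_le_mul_of_nonneg_left hσ.2.le (show 0 ≤ C2 + 1 by linarith)
    linarith
  linarith
end Ctx

lemma sec_min {f f' : ℝ → ℝ} {f'' x : ℝ} (h : IsLocalMin f x) (h1 : ∀ᶠ y in 𝓝 x, HasDerivAt f (f' y) y)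
    (h2 : HasDerivAt f' f'' x) : f' x = 0 ∧ 0 ≤ f'' := by
  have h0 : f' x = 0 := h.hasDerivAt_eq_zero h1.self_of_nhds
  refine ⟨h0, ?_⟩
  by_contra hneg
  push Not at hneg
  have hd : deriv f =ᶠ[𝓝 x] f' := h1.mono fun y hy => hy.deriv
  have hmax : IsLocalMax f x := by
    refine isLocalMax_of_deriv_deriv_neg ?_ ?_ h1.self_of_nhds.continuousAt
    · rw [hd.deriv_eq, h2.deriv]; exact hneg
    · rw [h1.self_of_nhds.deriv, h0]
  have he : f =ᶠ[𝓝 x] fun _ => f x := by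
    filter_upwards [h, hmax] with y a b using le_antisymm b a
  have h3 : f' =ᶠ[𝓝 x] fun _ => 0 := by
    have := he.deriv
    filter_upwards [this, hd] with y a b
    rw [← b, a]; simp
  have h4 := (hasDerivAt_const x (0 : ℝ)).congr_of_eventuallyEq h3
  have := h2.unique h4
  linarith

lemma exp_drop {f : ℝ → ℝ} {f' t M t1 : ℝ} (h1 : t1 < t) (hd : HasDerivAt f f' t) (hf : f t < 0)
    (h : M * f t ≤ f') : ∃ t' ∈ Ioo t1 t, ∀ r ∈ Ico t' t, exp (-(M + 1) * r) * f r < exp (-(M + 1) * t) * f t := by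
  have e1 : HasDerivAt (fun r => exp (-(M + 1) * r)) (exp (-(M + 1) * t) * (-(M + 1))) t := by
    have : HasDerivAt (fun r : ℝ => -(M + 1) * r) (-(M + 1)) t := by
      simpa using (hasDerivAt_id t).const_mul (-(M + 1))
    exact this.exp
  have e2 := e1.mul hd
  have hpos : 0 < exp (-(M + 1) * t) * (-(M + 1)) * f t + exp (-(M + 1) * t) * f' := by
    have : 0 < exp (-(M + 1) * t) := Real.exp_pos _
    have h3 : 0 < exp (-(M + 1) * t) * (f' - (M + 1) * f t) := mul_pos this (by linarith)
    linarith
  have h5 := eventually_nhdsWithin_sign_eq_of_deriv_pos (f := fun r => exp (-(M + 1) * r) * f r - exp (-(M + 1) * t) * f t)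
    (x₀ := t) (by
      have := (e2.sub_const (exp (-(M + 1) * t) * f t)).deriv
      simp only [Pi.mul_apply] at this
      rw [this]; exact hpos) (by simp)
  have h6 : ∀ᶠ r in 𝓝[<] t, exp (-(M + 1) * r) * f r < exp (-(M + 1) * t) * f t := by
    have := h5.filter_mono (nhdsWithin_le_nhds (s := Iio t))
    filter_upwards [this, self_mem_nhdsWithin] with r hr hr2
    have hlt : r - t < 0 := sub_neg.2 hr2
    rw [sign_neg hlt, sign_eq_neg_one_iff] at hr
    linarith
  obtain ⟨l, hl, hl2⟩ := (mem_nhdsLT_iff_exists_Ioo_subset).1 h6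
  have hl' : l < t := hl
  refine ⟨(max l t1 + t) / 2, ⟨?_, ?_⟩, fun r hr => hl2 ⟨?_, hr.2⟩⟩
  · have := le_max_right l t1; linarith
  · have : max l t1 < t := max_lt hl' h1; linarith
  · have := le_max_left l t1; have : max l t1 < t := max_lt hl' h1
    linarith [hr.1]

lemma weak_max {w wt : ℝ → ℝ → ℝ} {α β t1 t2 M : ℝ}
    (hc : ContinuousOn (fun p : ℝ × ℝ => w p.1 p.2) (Icc α β ×ˢ Icc t1 t2))
    (hdt : ∀ y ∈ Ioo α β, ∀ t ∈ Ioc t1 t2, HasDerivAt (fun t => w y t) (wt y t) t)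
    (hmin : ∀ y ∈ Ioo α β, ∀ t ∈ Ioc t1 t2, w y t < 0 → IsLocalMin (fun y => w y t) y → M * w y t ≤ wt y t)
    (b0 : ∀ y ∈ Icc α β, 0 ≤ w y t1) (bα : ∀ t ∈ Icc t1 t2, 0 ≤ w α t) (bβ : ∀ t ∈ Icc t1 t2, 0 ≤ w β t) :
    ∀ y ∈ Icc α β, ∀ t ∈ Icc t1 t2, 0 ≤ w y t := by
  intro y hy t ht
  have hcg : ContinuousOn (fun p : ℝ × ℝ => exp (-(M + 1) * p.2) * w p.1 p.2) (Icc α β ×ˢ Icc t1 t2) :=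
    ContinuousOn.mul (by fun_prop) hc
  obtain ⟨p, hp, hpm⟩ := (isCompact_Icc.prod isCompact_Icc).exists_isMinOn ⟨(y, t), hy, ht⟩ hcg
  obtain ⟨a, r⟩ := p
  obtain ⟨ha, hr⟩ := hp
  simp only at ha hr
  by_contra hneg
  push Not at hneg
  have hle : exp (-(M + 1) * r) * w a r ≤ exp (-(M + 1) * t) * w y t :=
    hpm (show (y, t) ∈ _ from ⟨hy, ht⟩)
  have hwneg : w a r < 0 := by
    have h1 : exp (-(M + 1) * t) * w y t < 0 := mul_neg_of_pos_of_neg (Real.exp_pos _) hneg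
    by_contra h2; push Not at h2
    have := mul_nonneg (Real.exp_pos (-(M + 1) * r)).le h2
    linarith
  have hr1 : t1 < r := lt_of_le_of_ne hr.1 fun h => by subst h; linarith [b0 a ha]
  have ha1 : α < a := lt_of_le_of_ne ha.1 fun h => by subst h; linarith [bα r hr]
  have ha2 : a < β := lt_of_le_of_ne ha.2 fun h => by subst h; linarith [bβ r hr]
  have hloc : IsLocalMin (fun y => w y r) a := by
    filter_upwards [Icc_mem_nhds ha1 ha2] with y' hy'
    have h3 : exp (-(M + 1) * r) * w a r ≤ exp (-(M + 1) * r) * w y' r :=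
      hpm (show (y', r) ∈ _ from ⟨hy', hr⟩)
    exact le_of_mul_le_mul_left h3 (Real.exp_pos _)
  have h4 := hmin a ⟨ha1, ha2⟩ r ⟨hr1, hr.2⟩ hwneg hloc
  obtain ⟨t', ht', hlt⟩ := exp_drop hr1 (hdt a ⟨ha1, ha2⟩ r ⟨hr1, hr.2⟩) hwneg h4
  have h5 := hlt t' ⟨le_rfl, ht'.2⟩
  have h6 : exp (-(M + 1) * r) * w a r ≤ exp (-(M + 1) * t') * w a t' :=
    hpm (show (a, t') ∈ _ from ⟨ha, ht'.1.le, ht'.2.le.trans hr.2⟩)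
  linarith

namespace PMod
variable {v vy vyy vt : ℝ → ℝ → ℝ} {ta tb M B R : ℝ} {α β t1 t2 : ℝ}

lemma neg (m : PMod v vy vyy vt ta tb M B R) : PMod (fun y t => -v y t) (fun y t => -vy y t)
    (fun y t => -vyy y t) (fun y t => -vt y t) ta tb M B R where
  hM := m.hM
  hB := m.hB
  hR := m.hR
  dy t ht y := (m.dy t ht y).fun_neg
  dyy t ht y hy := (m.dyy t ht y hy).fun_neg
  dt t ht y := (m.dt t ht y).fun_neg
  cy := m.cy.fun_neg
  cyy := m.cyy.fun_neg
  bv t ht y := by rw [abs_neg]; exact m.bv t ht y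
  bvy t ht y := by rw [abs_neg]; exact m.bvy t ht y
  bvyy t ht y := by rw [abs_neg]; exact m.bvyy t ht y
  bvt t ht y := by rw [abs_neg]; exact m.bvt t ht y
  eqn t ht y hy := by
    have := m.eqn t ht y hy
    rw [abs_neg, abs_neg, ← abs_neg]
    convert this using 2; ring
  far t ht y hy := by rw [abs_neg]; exact m.far t ht y hy
  zero t ht := by rw [m.zero t ht, neg_zero]

lemma jc (m : PMod v vy vyy vt ta tb M B R) : ContinuousOn (fun p : ℝ × ℝ => v p.1 p.2) {p | p.2 ∈ Ioo ta tb} := by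
  intro p hp
  rw [Metric.continuousWithinAt_iff]
  intro ε hε
  have hB := m.hB
  refine ⟨ε / (2 * B + 1), by positivity, fun q hq hd => ?_⟩
  rw [Real.dist_eq]
  refine (m.lip hq hp).trans_lt ?_
  have h1 : |q.1 - p.1| ≤ dist q p := by rw [← Real.dist_eq, Prod.dist_eq]; exact le_max_left _ _
  have h2 : |q.2 - p.2| ≤ dist q p := by rw [← Real.dist_eq, Prod.dist_eq]; exact le_max_right _ _
  have h3 : dist q p * (2 * B + 1) < ε := by rwa [lt_div_iff₀ (by positivity)] at hd
  have h4 : B * |q.1 - p.1| ≤ B * dist q p := by gcongr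
  have h5 : B * |q.2 - p.2| ≤ B * dist q p := by gcongr
  have h6 : (0 : ℝ) ≤ dist q p := dist_nonneg
  rcases h6.eq_or_lt with h7 | h7
  · rw [← h7] at h4 h5; linarith
  · linarith

lemma ct' (m : PMod v vy vyy vt ta tb M B R) (y : ℝ) {t : ℝ} (ht : t ∈ Ioo ta tb) : ContinuousAt (fun t => v y t) t :=
  (m.dt t ht y).continuousAt

lemma sub_Ioo (h1 : t1 ∈ Ioo ta tb) (h2 : t2 ∈ Ioo ta tb) {t : ℝ} (ht : t ∈ Icc t1 t2) : t ∈ Ioo ta tb :=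
  ⟨h1.1.trans_le ht.1, ht.2.trans_lt h2.2⟩

lemma weak (m : PMod v vy vyy vt ta tb M B R) (h0 : (0 : ℝ) ∉ Ioo α β) (h1 : t1 ∈ Ioo ta tb) (h2 : t2 ∈ Ioo ta tb)
    (b0 : ∀ y ∈ Icc α β, 0 ≤ v y t1) (bα : ∀ t ∈ Icc t1 t2, 0 ≤ v α t) (bβ : ∀ t ∈ Icc t1 t2, 0 ≤ v β t) :
    ∀ y ∈ Icc α β, ∀ t ∈ Icc t1 t2, 0 ≤ v y t := by
  refine weak_max (wt := vt) (M := M) (m.jc.mono fun p hp => sub_Ioo h1 h2 hp.2)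
    (fun y hy t ht => m.dt t (sub_Ioo h1 h2 (Ioc_subset_Icc_self ht)) y) ?_ b0 bα bβ
  intro y hy t ht hneg hloc
  have htt := sub_Ioo h1 h2 (Ioc_subset_Icc_self ht)
  have hy0 : y ≠ 0 := fun h => h0 (h ▸ hy)
  obtain ⟨q1, q2⟩ := sec_min hloc (Eventually.of_forall fun y => m.dy t htt y) (m.dyy t htt y hy0)
  have := (abs_le.1 (m.eqn t htt y hy0)).1
  rw [q1, abs_zero, abs_of_neg hneg] at this
  linarith

lemma strong (m : PMod v vy vyy vt ta tb M B R) (h0 : (0 : ℝ) ∉ Ioo α β) (h1 : t1 ∈ Ioo ta tb) (h2 : t2 ∈ Ioo ta tb)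
    (h12 : t1 < t2)
    (b0 : ∀ y ∈ Icc α β, 0 ≤ v y t1) (bα : ∀ t ∈ Icc t1 t2, 0 ≤ v α t) (bβ : ∀ t ∈ Icc t1 t2, 0 < v β t) :
    ∀ y ∈ Ioc α β, 0 < v y t2 := by
  intro ys hys
  have hw := m.weak h0 h1 h2 b0 bα (fun t ht => (bβ t ht).le)
  have hαβ : α < β := hys.1.trans_le hys.2
  obtain ⟨κ, hκ, hκb⟩ : ∃ κ > 0, ∀ t ∈ Icc t1 t2, κ ≤ v β t := by
    obtain ⟨t, ht, hm⟩ := isCompact_Icc.exists_isMinOn (nonempty_Icc.2 h12.le)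
      (fun t ht => (m.ct' β (sub_Ioo h1 h2 ht)).continuousWithinAt : ContinuousOn (fun t => v β t) (Icc t1 t2))
    exact ⟨v β t, bβ t ht, fun r hr => hm hr⟩
  set y' := (α + ys) / 2 with hy'
  have hy1 : α < y' := by rw [hy']; linarith [hys.1]
  have hy2 : y' < ys := by rw [hy']; linarith [hys.1]
  set V := (β - y') / (t2 - t1) with hV
  have hV0 : 0 ≤ V := div_nonneg (by linarith [hys.2]) (by linarith)
  have hV1 : V * (t2 - t1) = β - y' := by rw [hV]; field_simp [(sub_pos.2 h12).ne']
  clear_value V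
  have hM := m.hM
  set μ := M + V + 1 with hμ
  have hμ0 : 0 < μ := by positivity
  set E : ℝ → ℝ → ℝ := fun y t => exp (μ * (y - (β - V * (t - t1)))) with hE
  set ε := κ / exp (μ * (β - α)) with hε
  have hεp : 0 < ε := by positivity
  have hεκ : ε * exp (μ * (β - α)) = κ := by rw [hε]; field_simp
  clear_value ε
  have hl : ∀ t ∈ Icc t1 t2, y' ≤ β - V * (t - t1) := by
    intro t ht
    have : V * (t - t1) ≤ V * (t2 - t1) := by gcongr; exact ht.2
    linarith
  have hEt : ∀ y t, HasDerivAt (fun t => E y t) (E y t * (μ * V)) t := by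
    intro y t
    have : HasDerivAt (fun t => μ * (y - (β - V * (t - t1)))) (μ * V) t := by
      have := (((((hasDerivAt_id t).sub_const t1).const_mul V).const_sub β).const_sub y).const_mul μ
      simpa using this
    exact this.exp
  have hEy : ∀ y t, HasDerivAt (fun y => E y t) (E y t * μ) y := by
    intro y t
    have : HasDerivAt (fun y => μ * (y - (β - V * (t - t1)))) μ y := by
      simpa using ((hasDerivAt_id y).sub_const (β - V * (t - t1))).const_mul μ
    exact this.exp
  have key := weak_max (w := fun y t => v y t - ε * (E y t - 1)) (wt := fun y t => vt y t - ε * (E y t * (μ * V)))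
    (α := α) (β := β) (t1 := t1) (t2 := t2) (M := M) ?_ ?_ ?_ ?_ ?_ ?_ ys ⟨hys.1.le, hys.2⟩ t2 ⟨h12.le, le_rfl⟩
  · have : 1 < E ys t2 := by
      rw [hE]; simp only
      rw [Real.one_lt_exp_iff]
      apply mul_pos hμ0
      linarith
    have := mul_pos hεp (sub_pos.2 this)
    linarith
  · refine ContinuousOn.sub (m.jc.mono fun p hp => sub_Ioo h1 h2 hp.2) ?_
    rw [hE]; fun_prop
  · intro y hy t ht
    exact (m.dt t (sub_Ioo h1 h2 (Ioc_subset_Icc_self ht)) y).sub (((hEt y t).sub_const 1).const_mul ε)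
  · intro y hy t ht hneg hloc
    have htt := sub_Ioo h1 h2 (Ioc_subset_Icc_self ht)
    have hy0 : y ≠ 0 := fun h => h0 (h ▸ hy)
    obtain ⟨q1, q2⟩ := sec_min (f' := fun y => vy y t - ε * (E y t * μ)) (f'' := vyy y t - ε * (E y t * μ * μ)) hloc
      (Eventually.of_forall fun y => (m.dy t htt y).sub (((hEy y t).sub_const 1).const_mul ε))
      ((m.dyy t htt y hy0).sub (((hEy y t).mul_const μ).const_mul ε))
    have hEp : 0 < E y t := Real.exp_pos _
    have h3 := (abs_le.1 (m.eqn t htt y hy0)).1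
    have hv0 := hw y (Ioo_subset_Icc_self hy) t (Ioc_subset_Icc_self ht)
    have hvy : vy y t = ε * (E y t * μ) := by linarith
    have hvyp : 0 ≤ ε * (E y t * μ) := by positivity
    rw [abs_of_nonneg hv0, hvy, abs_of_nonneg hvyp] at h3
    have hvle : M * v y t ≤ M * (ε * E y t) := by
      gcongr
      linarith
    have hMw : M * (v y t - ε * (E y t - 1)) ≤ 0 := mul_nonpos_of_nonneg_of_nonpos hM hneg.le
    refine hMw.trans ?_
    have hfin : 0 ≤ ε * E y t * (μ * μ - M * μ - M - μ * V) := by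
      refine mul_nonneg (by positivity) ?_
      have : μ * μ - M * μ - M - μ * V = V + 1 := by rw [hμ]; ring
      rw [this]; linarith
    change 0 ≤ vt y t - ε * (E y t * (μ * V))
    linarith
  · intro y hy
    have : E y t1 ≤ 1 := by
      rw [hE]; simp only
      rw [Real.exp_le_one_iff]
      have : y - (β - V * (t1 - t1)) ≤ 0 := by rw [sub_self, mul_zero]; linarith [hy.2]
      exact mul_nonpos_of_nonneg_of_nonpos hμ0.le this
    have := mul_nonpos_of_nonneg_of_nonpos hεp.le (sub_nonpos.2 this)
    linarith [b0 y hy]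
  · intro t ht
    have : E α t ≤ 1 := by
      rw [hE]; simp only
      rw [Real.exp_le_one_iff]
      exact mul_nonpos_of_nonneg_of_nonpos hμ0.le (by linarith [hl t ht])
    have := mul_nonpos_of_nonneg_of_nonpos hεp.le (sub_nonpos.2 this)
    linarith [bα t ht]
  · intro t ht
    have : E β t ≤ exp (μ * (β - α)) := by
      rw [hE]; simp only
      gcongr
      linarith [hl t ht]
    have := mul_le_mul_of_nonneg_left this hεp.le
    linarith [hκb t ht]

lemma mtrick (m : PMod v vy vyy vt ta tb M B R) (h0 : (0 : ℝ) ∉ Ioo α β) (h1 : t1 ∈ Ioo ta tb) (h2 : t2 ∈ Ioo ta tb)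
    (h12 : t1 ≤ t2) (bα : ∀ t ∈ Icc t1 t2, v α t < 0) (bβ : ∀ t ∈ Icc t1 t2, 0 < v β t)
    (b0 : ∀ p q, α ≤ p → p ≤ q → q ≤ β → 0 < v p t1 → 0 ≤ v q t1) :
    ∀ p q, α ≤ p → p ≤ q → q ≤ β → 0 < v p t2 → 0 ≤ v q t2 := by
  intro p q hp hpq hq hvp
  by_contra hvq
  push Not at hvq
  set S : Set ((ℝ × ℝ) × ℝ) := {x | α ≤ x.1.1 ∧ x.1.1 ≤ x.1.2 ∧ x.1.2 ≤ β ∧ x.2 ∈ Icc t1 t2} with hS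
  have hSc : IsCompact S := by
    refine ((isCompact_Icc (a := α) (b := β)).prod (isCompact_Icc (a := α) (b := β)) |>.prod
      (isCompact_Icc (a := t1) (b := t2))).of_isClosed_subset ?_ ?_
    · have e : S = {x | α ≤ x.1.1} ∩ {x | x.1.1 ≤ x.1.2} ∩ {x | x.1.2 ≤ β} ∩ {x | t1 ≤ x.2} ∩ {x | x.2 ≤ t2} := by
        ext x; simp only [hS, mem_Icc, mem_inter_iff, mem_setOf_eq]; tauto
      rw [e]
      exact ((((isClosed_le (by fun_prop) (by fun_prop)).inter (isClosed_le (by fun_prop) (by fun_prop))).inter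
        (isClosed_le (by fun_prop) (by fun_prop))).inter (isClosed_le (by fun_prop) (by fun_prop))).inter
        (isClosed_le (by fun_prop) (by fun_prop))
    · rintro x ⟨a, b, c, d⟩
      exact ⟨⟨⟨a, b.trans c⟩, ⟨a.trans b, c⟩⟩, d⟩
  have hg : ContinuousOn (fun x : (ℝ × ℝ) × ℝ => exp (-(M + 1) * x.2) * max (-v x.1.1 x.2) (v x.1.2 x.2)) S := by
    refine ContinuousOn.mul (by fun_prop) (ContinuousOn.sup (ContinuousOn.neg ?_) ?_)
    · exact m.jc.comp (f := fun x : (ℝ × ℝ) × ℝ => (x.1.1, x.2)) (by fun_prop) fun x hx => sub_Ioo h1 h2 hx.2.2.2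
    · exact m.jc.comp (f := fun x : (ℝ × ℝ) × ℝ => (x.1.2, x.2)) (by fun_prop) fun x hx => sub_Ioo h1 h2 hx.2.2.2
  obtain ⟨⟨⟨a, b⟩, t⟩, hx, hmin⟩ := hSc.exists_isMinOn ⟨((p, q), t2), hp, hpq, hq, h12, le_rfl⟩ hg
  obtain ⟨x1, x2, x3, x4⟩ := hx
  simp only at x1 x2 x3 x4
  have hm1 : exp (-(M + 1) * t) * max (-v a t) (v b t) ≤ exp (-(M + 1) * t2) * max (-v p t2) (v q t2) :=
    hmin (show ((p, q), t2) ∈ S from ⟨hp, hpq, hq, h12, le_rfl⟩)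
  have hm2 : max (-v a t) (v b t) < 0 := by
    have : exp (-(M + 1) * t2) * max (-v p t2) (v q t2) < 0 :=
      mul_neg_of_pos_of_neg (Real.exp_pos _) (max_lt (by linarith) hvq)
    by_contra h3; push Not at h3
    have := mul_nonneg (Real.exp_pos (-(M + 1) * t)).le h3
    linarith
  rw [max_lt_iff] at hm2
  have ht1 : t1 < t := lt_of_le_of_ne x4.1 fun h => by
    subst h; linarith [b0 a b x1 x2 x3 (by linarith)]
  have htt := sub_Ioo h1 h2 x4
  have hcv := m.cv htt
  obtain ⟨a', ha', hamax⟩ := isCompact_Icc.exists_isMaxOn (s := Icc α b) ⟨a, x1, x2⟩ hcv.continuousOn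
  obtain ⟨b', hb', hbmin⟩ := isCompact_Icc.exists_isMinOn (s := Icc a' β) ⟨b, ha'.2, x3⟩ hcv.continuousOn
  have hva : v a t ≤ v a' t := hamax (show a ∈ _ from ⟨x1, x2⟩)
  have hvb : v b' t ≤ v b t := hbmin (show b ∈ _ from ⟨ha'.2, x3⟩)
  have n1 : α < a' := lt_of_le_of_ne ha'.1 fun h => by rw [← h] at hva; linarith [bα t x4]
  have n2 : a' < b := lt_of_le_of_ne ha'.2 fun h => by rw [h] at hva; linarith
  have n3 : a' < b' := lt_of_le_of_ne hb'.1 fun h => by rw [← h] at hvb; linarith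
  have n4 : b' < β := lt_of_le_of_ne hb'.2 fun h => by rw [h] at hvb; linarith [bβ t x4]
  have za : a' ≠ 0 := fun h => h0 ⟨h ▸ n1, h ▸ (n2.trans_le x3)⟩
  have zb : b' ≠ 0 := fun h => h0 ⟨h ▸ (n1.trans n3), h ▸ n4⟩
  have la : IsLocalMin (fun y => -v y t) a' := by
    filter_upwards [Icc_mem_nhds n1 n2] with y hy
    exact neg_le_neg (hamax hy)
  have lb : IsLocalMin (fun y => v y t) b' := by
    filter_upwards [Icc_mem_nhds n3 n4] with y hy using hbmin hy
  obtain ⟨qa1, qa2⟩ := sec_min la (Eventually.of_forall fun y => (m.neg.dy t htt y)) (m.neg.dyy t htt a' za)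
  obtain ⟨qb1, qb2⟩ := sec_min lb (Eventually.of_forall fun y => (m.dy t htt y)) (m.dyy t htt b' zb)
  have ea := (abs_le.1 (m.neg.eqn t htt a' za)).1
  have eb := (abs_le.1 (m.eqn t htt b' zb)).1
  rw [qa1, abs_zero, abs_of_neg (show -v a' t < 0 by linarith)] at ea
  rw [qb1, abs_zero, abs_of_neg (show v b' t < 0 by linarith)] at eb
  obtain ⟨ra, hra, hra2⟩ := exp_drop (M := M) ht1 (m.neg.dt t htt a') (by linarith) (by linarith)
  obtain ⟨rb, hrb, hrb2⟩ := exp_drop (M := M) ht1 (m.dt t htt b') (by linarith) (by linarith)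
  have hr1 := hra2 (max ra rb) ⟨le_max_left _ _, max_lt hra.2 hrb.2⟩
  have hr2 := hrb2 (max ra rb) ⟨le_max_right _ _, max_lt hra.2 hrb.2⟩
  set r := max ra rb with hr
  have hrt : t1 < r := hra.1.trans_le (le_max_left _ _)
  have hrt2 : r < t := max_lt hra.2 hrb.2
  have hm3 : exp (-(M + 1) * t) * max (-v a t) (v b t) ≤ exp (-(M + 1) * r) * max (-v a' r) (v b' r) :=
    hmin (show ((a', b'), r) ∈ S from ⟨n1.le, n3.le, n4.le, hrt.le, hrt2.le.trans x4.2⟩)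
  have e1 : exp (-(M + 1) * t) * -v a' t ≤ exp (-(M + 1) * t) * max (-v a t) (v b t) := by
    gcongr; exact le_max_of_le_left (by linarith)
  have e2 : exp (-(M + 1) * t) * v b' t ≤ exp (-(M + 1) * t) * max (-v a t) (v b t) := by
    gcongr; exact le_max_of_le_right (by linarith)
  rcases max_choice (-v a' r) (v b' r) with h | h <;> rw [h] at hm3 <;> linarith
end PMod

lemma ivt_zero {f : ℝ → ℝ} (hf : Continuous f) {a b : ℝ} (hab : a ≤ b) (h : f a * f b < 0) : ∃ c ∈ Ioo a b, f c = 0 := by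
  have key : ∀ {g : ℝ → ℝ}, Continuous g → g a < 0 → 0 < g b → ∃ c ∈ Ioo a b, g c = 0 := by
    intro g hg h1 h2
    obtain ⟨c, hc, h3⟩ := intermediate_value_Icc hab hg.continuousOn (show (0 : ℝ) ∈ Icc (g a) (g b) from ⟨h1.le, h2.le⟩)
    refine ⟨c, ⟨lt_of_le_of_ne hc.1 ?_, lt_of_le_of_ne hc.2 ?_⟩, h3⟩
    · rintro rfl; linarith
    · rintro rfl; linarith
  rcases mul_neg_iff.1 h with ⟨h1, h2⟩ | ⟨h1, h2⟩
  · obtain ⟨c, hc, h3⟩ := key (g := fun y => -f y) hf.neg (by linarith) (by linarith)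
    exact ⟨c, hc, by linarith⟩
  · exact key hf h1 h2

namespace PMod
variable {v vy vyy vt : ℝ → ℝ → ℝ} {ta tb M B R : ℝ} {α β t1 t2 : ℝ}

lemma refl (m : PMod v vy vyy vt ta tb M B R) : PMod (fun y t => v (-y) t) (fun y t => -vy (-y) t)
    (fun y t => vyy (-y) t) (fun y t => vt (-y) t) ta tb M B R where
  hM := m.hM
  hB := m.hB
  hR := m.hR
  dy t ht y := by
    have := (m.dy t ht (-y)).comp y (hasDerivAt_neg y)
    rw [mul_neg_one] at this; exact this
  dyy t ht y hy := by
    have := ((m.dyy t ht (-y) (neg_ne_zero.2 hy)).comp y (hasDerivAt_neg y)).fun_neg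
    rw [mul_neg_one, neg_neg] at this; exact this
  dt t ht y := m.dt t ht (-y)
  cy := (m.cy.comp (f := fun p : ℝ × ℝ => (-p.1, p.2)) (by fun_prop) fun p hp => hp).fun_neg
  cyy := m.cyy.comp (f := fun p : ℝ × ℝ => (-p.1, p.2)) (by fun_prop) fun p hp => ⟨neg_ne_zero.2 hp.1, hp.2⟩
  bv t ht y := m.bv t ht _
  bvy t ht y := by rw [abs_neg]; exact m.bvy t ht _
  bvyy t ht y := m.bvyy t ht _
  bvt t ht y := m.bvt t ht _
  eqn t ht y hy := by rw [abs_neg]; exact m.eqn t ht _ (neg_ne_zero.2 hy)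
  far t ht y hy := m.far t ht _ (by rwa [abs_neg])
  zero t ht := by rw [neg_zero]; exact m.zero t ht

lemma strongL (m : PMod v vy vyy vt ta tb M B R) (h0 : (0 : ℝ) ∉ Ioo α β) (h1 : t1 ∈ Ioo ta tb) (h2 : t2 ∈ Ioo ta tb)
    (h12 : t1 < t2)
    (b0 : ∀ y ∈ Icc α β, 0 ≤ v y t1) (bα : ∀ t ∈ Icc t1 t2, 0 < v α t) (bβ : ∀ t ∈ Icc t1 t2, 0 ≤ v β t) :
    ∀ y ∈ Ico α β, 0 < v y t2 := by
  intro y hy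
  have := m.refl.strong (α := -β) (β := -α) (fun h => h0 ⟨by linarith [h.2], by linarith [h.1]⟩) h1 h2 h12
    (fun y hy => b0 _ ⟨by linarith [hy.2], by linarith [hy.1]⟩) (by simpa using bβ) (by simpa using bα)
    (-y) ⟨by linarith [hy.2], by linarith [hy.1]⟩
  simpa using this

lemma persist (m : PMod v vy vyy vt ta tb M B R) {j : ℝ} (ht : j ∈ Ioo ta tb) (y : ℝ) (h : 0 < v y j) :
    ∃ η > 0, ∀ t, |t - j| ≤ η → 0 < v y t := by
  have := (m.ct' y ht).eventually (lt_mem_nhds h)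
  obtain ⟨η, hη, h1⟩ := Metric.eventually_nhds_iff.1 this
  refine ⟨η / 2, by positivity, fun t h2 => h1 ?_⟩
  rw [Real.dist_eq]; linarith

lemma uniq (m : PMod v vy vyy vt ta tb M B R) (h0 : (0 : ℝ) ∉ Ioo α β) (h1 : t1 ∈ Ioo ta tb) (h2 : t2 ∈ Ioo ta tb)
    (h12 : t1 < t2) (hfin : {y | v y t2 = 0}.Finite) (bα : ∀ t ∈ Icc t1 t2, v α t < 0) (bβ : ∀ t ∈ Icc t1 t2, 0 < v β t)
    (b0 : ∀ p q, α ≤ p → p ≤ q → q ≤ β → 0 < v p t1 → 0 ≤ v q t1) {y1 y2 : ℝ} (hy1 : y1 ∈ Icc α β) (hy2 : y2 ∈ Icc α β)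
    (e1 : v y1 t2 = 0) (e2 : v y2 t2 = 0) : ¬ y1 < y2 := by
  intro hlt
  obtain ⟨y', hy', hne⟩ : ∃ y' ∈ Ioo y1 y2, v y' t2 ≠ 0 := by
    by_contra h
    push Not at h
    exact (Ioo_infinite hlt) (hfin.subset fun y hy => h y hy)
  rcases lt_or_gt_of_ne hne with hs | hs
  · obtain ⟨η, hη, hp⟩ := m.neg.persist h2 y' (by linarith)
    set t' := max t1 (t2 - η) with ht'
    have q1 : t1 ≤ t' := le_max_left _ _
    have q2 : t' < t2 := max_lt h12 (by linarith)
    have q3 : t2 - η ≤ t' := le_max_right _ _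
    have hI : t' ∈ Ioo ta tb := ⟨h1.1.trans_le q1, q2.trans h2.2⟩
    have hS := m.mtrick h0 h1 hI q1 (fun t ht => bα t ⟨ht.1, ht.2.trans q2.le⟩) (fun t ht => bβ t ⟨ht.1, ht.2.trans q2.le⟩) b0
    have hpp : ∀ t ∈ Icc t' t2, 0 < -v y' t := fun t ht => hp t (by rw [abs_le]; constructor <;> linarith [ht.1, ht.2])
    have := m.neg.strongL (α := α) (β := y') (fun h => h0 ⟨h.1, h.2.trans (hy'.2.trans_le hy2.2)⟩) hI h2 q2 ?_
      (fun t ht => by linarith [bα t ⟨q1.trans ht.1, ht.2⟩]) (fun t ht => (hpp t ht).le) y1 ⟨hy1.1, hy'.1⟩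
    · linarith
    · intro y hy
      by_contra hc
      have := hS y y' hy.1 hy.2 (hy'.2.le.trans hy2.2) (by linarith)
      linarith [hpp t' ⟨le_rfl, q2.le⟩]
  · obtain ⟨η, hη, hp⟩ := m.persist h2 y' hs
    set t' := max t1 (t2 - η) with ht'
    have q1 : t1 ≤ t' := le_max_left _ _
    have q2 : t' < t2 := max_lt h12 (by linarith)
    have q3 : t2 - η ≤ t' := le_max_right _ _
    have hI : t' ∈ Ioo ta tb := ⟨h1.1.trans_le q1, q2.trans h2.2⟩
    have hS := m.mtrick h0 h1 hI q1 (fun t ht => bα t ⟨ht.1, ht.2.trans q2.le⟩) (fun t ht => bβ t ⟨ht.1, ht.2.trans q2.le⟩) b0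
    have hpp : ∀ t ∈ Icc t' t2, 0 < v y' t := fun t ht => hp t (by rw [abs_le]; constructor <;> linarith [ht.1, ht.2])
    have := m.strong (α := y') (β := β) (fun h => h0 ⟨hy1.1.trans_lt (hy'.1.trans h.1), h.2⟩) hI h2 q2 ?_
      (fun t ht => (hpp t ht).le) (fun t ht => bβ t ⟨q1.trans ht.1, ht.2⟩) y2 ⟨hy'.2, hy2.2⟩
    · linarith
    · intro y hy
      exact hS y' y (hy1.1.trans hy'.1.le) hy.1 hy.2 (hpp t' ⟨le_rfl, q2.le⟩)
end PMod

structure Good (v vy vyy vt : ℝ → ℝ → ℝ) (ta tb M B R τ : ℝ) : Prop where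
  m : PMod v vy vyy vt ta tb M B R
  hτ : ta ≤ τ
  odd : ∀ t ∈ Ioo ta tb, ∀ y, v (-y) t = -v y t
  fin : ∀ t ∈ Ioo τ tb, {y | v y t = 0}.Finite
  ns : ∀ j ∈ Ioo τ tb, ∀ Q, v Q j = 0 → vy Q j = 0 → ∀ ρ > 0, ∀ τ' < j,
    (∀ t ∈ Ioo τ' j, ∃ γ s : ℝ, (s = 1 ∨ s = -1) ∧ ∀ y ∈ Icc (Q - ρ) (Q + ρ), 0 ≤ s * (v y t * (y - γ))) → False

def bx (v : ℝ → ℝ → ℝ) (Q ρ t : ℝ) : Set ℝ := {y | 0 ≤ y ∧ |y - Q| ≤ ρ ∧ v y t = 0}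

def PZ (v vy : ℝ → ℝ → ℝ) (j Q ρ0 : ℝ) : Prop := ∃ ρ ∈ Ioc 0 ρ0, ∃ nm np : ℕ, np ≤ 1 ∧ 1 ≤ nm ∧ (vy Q j = 0 → np < nm) ∧
  ∃ η > 0, (∀ t ∈ Ioo (j - η) j, nm ≤ (bx v Q ρ t).ncard) ∧ (∀ t ∈ Ioo j (j + η), (bx v Q ρ t).ncard ≤ np)

namespace Good
variable {v vy vyy vt : ℝ → ℝ → ℝ} {ta tb M B R τ : ℝ}

lemma neg (g : Good v vy vyy vt ta tb M B R τ) : Good (fun y t => -v y t) (fun y t => -vy y t)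
    (fun y t => -vyy y t) (fun y t => -vt y t) ta tb M B R τ where
  m := g.m.neg
  hτ := g.hτ
  odd t ht y := by rw [g.odd t ht y]
  fin t ht := by simpa using g.fin t ht
  ns j ht Q h1 h2 ρ hρ τ' hτ' h := by
    refine g.ns j ht Q (by linarith) (by linarith) ρ hρ τ' hτ' fun t ht => ?_
    obtain ⟨γ, s, hs, h3⟩ := h t ht
    refine ⟨γ, -s, ?_, fun y hy => ?_⟩
    · rcases hs with rfl | rfl
      · right; rfl
      · left; norm_num
    · have := h3 y hy
      linarith

lemma memI (g : Good v vy vyy vt ta tb M B R τ) {t : ℝ} (ht : t ∈ Ioo τ tb) : t ∈ Ioo ta tb := ⟨g.hτ.trans_lt ht.1, ht.2⟩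

lemma bxfin (g : Good v vy vyy vt ta tb M B R τ) {t : ℝ} (ht : t ∈ Ioo τ tb) (Q ρ : ℝ) : (bx v Q ρ t).Finite :=
  (g.fin t ht).subset fun _ hy => hy.2.2

lemma bx_neg (Q ρ t : ℝ) : bx (fun y t => -v y t) Q ρ t = bx v Q ρ t := by
  simp [bx]

lemma pz_neg {j Q ρ0 : ℝ} (h : PZ (fun y t => -v y t) (fun y t => -vy y t) j Q ρ0) : PZ v vy j Q ρ0 := by
  unfold PZ at h ⊢
  simpa only [bx_neg, neg_eq_zero] using h

lemma iso (g : Good v vy vyy vt ta tb M B R τ) {t : ℝ} (ht : t ∈ Ioo τ tb) (Q : ℝ) {ρ0 : ℝ} (hρ0 : 0 < ρ0) :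
    ∃ ρ ∈ Ioc 0 ρ0, ∀ y, |y - Q| ≤ ρ → v y t = 0 → y = Q := by
  have h1 : IsClosed ({y | v y t = 0} \ {Q}) := ((g.fin t ht).subset sdiff_subset).isClosed
  have h2 : ({y | v y t = 0} \ {Q})ᶜ ∈ 𝓝 Q := h1.isOpen_compl.mem_nhds (by simp)
  obtain ⟨ε, hε, h3⟩ := Metric.mem_nhds_iff.1 h2
  refine ⟨min (ε / 2) ρ0, ⟨by positivity, min_le_right _ _⟩, fun y hy hv => ?_⟩
  by_contra hne
  have : y ∈ Metric.ball Q ε := by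
    rw [Metric.mem_ball, Real.dist_eq]
    have := min_le_left (ε / 2) ρ0
    linarith
  exact h3 this ⟨hv, hne⟩

lemma small (_ : Good v vy vyy vt ta tb M B R τ) {j : ℝ} (ht : j ∈ Ioo τ tb) {η : ℝ} (hη : 0 < η) :
    ∃ η' ∈ Ioc 0 η, ∀ t, |t - j| ≤ η' → t ∈ Ioo τ tb := by
  refine ⟨min η (min (j - τ) (tb - j) / 2), ⟨?_, min_le_left _ _⟩, fun t h => ?_⟩
  · have := sub_pos.2 ht.1; have := sub_pos.2 ht.2; positivity
  · have h1 := min_le_right η (min (j - τ) (tb - j) / 2)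
    have h2 := min_le_left (j - τ) (tb - j)
    have h3 := min_le_right (j - τ) (tb - j)
    have h4 := sub_pos.2 ht.1; have h5 := sub_pos.2 ht.2
    rw [abs_le] at h
    constructor <;> linarith [h.1, h.2]

/-- same sign at both ends -/
lemma even (g : Good v vy vyy vt ta tb M B R τ) {j : ℝ} (ht : j ∈ Ioo τ tb) {Q ρ ρ0 : ℝ} (hv : v Q j = 0)
    (hρ : ρ ∈ Ioc 0 ρ0) (hiso : ∀ y, |y - Q| ≤ ρ → v y j = 0 → y = Q) (hb : 0 < Q - ρ)
    (s1 : 0 < v (Q - ρ) j) (s2 : 0 < v (Q + ρ) j) : PZ v vy j Q ρ0 := by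
  have m := g.m
  obtain ⟨η1, hη1, p1⟩ := m.persist (g.memI ht) _ s1
  obtain ⟨η2, hη2, p2⟩ := m.persist (g.memI ht) _ s2
  obtain ⟨η, hη, p3⟩ := g.small ht (lt_min hη1 hη2)
  have hle1 := hη.2.trans (min_le_left _ _)
  have hle2 := hη.2.trans (min_le_right _ _)
  have hρ0 := hρ.1
  have h0 : (0 : ℝ) ∉ Ioo (Q - ρ) (Q + ρ) := fun h => by linarith [h.1]
  have hin : ∀ y ∈ Icc (Q - ρ) (Q + ρ), |y - Q| ≤ ρ := fun y hy => by
    rw [abs_le]; constructor <;> linarith [hy.1, hy.2]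
  refine ⟨ρ, hρ, 1, 0, by norm_num, le_rfl, fun _ => by norm_num, η, hη.1, fun t h => ?_, fun t h => ?_⟩
  · have htt : t ∈ Ioo τ tb := p3 t (by rw [abs_le]; constructor <;> linarith [h.1, h.2, hη.1])
    rw [Nat.one_le_iff_ne_zero, Ne, Set.ncard_eq_zero (g.bxfin htt _ _)]
    intro hemp
    have hpos : ∀ y ∈ Icc (Q - ρ) (Q + ρ), 0 ≤ v y t := by
      intro y hy
      by_contra hc
      push Not at hc
      have : 0 < v (Q - ρ) t := p1 t (by rw [abs_le]; constructor <;> linarith [h.1, h.2, hη.1])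
      obtain ⟨z, hz, hz2⟩ := ivt_zero (m.cv (g.memI htt)) hy.1 (mul_neg_of_pos_of_neg this hc)
      have : z ∈ bx v Q ρ t := ⟨by linarith [hz.1], hin z ⟨hz.1.le, hz.2.le.trans hy.2⟩, hz2⟩
      rw [hemp] at this; exact this
    have := m.strong h0 (g.memI htt) (g.memI ht) h.2 hpos
      (fun r hr => (p1 r (by rw [abs_le]; constructor <;> linarith [h.1, h.2, hr.1, hr.2, hη.1])).le)
      (fun r hr => (p2 r (by rw [abs_le]; constructor <;> linarith [h.1, h.2, hr.1, hr.2, hη.1]))) Q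
      ⟨by linarith, by linarith⟩
    linarith
  · have htt : t ∈ Ioo τ tb := p3 t (by rw [abs_le]; constructor <;> linarith [h.1, h.2, hη.1])
    rw [Nat.le_zero, Set.ncard_eq_zero (g.bxfin htt _ _)]
    have hpos : ∀ y ∈ Icc (Q - ρ) (Q + ρ), 0 ≤ v y j := by
      intro y hy
      by_contra hc
      push Not at hc
      obtain ⟨z, hz, hz2⟩ := ivt_zero (m.cv (g.memI ht)) hy.1 (mul_neg_of_pos_of_neg s1 hc)
      obtain ⟨z', hz', hz2'⟩ := ivt_zero (m.cv (g.memI ht)) hy.2 (mul_neg_of_neg_of_pos hc s2)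
      have e1 := hiso z (hin z ⟨hz.1.le, hz.2.le.trans hy.2⟩) hz2
      have e2 := hiso z' (hin z' ⟨hy.1.trans hz'.1.le, hz'.2.le⟩) hz2'
      linarith [hz.2, hz'.1]
    have hp1 : ∀ r ∈ Icc j t, 0 < v (Q - ρ) r :=
      (fun r hr => (p1 r (by rw [abs_le]; constructor <;> linarith [h.1, h.2, hr.1, hr.2, hη.1])))
    have := m.strong h0 (g.memI ht) (g.memI htt) h.1 hpos (fun r hr => (hp1 r hr).le)
      (fun r hr => (p2 r (by rw [abs_le]; constructor <;> linarith [h.1, h.2, hr.1, hr.2, hη.1])))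
    ext y
    simp only [mem_empty_iff_false, iff_false]
    rintro ⟨-, q2, q3⟩
    rw [abs_le] at q2
    rcases (show Q - ρ ≤ y by linarith).eq_or_lt with e | e
    · rw [← e] at q3; linarith [hp1 t ⟨h.1.le, le_rfl⟩]
    · linarith [this y ⟨e, by linarith⟩]

lemma oddc (g : Good v vy vyy vt ta tb M B R τ) {j : ℝ} (ht : j ∈ Ioo τ tb) {Q ρ ρ0 : ℝ} (hv : v Q j = 0)
    (hρ : ρ ∈ Ioc 0 ρ0) (hiso : ∀ y, |y - Q| ≤ ρ → v y j = 0 → y = Q) (hb : 0 < Q - ρ)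
    (s1 : v (Q - ρ) j < 0) (s2 : 0 < v (Q + ρ) j) : PZ v vy j Q ρ0 := by
  have m := g.m
  obtain ⟨η1, hη1, p1⟩ := m.neg.persist (g.memI ht) (Q - ρ) (by linarith)
  obtain ⟨η2, hη2, p2⟩ := m.persist (g.memI ht) _ s2
  obtain ⟨η, hη, p3⟩ := g.small ht (lt_min hη1 hη2)
  have hle1 := hη.2.trans (min_le_left _ _)
  have hle2 := hη.2.trans (min_le_right _ _)
  have hρ0 := hρ.1
  have h0 : (0 : ℝ) ∉ Ioo (Q - ρ) (Q + ρ) := fun h => by linarith [h.1]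
  have hin : ∀ y ∈ Icc (Q - ρ) (Q + ρ), |y - Q| ≤ ρ := fun y hy => by
    rw [abs_le]; constructor <;> linarith [hy.1, hy.2]
  have habs : ∀ {t}, t ∈ Ioo (j - η) (j + η) → |t - j| ≤ η := fun h => by
    rw [abs_le]; constructor <;> linarith [h.1, h.2]
  have P1 : ∀ t ∈ Ioo (j - η) (j + η), v (Q - ρ) t < 0 := fun t h => by
    linarith [p1 t ((habs h).trans hle1)]
  have P2 : ∀ t ∈ Ioo (j - η) (j + η), 0 < v (Q + ρ) t := fun t h => p2 t ((habs h).trans hle2)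
  have P3 : ∀ t ∈ Ioo (j - η) (j + η), t ∈ Ioo τ tb := fun t h => p3 t (habs h)
  have hη0 := hη.1
  have ex : ∀ t ∈ Ioo (j - η) (j + η), ∃ z ∈ Ioo (Q - ρ) (Q + ρ), v z t = 0 := fun t h =>
    ivt_zero (m.cv (g.memI (P3 t h))) (by linarith) (mul_neg_of_neg_of_pos (P1 t h) (P2 t h))
  have one : ∀ t ∈ Ioo (j - η) (j + η), (bx v Q ρ t).ncard ≤ 1 →
      (∀ p q, Q - ρ ≤ p → p ≤ q → q ≤ Q + ρ → 0 < v p t → 0 ≤ v q t) := by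
    intro t h hle p q hp hpq hq hvp
    by_contra hc
    push Not at hc
    obtain ⟨z, hz, hz2⟩ := ivt_zero (m.cv (g.memI (P3 t h))) hp (mul_neg_of_neg_of_pos (P1 t h) hvp)
    obtain ⟨z', hz', hz2'⟩ := ivt_zero (m.cv (g.memI (P3 t h))) hpq (mul_neg_of_pos_of_neg hvp hc)
    have := (Set.ncard_le_one_iff (g.bxfin (P3 t h) _ _)).1 hle
      (show z ∈ bx v Q ρ t from ⟨by linarith [hz.1], hin z ⟨hz.1.le, by linarith [hz.2]⟩, hz2⟩)
      (show z' ∈ bx v Q ρ t from ⟨by linarith [hz'.1], hin z' ⟨by linarith [hz'.1], by linarith [hz'.2]⟩, hz2'⟩)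
    linarith [hz.2, hz'.1]
  have hsub : ∀ {r1 r2}, r1 ∈ Ioo (j - η) (j + η) → r2 ∈ Ioo (j - η) (j + η) → ∀ r ∈ Icc r1 r2, r ∈ Ioo (j - η) (j + η) :=
    fun h1 h2 r hr => ⟨h1.1.trans_le hr.1, hr.2.trans_lt h2.2⟩
  have uq : ∀ r1 ∈ Ioo (j - η) (j + η), ∀ r2 ∈ Ioo (j - η) (j + η), r1 < r2 → (bx v Q ρ r1).ncard ≤ 1 →
      ∀ y1 ∈ Icc (Q - ρ) (Q + ρ), ∀ y2 ∈ Icc (Q - ρ) (Q + ρ), v y1 r2 = 0 → v y2 r2 = 0 → y1 = y2 := by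
    intro r1 h1 r2 h2 h12 hle y1 hy1 y2 hy2 e1 e2
    have key := fun {z1 z2 : ℝ} => m.uniq (y1 := z1) (y2 := z2) h0 (g.memI (P3 r1 h1)) (g.memI (P3 r2 h2)) h12 (g.fin _ (P3 r2 h2))
      (fun r hr => P1 r (hsub h1 h2 r hr)) (fun r hr => P2 r (hsub h1 h2 r hr)) (one r1 h1 hle)
    exact le_antisymm (not_lt.1 (key hy2 hy1 e2 e1)) (not_lt.1 (key hy1 hy2 e1 e2))
  have h00 : j ∈ Ioo (j - η) (j + η) := ⟨by linarith, by linarith⟩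
  have hone0 : (bx v Q ρ j).ncard ≤ 1 := by
    rw [Set.ncard_le_one_iff (g.bxfin ht _ _)]
    intro a b ha hb
    rw [hiso a ha.2.1 ha.2.2, hiso b hb.2.1 hb.2.2]
  have hright : ∀ t ∈ Ioo j (j + η), (bx v Q ρ t).ncard ≤ 1 := by
    intro t h
    have h' : t ∈ Ioo (j - η) (j + η) := ⟨by linarith [h.1], h.2⟩
    rw [Set.ncard_le_one_iff (g.bxfin (P3 t h') _ _)]
    intro a b ha hb
    have a1 := abs_le.1 ha.2.1
    have b1 := abs_le.1 hb.2.1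
    exact uq j h00 t h' h.1 hone0 a ⟨by linarith, by linarith⟩ b ⟨by linarith, by linarith⟩ ha.2.2 hb.2.2
  by_cases hmul : vy Q j = 0
  · refine ⟨ρ, hρ, 2, 1, le_rfl, by norm_num, fun _ => by norm_num, η, hη0, fun t h => ?_, hright⟩
    by_contra hc
    have hle : (bx v Q ρ t).ncard ≤ 1 := by lia
    have h' : t ∈ Ioo (j - η) (j + η) := ⟨h.1, by linarith [h.2]⟩
    refine g.ns j ht Q hv hmul ρ hρ0 t h.2 fun r hr => ?_
    have hr' : r ∈ Ioo (j - η) (j + η) := ⟨h.1.trans hr.1, by linarith [hr.2]⟩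
    obtain ⟨γ, hγ, hγ2⟩ := ex r hr'
    have uu := uq t h' r hr' hr.1 hle γ (Ioo_subset_Icc_self hγ)
    refine ⟨γ, 1, Or.inl rfl, fun y hy => ?_⟩
    rw [one_mul]
    have hcv := m.cv (g.memI (P3 r hr'))
    rcases lt_trichotomy y γ with hl | hl | hl
    · refine mul_nonneg_of_nonpos_of_nonpos ?_ (by linarith)
      by_contra hcc
      push Not at hcc
      obtain ⟨z, hz, hz2⟩ := ivt_zero hcv hy.1 (mul_neg_of_neg_of_pos (P1 r hr') hcc)
      have := uu z ⟨hz.1.le, hz.2.le.trans hy.2⟩ hγ2 hz2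
      linarith [hz.2]
    · rw [hl]; simp
    · refine mul_nonneg ?_ (by linarith)
      by_contra hcc
      push Not at hcc
      obtain ⟨z, hz, hz2⟩ := ivt_zero hcv hy.2 (mul_neg_of_neg_of_pos hcc (P2 r hr'))
      have := uu z ⟨hy.1.trans hz.1.le, hz.2.le⟩ hγ2 hz2
      linarith [hz.1]
  · refine ⟨ρ, hρ, 1, 1, le_rfl, le_rfl, fun h => absurd h hmul, η, hη0, fun t h => ?_, hright⟩
    have h' : t ∈ Ioo (j - η) (j + η) := ⟨h.1, by linarith [h.2]⟩
    obtain ⟨z, hz, hz2⟩ := ex t h'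
    rw [Nat.one_le_iff_ne_zero, Ne, Set.ncard_eq_zero (g.bxfin (P3 t h') _ _)]
    exact Set.nonempty_iff_ne_empty.1 ⟨z, by linarith [hz.1], hin z (Ioo_subset_Icc_self hz), hz2⟩

lemma zeroc (g : Good v vy vyy vt ta tb M B R τ) {j : ℝ} (ht : j ∈ Ioo τ tb) {ρ ρ0 : ℝ}
    (hρ : ρ ∈ Ioc 0 ρ0) (hiso : ∀ y, |y - 0| ≤ ρ → v y j = 0 → y = 0)
    (s2 : 0 < v ρ j) : PZ v vy j 0 ρ0 := by
  have m := g.m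
  obtain ⟨η2, hη2, p2⟩ := m.persist (g.memI ht) _ s2
  obtain ⟨η, hη, p3⟩ := g.small ht hη2
  have hρ0 := hρ.1
  have h0 : (0 : ℝ) ∉ Ioo 0 ρ := fun h => lt_irrefl _ h.1
  have hin : ∀ y ∈ Icc 0 ρ, |y - 0| ≤ ρ := fun y hy => by
    rw [sub_zero, abs_of_nonneg hy.1]; exact hy.2
  have habs : ∀ {t}, t ∈ Ioo (j - η) (j + η) → |t - j| ≤ η := fun h => by
    rw [abs_le]; constructor <;> linarith [h.1, h.2]
  have P2 : ∀ t ∈ Ioo (j - η) (j + η), 0 < v ρ t := fun t h => p2 t ((habs h).trans hη.2)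
  have P3 : ∀ t ∈ Ioo (j - η) (j + η), t ∈ Ioo τ tb := fun t h => p3 t (habs h)
  have hη0 := hη.1
  have h00 : j ∈ Ioo (j - η) (j + η) := ⟨by linarith, by linarith⟩
  have hz : ∀ t ∈ Ioo (j - η) (j + η), (0 : ℝ) ∈ bx v 0 ρ t := fun t h =>
    ⟨le_rfl, hin 0 ⟨le_rfl, hρ0.le⟩, m.zero t (g.memI (P3 t h))⟩
  have hsub : ∀ {r1 r2}, r1 ∈ Ioo (j - η) (j + η) → r2 ∈ Ioo (j - η) (j + η) → ∀ r ∈ Icc r1 r2, r ∈ Ioo (j - η) (j + η) :=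
    fun h1 h2 r hr => ⟨h1.1.trans_le hr.1, hr.2.trans_lt h2.2⟩
  have st : ∀ t ∈ Ioo (j - η) (j + η), (∀ y, 0 ≤ y → |y - 0| ≤ ρ → v y t = 0 → y = 0) → ∀ y ∈ Icc 0 ρ, 0 ≤ v y t := by
    intro t h hu y hy
    by_contra hc
    push Not at hc
    obtain ⟨z', hz', hz2'⟩ := ivt_zero (m.cv (g.memI (P3 t h))) hy.2 (mul_neg_of_neg_of_pos hc (P2 t h))
    have := hu z' (hy.1.trans hz'.1.le) (hin z' ⟨hy.1.trans hz'.1.le, hz'.2.le⟩) hz2'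
    linarith [hz'.1, hy.1]
  have hright : ∀ t ∈ Ioo j (j + η), (bx v 0 ρ t).ncard ≤ 1 := by
    intro t h
    have h' : t ∈ Ioo (j - η) (j + η) := ⟨by linarith [h.1], h.2⟩
    have key := m.strong h0 (g.memI ht) (g.memI (P3 t h')) h.1 (st j h00 fun y _ => hiso y)
      (fun r hr => (m.zero r (g.memI (P3 r (hsub h00 h' r hr)))).ge) (fun r hr => P2 r (hsub h00 h' r hr))
    have hu : ∀ a ∈ bx v 0 ρ t, a = 0 := by
      intro a ha
      by_contra hne
      have h1 := abs_le.1 ha.2.1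
      linarith [key a ⟨lt_of_le_of_ne ha.1 (Ne.symm hne), by linarith⟩, ha.2.2]
    rw [Set.ncard_le_one_iff (g.bxfin (P3 t h') _ _)]
    intro a b ha hb
    rw [hu a ha, hu b hb]
  by_cases hmul : vy 0 j = 0
  · refine ⟨ρ, hρ, 2, 1, le_rfl, by norm_num, fun _ => by norm_num, η, hη0, fun t h => ?_, hright⟩
    by_contra hc
    have hle : (bx v 0 ρ t).ncard ≤ 1 := by lia
    have h' : t ∈ Ioo (j - η) (j + η) := ⟨h.1, by linarith [h.2]⟩
    refine g.ns j ht 0 (m.zero j (g.memI ht)) hmul ρ hρ0 t h.2 fun r hr => ?_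
    have hr' : r ∈ Ioo (j - η) (j + η) := ⟨h.1.trans hr.1, by linarith [hr.2]⟩
    have hw := m.weak h0 (g.memI (P3 t h')) (g.memI (P3 r hr')) (st t h' fun y Q y1 y2 =>
      (Set.ncard_le_one_iff (g.bxfin (P3 t h') _ _)).1 hle (show y ∈ bx v 0 ρ t from ⟨Q, y1, y2⟩) (hz t h'))
      (fun r1 hr1 => (m.zero r1 (g.memI (P3 r1 (hsub h' hr' r1 hr1)))).ge) (fun r1 hr1 => (P2 r1 (hsub h' hr' r1 hr1)).le)
    refine ⟨0, 1, Or.inl rfl, fun y hy => ?_⟩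
    rw [one_mul, sub_zero]
    rcases le_total 0 y with h3 | h3
    · exact mul_nonneg (hw y ⟨h3, by linarith [hy.2]⟩ r ⟨hr.1.le, le_rfl⟩) h3
    · have h4 := hw (-y) ⟨by linarith, by linarith [hy.1]⟩ r ⟨hr.1.le, le_rfl⟩
      rw [g.odd r (g.memI (P3 r hr'))] at h4
      exact mul_nonneg_of_nonpos_of_nonpos (by linarith) h3
  · refine ⟨ρ, hρ, 1, 1, le_rfl, le_rfl, fun h => absurd h hmul, η, hη0, fun t h => ?_, hright⟩
    have h' : t ∈ Ioo (j - η) (j + η) := ⟨h.1, by linarith [h.2]⟩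
    rw [Nat.one_le_iff_ne_zero, Ne, Set.ncard_eq_zero (g.bxfin (P3 t h') _ _)]
    exact Set.nonempty_iff_ne_empty.1 ⟨0, hz t h'⟩

lemma pz (g : Good v vy vyy vt ta tb M B R τ) {j : ℝ} (ht : j ∈ Ioo τ tb) {Q ρ0 : ℝ} (hy0 : 0 ≤ Q) (hv : v Q j = 0)
    (hρ0 : 0 < ρ0) : PZ v vy j Q ρ0 := by
  rcases hy0.eq_or_lt with h | h
  · subst h
    obtain ⟨ρ, hρ, hi⟩ := g.iso ht 0 hρ0
    have hp := hρ.1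
    have hne : v ρ j ≠ 0 := fun h => hp.ne' (hi ρ (by rw [sub_zero, abs_of_pos hp]) h)
    rcases lt_or_gt_of_ne hne with h1 | h1
    · exact pz_neg (g.neg.zeroc ht hρ (fun y a b => hi y a (by linarith)) (by linarith))
    · exact g.zeroc ht hρ hi h1
  · obtain ⟨ρ, hρ, hi⟩ := g.iso ht Q (lt_min hρ0 (half_pos h))
    have hp := hρ.1
    have hb : 0 < Q - ρ := by have := hρ.2.trans (min_le_right _ _); linarith
    have hρ' : ρ ∈ Ioc 0 ρ0 := ⟨hp, hρ.2.trans (min_le_left _ _)⟩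
    have n1 : v (Q - ρ) j ≠ 0 := fun h => by
      have := hi (Q - ρ) (by rw [sub_sub_cancel_left, abs_neg, abs_of_pos hp]) h; linarith
    have n2 : v (Q + ρ) j ≠ 0 := fun h => by
      have := hi (Q + ρ) (by rw [add_sub_cancel_left, abs_of_pos hp]) h; linarith
    have hi' : ∀ y, |y - Q| ≤ ρ → -v y j = 0 → y = Q := fun y a b => hi y a (by linarith)
    rcases lt_or_gt_of_ne n1 with h1 | h1 <;> rcases lt_or_gt_of_ne n2 with h2 | h2
    · exact pz_neg (g.neg.even ht (by linarith) hρ' hi' hb (by linarith) (by linarith))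
    · exact g.oddc ht hv hρ' hi hb h1 h2
    · exact pz_neg (g.neg.oddc ht (by linarith) hρ' hi' hb (by linarith) (by linarith))
    · exact g.even ht hv hρ' hi hb h1 h2
end Good

lemma anti_of_local {f : ℝ → ℕ} {a b : ℝ} (h : ∀ j ∈ Ioo a b, ∃ η > 0, (∀ t ∈ Ioo (j - η) j, f j ≤ f t) ∧
    (∀ t ∈ Ioo j (j + η), f t ≤ f j)) {p q : ℝ} (hp : p ∈ Ioo a b) (hq : q ∈ Ioo a b) (hpq : p ≤ q) : f q ≤ f p := by
  set S : Set ℝ := {t | t ∈ Icc p q ∧ ∀ r ∈ Icc p t, f r ≤ f p} with hS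
  have hpS : p ∈ S := ⟨⟨le_rfl, hpq⟩, fun r hr => by rw [le_antisymm hr.2 hr.1]⟩
  have hbd : BddAbove S := ⟨q, fun t ht => ht.1.2⟩
  set c := sSup S with hc
  have hpc : p ≤ c := le_csSup hbd hpS
  have hcq : c ≤ q := csSup_le ⟨p, hpS⟩ fun t ht => ht.1.2
  obtain ⟨η, hη, h1, h2⟩ := h c ⟨hp.1.trans_le hpc, hcq.trans_lt hq.2⟩
  have hlt : ∀ r, p ≤ r → r < c → f r ≤ f p := by
    intro r hr hrc
    obtain ⟨t, ht, hrt⟩ := exists_lt_of_lt_csSup ⟨p, hpS⟩ hrc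
    exact ht.2 r ⟨hr, hrt.le⟩
  have hcc : f c ≤ f p := by
    rcases hpc.eq_or_lt with e | e
    · rw [← e]
    · have hm : max p (c - η) < c := max_lt e (by linarith)
      have h3 := le_max_left p (c - η)
      have h4 := le_max_right p (c - η)
      exact (h1 ((max p (c - η) + c) / 2) ⟨by linarith, by linarith⟩).trans (hlt _ (by linarith) (by linarith))
  rcases hcq.eq_or_lt with e | e
  · rw [← e]; exact hcc
  · exfalso
    have hm : c < min q (c + η) := lt_min e (by linarith)
    have h3 := min_le_left q (c + η)
    have h4 := min_le_right q (c + η)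
    have : (c + min q (c + η)) / 2 ∈ S := by
      refine ⟨⟨by linarith, by linarith⟩, fun r hr => ?_⟩
      rcases lt_trichotomy r c with k | k | k
      · exact hlt r hr.1 k
      · rw [k]; exact hcc
      · exact (h2 r ⟨k, by linarith [hr.2]⟩).trans hcc
    have := le_csSup hbd this
    linarith

def zs (v : ℝ → ℝ → ℝ) (t : ℝ) : Set ℝ := {y | 0 ≤ y ∧ v y t = 0}

namespace Good
variable {v vy vyy vt : ℝ → ℝ → ℝ} {ta tb M B R τ : ℝ}

lemma zsfin (g : Good v vy vyy vt ta tb M B R τ) {t : ℝ} (ht : t ∈ Ioo τ tb) : (zs v t).Finite :=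
  (g.fin t ht).subset fun _ hy => hy.2

lemma near (g : Good v vy vyy vt ta tb M B R τ) {j : ℝ} (ht : j ∈ Ioo τ tb) {δ : ℝ} (hδ : 0 < δ) :
    ∃ η > 0, ∀ t, |t - j| ≤ η → t ∈ Ioo τ tb → ∀ y ∈ zs v t, ∃ z ∈ zs v j, |y - z| < δ := by
  have m := g.m
  have hB := m.hB
  set C : Set ℝ := Icc 0 R ∩ ⋂ z ∈ zs v j, {y | δ ≤ |y - z|} with hC
  have hCc : IsCompact C := isCompact_Icc.inter_right
    (isClosed_biInter fun z _ => isClosed_le continuous_const (by fun_prop))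
  obtain ⟨κ, hκ, hb⟩ : ∃ κ > 0, ∀ y ∈ C, κ ≤ |v y j| := by
    rcases C.eq_empty_or_nonempty with e | e
    · exact ⟨1, one_pos, fun y hy => by rw [e] at hy; exact hy.elim⟩
    · obtain ⟨y, hy, hm⟩ := hCc.exists_isMinOn e ((m.cv (g.memI ht)).abs.continuousOn)
      refine ⟨|v y j|, abs_pos.2 fun h => ?_, fun z hz => hm hz⟩
      have := mem_iInter₂.1 hy.2 y ⟨hy.1.1, h⟩
      simp only [mem_ofPred_eq, sub_self, abs_zero] at this
      linarith
  refine ⟨κ / (2 * B + 1), by positivity, fun t h htt y hy => ?_⟩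
  by_contra hc
  push Not at hc
  have hyC : y ∈ C := by
    refine ⟨⟨hy.1, ?_⟩, mem_iInter₂.2 hc⟩
    by_contra hR
    have := m.far t (g.memI htt) y (by rw [abs_of_nonneg hy.1]; linarith)
    rw [hy.2] at this; simp at this
  have h1 := hb y hyC
  have h2 := m.lip (y := y) (y' := y) (g.memI ht) (g.memI htt)
  simp only [sub_self, abs_zero, mul_zero, zero_add, hy.2, sub_zero, zero_sub, abs_neg] at h2
  rw [le_div_iff₀ (by positivity)] at h
  rw [abs_sub_comm] at h2
  have : (0 : ℝ) ≤ |t - j| := abs_nonneg _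
  nlinarith

lemma loc (g : Good v vy vyy vt ta tb M B R τ) {j : ℝ} (ht : j ∈ Ioo τ tb) :
    ∃ η > 0, (∀ t ∈ Ioo (j - η) j, (zs v j).ncard ≤ (zs v t).ncard) ∧
    (∀ t ∈ Ioo j (j + η), (zs v t).ncard ≤ (zs v j).ncard) ∧
    ((∃ y ∈ zs v j, vy y j = 0) → ∀ t ∈ Ioo (j - η) j, ∀ t' ∈ Ioo j (j + η), (zs v t').ncard < (zs v t).ncard) := by
  classical
  set F := (g.zsfin ht).toFinset with hF
  have hmem : ∀ {y}, y ∈ F ↔ y ∈ zs v j := by simp [hF]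
  obtain ⟨ρ0, hρ0, hsep⟩ : ∃ ρ0 > 0, ∀ y ∈ F, ∀ z ∈ F, |y - z| ≤ 2 * ρ0 → y = z := by
    have : ∀ y ∈ F, ∀ z ∈ F, ∃ r > 0, |y - z| ≤ 2 * r → y = z := by
      intro y _ z _
      by_cases h : y = z
      · exact ⟨1, one_pos, fun _ => h⟩
      · have : 0 < |y - z| := abs_pos.2 (sub_ne_zero.2 h)
        exact ⟨|y - z| / 4, by positivity, fun h => by linarith⟩
    have hex : ∀ᶠ r in 𝓝[>] (0 : ℝ), ∀ y ∈ F, ∀ z ∈ F, |y - z| ≤ 2 * r → y = z := by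
      rw [Filter.eventually_all_finset]
      intro y hy
      rw [Filter.eventually_all_finset]
      intro z hz
      obtain ⟨r, hr, h⟩ := this y hy z hz
      filter_upwards [Ioo_mem_nhdsGT hr] with r' hr' h'
      exact h (by linarith [hr'.2])
    obtain ⟨r, h1, h2⟩ := (hex.and self_mem_nhdsWithin).exists
    exact ⟨r, h2, h1⟩
  have hP : ∀ y : ℝ, y ∈ F → PZ v vy j y ρ0 := fun y hy => g.pz ht (hmem.1 hy).1 (hmem.1 hy).2 hρ0
  choose! ρ hρ nm np h1 h2 h3 η hη h4 h5 using hP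
  obtain ⟨e, he, heη, heρ⟩ : ∃ e > 0, (∀ y ∈ F, e < η y) ∧ ∀ y ∈ F, e < ρ y := by
    have h1 : ∀ᶠ r in 𝓝[>] (0 : ℝ), ∀ y ∈ F, r < η y := by
      rw [Filter.eventually_all_finset]
      intro y hy
      filter_upwards [Ioo_mem_nhdsGT (hη y hy)] with r hr using hr.2
    have h2 : ∀ᶠ r in 𝓝[>] (0 : ℝ), ∀ y ∈ F, r < ρ y := by
      rw [Filter.eventually_all_finset]
      intro y hy
      filter_upwards [Ioo_mem_nhdsGT (hρ y hy).1] with r hr using hr.2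
    obtain ⟨r, h1, h2, h3⟩ := (h1.and (h2.and self_mem_nhdsWithin)).exists
    exact ⟨r, h3, h1, h2⟩
  obtain ⟨η1, hη1, hn⟩ := g.near ht he
  obtain ⟨η2, hη2, hs⟩ := g.small ht (lt_min hη1 he)
  have hη20 := hη2.1
  have q1 := hη2.2.trans (min_le_left _ _)
  have q2 := hη2.2.trans (min_le_right _ _)
  have hcard : (zs v j).ncard = ∑ y ∈ F, 1 := by
    rw [Set.ncard_eq_toFinset_card _ (g.zsfin ht), Finset.card_eq_sum_ones]
  have hL : ∀ t ∈ Ioo (j - η2) j, ∑ y ∈ F, nm y ≤ (zs v t).ncard := by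
    intro t h
    have htt := hs t (by rw [abs_le]; constructor <;> linarith [h.1, h.2])
    have hU : (F.biUnion fun y => (g.bxfin htt y (ρ y)).toFinset).card ≤ (zs v t).ncard := by
      rw [Set.ncard_eq_toFinset_card _ (g.zsfin htt)]
      apply Finset.card_le_card
      intro z hz
      simp only [Finset.mem_biUnion, Set.Finite.mem_toFinset] at hz ⊢
      obtain ⟨y, _, hz⟩ := hz
      exact ⟨hz.1, hz.2.2⟩
    rw [Finset.card_biUnion] at hU
    · refine le_trans (Finset.sum_le_sum fun y hy => ?_) hU
      rw [← Set.ncard_eq_toFinset_card _ (g.bxfin htt y (ρ y))]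
      exact h4 y hy t ⟨by linarith [h.1, heη y hy], h.2⟩
    · intro y hy z hz hne
      change Disjoint _ _
      rw [Finset.disjoint_left]
      intro x hx hx'
      simp only [Set.Finite.mem_toFinset] at hx hx'
      apply hne
      apply hsep y hy z hz
      have a1 := hx.2.1; have a2 := hx'.2.1
      have b1 := (hρ y hy).2; have b2 := (hρ z hz).2
      rw [abs_le] at *
      constructor <;> linarith
  have hR : ∀ t ∈ Ioo j (j + η2), (zs v t).ncard ≤ ∑ y ∈ F, np y := by
    intro t h
    have habs : |t - j| ≤ η2 := by rw [abs_le]; constructor <;> linarith [h.1, h.2]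
    have htt := hs t habs
    have hU : (zs v t).ncard ≤ (F.biUnion fun y => (g.bxfin htt y (ρ y)).toFinset).card := by
      rw [Set.ncard_eq_toFinset_card _ (g.zsfin htt)]
      apply Finset.card_le_card
      intro z hz
      simp only [Finset.mem_biUnion, Set.Finite.mem_toFinset] at hz ⊢
      obtain ⟨y, hy, hyz⟩ := hn t (habs.trans q1) htt z hz
      exact ⟨y, hmem.2 hy, hz.1, by linarith [heρ y (hmem.2 hy)], hz.2⟩
    refine (hU.trans Finset.card_biUnion_le).trans (Finset.sum_le_sum fun y hy => ?_)
    rw [← Set.ncard_eq_toFinset_card _ (g.bxfin htt y (ρ y))]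
    exact h5 y hy t ⟨h.1, by linarith [h.2, heη y hy]⟩
  have hnp : ∑ y ∈ F, np y ≤ (zs v j).ncard := by rw [hcard]; exact Finset.sum_le_sum h1
  have hnm : (zs v j).ncard ≤ ∑ y ∈ F, nm y := by rw [hcard]; exact Finset.sum_le_sum h2
  refine ⟨η2, hη20, fun t h => hnm.trans (hL t h), fun t h => (hR t h).trans hnp, ?_⟩
  rintro ⟨y, hy, hvy⟩ t h t' h'
  refine (hR t' h').trans_lt (lt_of_lt_of_le ?_ (hL t h))
  exact Finset.sum_lt_sum (fun z hz => (h1 z hz).trans (h2 z hz)) ⟨y, hmem.2 hy, h3 y (hmem.2 hy) hvy⟩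

theorem final (g : Good v vy vyy vt ta tb M B R τ) :
    (∀ t ∈ Ioo τ tb, (zs v t).Finite) ∧
    (∀ p ∈ Ioo τ tb, ∀ q ∈ Ioo τ tb, p ≤ q → (zs v q).ncard ≤ (zs v p).ncard) ∧
    (∀ j ∈ Ioo τ tb, (∃ y ∈ zs v j, vy y j = 0) → ∀ p ∈ Ioo τ tb, ∀ q ∈ Ioo τ tb, p < j → j < q →
      (zs v q).ncard < (zs v p).ncard) := by
  have anti : ∀ p ∈ Ioo τ tb, ∀ q ∈ Ioo τ tb, p ≤ q → (zs v q).ncard ≤ (zs v p).ncard := by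
    intro p hp q hq hpq
    refine anti_of_local (f := fun t => (zs v t).ncard) (fun j ht => ?_) hp hq hpq
    obtain ⟨η, hη, h1, h2, -⟩ := g.loc ht
    exact ⟨η, hη, h1, h2⟩
  refine ⟨fun t ht => g.zsfin ht, anti, ?_⟩
  intro j ht hm p hp q hq h1 h2
  obtain ⟨η, hη, -, -, h3⟩ := g.loc ht
  have a1 := le_max_left p (j - η); have a2 := le_max_right p (j - η)
  have a3 : max p (j - η) < j := max_lt h1 (by linarith)
  have b1 := min_le_left q (j + η); have b2 := min_le_right q (j + η)
  have b3 : j < min q (j + η) := lt_min h2 (by linarith)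
  have key := h3 hm ((max p (j - η) + j) / 2) ⟨by linarith, by linarith⟩ ((j + min q (j + η)) / 2) ⟨by linarith, by linarith⟩
  have k1 := anti p hp ((max p (j - η) + j) / 2) ⟨by linarith [hp.1], by linarith [ht.2]⟩ (by linarith)
  have k2 := anti ((j + min q (j + η)) / 2) ⟨by linarith [ht.1], by linarith [hq.2]⟩ q hq (by linarith)
  exact k2.trans_lt (key.trans_le k1)
end Good

theorem PMod.final {v vy vyy vt : ℝ → ℝ → ℝ} {ta tb M B R τ : ℝ} (m : PMod v vy vyy vt ta tb M B R)
    (odd : ∀ t ∈ Ioo ta tb, ∀ y, v (-y) t = -v y t) (hτ : ta < τ) :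
    (∀ t ∈ Ioo τ tb, (zs v t).Finite) ∧
    (∀ p ∈ Ioo τ tb, ∀ q ∈ Ioo τ tb, p ≤ q → (zs v q).ncard ≤ (zs v p).ncard) ∧
    (∀ j ∈ Ioo τ tb, (∃ y ∈ zs v j, vy y j = 0) → ∀ p ∈ Ioo τ tb, ∀ q ∈ Ioo τ tb, p < j → j < q →
      (zs v q).ncard < (zs v p).ncard) := by
  have h0 : 0 < min 1 (τ - ta) := lt_min one_pos (by linarith)
  have h1 : min 1 (τ - ta) ≤ 1 := min_le_left _ _
  have h2 : min 1 (τ - ta) ≤ τ - ta := min_le_right _ _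
  obtain ⟨K, hK⟩ := m.exists_K h0 h1
  set J := min 1 (τ - ta)
  have c : Ctx v vy vyy vt ta tb M B R J K := ⟨m, h0, h1, hK⟩
  have hs : ∀ t ∈ Ioo τ tb, t ∈ Ioo (ta + J ^ 2) tb := fun t ht => ⟨by nlinarith [ht.1], ht.2⟩
  have g : Good v vy vyy vt ta tb M B R τ := ⟨m, hτ.le, odd, fun t ht => c.finite_zeros (hs t ht),
    fun j ht Q a b ρ hρ τ' hτ' h => c.not_single (hs j ht) a b hρ hτ' h⟩
  exact g.final

lemma par_int {q : ℝ → ℝ → ℝ} {ta tb C j : ℝ} (hC : 0 ≤ C) (ht : j ∈ Ioo ta tb)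
    (hc : ∀ t ∈ Ioo ta tb, Continuous fun z => q z t)
    (hl : ∀ z, ∀ t ∈ Ioo ta tb, ∀ t' ∈ Ioo ta tb, |q z t - q z t'| ≤ C * |t - t'|)
    (hd : ∀ z, z ≠ 0 → ∃ d, HasDerivAt (fun t => q z t) d j) (w : ℝ) :
    ∃ d, HasDerivAt (fun t => ∫ z in (0 : ℝ)..w, q z t) d j ∧ |d| ≤ C * |w| := by
  choose! d hd using hd
  have hnb : Ioo ta tb ∈ 𝓝 j := Ioo_mem_nhds ht.1 ht.2
  have hae : ∀ᵐ z : ℝ, z ≠ 0 := by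
    rw [ae_iff]; simp
  have hmeas : AEStronglyMeasurable d (volume.restrict (Set.uIoc 0 w)) := by
    have h1 : Tendsto (fun n : ℕ => j + (tb - j) / ((n : ℝ) + 2)) atTop (𝓝[≠] j) := by
      rw [tendsto_nhdsWithin_iff]
      constructor
      · have : Tendsto (fun n : ℕ => (tb - j) / ((n : ℝ) + 2)) atTop (𝓝 0) :=
          tendsto_const_nhds.div_atTop (tendsto_atTop_add_const_right _ _ tendsto_natCast_atTop_atTop)
        simpa using this.const_add j
      · refine Eventually.of_forall fun n => ?_
        have : 0 < (tb - j) / ((n : ℝ) + 2) := div_pos (by linarith [ht.2]) (by positivity)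
        simp only [mem_compl_iff, mem_singleton_iff]; linarith
    refine aestronglyMeasurable_of_tendsto_ae (u := atTop)
      (f := fun (n : ℕ) z => slope (fun t => q z t) j (j + (tb - j) / ((n : ℝ) + 2))) ?_ ?_
    · intro n
      have hpos : 0 < (tb - j) / ((n : ℝ) + 2) := div_pos (by linarith [ht.2]) (by positivity)
      have hlt : (tb - j) / ((n : ℝ) + 2) < tb - j := div_lt_self (by linarith [ht.2]) (by
        have : (0 : ℝ) ≤ n := n.cast_nonneg
        linarith)
      have c1 := hc _ (show j + (tb - j) / ((n : ℝ) + 2) ∈ Ioo ta tb from ⟨by linarith [ht.1], by linarith⟩)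
      have c2 := hc _ ht
      simp only [slope_def_field]
      exact ((c1.sub c2).div_const _).aestronglyMeasurable
    · refine ae_restrict_of_ae ?_
      filter_upwards [hae] with z hz
      exact (hasDerivAt_iff_tendsto_slope.1 (hd z hz)).comp h1
  have key := intervalIntegral.hasDerivAt_integral_of_dominated_loc_of_lip (𝕜 := ℝ) (F := fun t z => q z t) (F' := d) (x₀ := j)
    (a := 0) (b := w) (μ := volume) (bound := fun _ => C) hnb
    (by filter_upwards [hnb] with t h using (hc t h).aestronglyMeasurable) ((hc j ht).intervalIntegrable _ _) hmeas
    (Eventually.of_forall fun z _ => by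
      rw [Real.nnabs_of_nonneg hC]
      refine LipschitzOnWith.of_dist_le_mul fun t h t' h' => ?_
      rw [Real.coe_toNNReal _ hC, Real.dist_eq, Real.dist_eq]; exact hl z t h t' h')
    (by simp) (by filter_upwards [hae] with z hz _ using hd z hz)
  refine ⟨_, key.2, ?_⟩
  have := key.2.le_of_lip' (C := C * |w|) (by positivity) ?_
  · exact this
  · filter_upwards [hnb] with t h
    rw [← intervalIntegral.integral_sub ((hc t h).intervalIntegrable _ _) ((hc j ht).intervalIntegrable _ _)]
    refine (intervalIntegral.norm_integral_le_of_norm_le_const fun z _ => hl z t h j ht).trans_eq ?_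
    rw [sub_zero, Real.norm_eq_abs]; ring

lemma coord {q : ℝ → ℝ → ℝ} {ta tb C q0 q1 : ℝ} (hC : 0 ≤ C) (hq0 : 0 < q0)
    (hq : ∀ t ∈ Ioo ta tb, ∀ w, q0 ≤ q w t ∧ q w t ≤ q1)
    (hl : ∀ t ∈ Ioo ta tb, ∀ t' ∈ Ioo ta tb, ∀ w w', |q w t - q w' t'| ≤ C * |w - w'| + C * |t - t'|)
    (hd : ∀ t ∈ Ioo ta tb, ∀ z, z ≠ 0 → ∃ d, HasDerivAt (fun t => q z t) d t) :
    ∃ F x xt : ℝ → ℝ → ℝ, (∀ t ∈ Ioo ta tb, ∀ y, F (x y t) t = y) ∧ (∀ t ∈ Ioo ta tb, ∀ w, x (F w t) t = w) ∧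
      (∀ t ∈ Ioo ta tb, x 0 t = 0) ∧ (∀ t ∈ Ioo ta tb, StrictMono fun y => x y t) ∧
      (∀ t ∈ Ioo ta tb, ∀ y, HasDerivAt (fun y => x y t) (q (x y t) t)⁻¹ y) ∧
      (∀ t ∈ Ioo ta tb, ∀ y, HasDerivAt (fun t => x y t) (xt y t) t) ∧
      (∀ t ∈ Ioo ta tb, ∀ y, |xt y t| ≤ C * |x y t| / q0) ∧
      (∀ t ∈ Ioo ta tb, ∀ y, |y| ≤ q1 * |x y t|) ∧
      ContinuousOn (fun p : ℝ × ℝ => x p.1 p.2) {p | p.2 ∈ Ioo ta tb} ∧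
      ((∀ t ∈ Ioo ta tb, ∀ w, q (-w) t = q w t) → ∀ t ∈ Ioo ta tb, ∀ y, x (-y) t = -x y t) := by
  have hqc : ∀ t ∈ Ioo ta tb, Continuous fun z => q z t := by
    intro t ht
    refine (LipschitzWith.of_dist_le_mul (K := C.toNNReal) fun w w' => ?_).continuous
    have := hl t ht t ht w w'
    rw [Real.coe_toNNReal _ hC, Real.dist_eq, Real.dist_eq]; simpa using this
  set F : ℝ → ℝ → ℝ := fun w t => ∫ z in (0 : ℝ)..w, q z t with hF
  have Fw : ∀ t ∈ Ioo ta tb, ∀ w, HasDerivAt (fun w => F w t) (q w t) w := fun t ht w =>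
    ((hqc t ht).integral_hasStrictDerivAt 0 w).hasDerivAt
  have Fc : ∀ t ∈ Ioo ta tb, Continuous fun w => F w t := fun t ht =>
    continuous_iff_continuousAt.2 fun w => (Fw t ht w).continuousAt
  have F0 : ∀ t, F 0 t = 0 := fun t => intervalIntegral.integral_same
  have mvt : ∀ t ∈ Ioo ta tb, ∀ w w', ∃ z ∈ uIcc w w', F w' t - F w t = q z t * (w' - w) := by
    intro t ht
    have key : ∀ w w', w < w' → ∃ z ∈ Icc w w', F w' t - F w t = q z t * (w' - w) := by
      intro w w' h
      obtain ⟨z, hz, h1⟩ := exists_hasDerivAt_eq_slope (fun w => F w t) (fun w => q w t) h (Fc t ht).continuousOn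
        (fun z _ => Fw t ht z)
      refine ⟨z, Ioo_subset_Icc_self hz, ?_⟩
      rw [h1, div_mul_cancel₀ _ (sub_pos.2 h).ne']
    intro w w'
    rcases lt_trichotomy w w' with h | h | h
    · obtain ⟨z, hz, e⟩ := key w w' h
      exact ⟨z, by rwa [uIcc_of_le h.le], e⟩
    · subst h; exact ⟨w, left_mem_uIcc, by simp⟩
    · obtain ⟨z, hz, e⟩ := key w' w h
      exact ⟨z, by rwa [uIcc_of_ge h.le], by linarith⟩
  have low : ∀ t ∈ Ioo ta tb, ∀ w w', q0 * |w' - w| ≤ |F w' t - F w t| := by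
    intro t ht w w'
    obtain ⟨z, -, e⟩ := mvt t ht w w'
    rw [e, abs_mul, abs_of_pos (hq0.trans_le (hq t ht z).1)]
    gcongr; exact (hq t ht z).1
  have up : ∀ t ∈ Ioo ta tb, ∀ w, |F w t| ≤ q1 * |w| := by
    intro t ht w
    obtain ⟨z, -, e⟩ := mvt t ht 0 w
    rw [F0, sub_zero, sub_zero] at e
    rw [e, abs_mul, abs_of_pos (hq0.trans_le (hq t ht z).1)]
    gcongr; exact (hq t ht z).2
  have smono : ∀ t ∈ Ioo ta tb, StrictMono fun w => F w t := by
    intro t ht w w' h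
    obtain ⟨z, -, e⟩ := mvt t ht w w'
    have := mul_pos (hq0.trans_le (hq t ht z).1) (sub_pos.2 h)
    simp only; linarith
  have surj : ∀ t ∈ Ioo ta tb, ∀ y, ∃ x, F x t = y := by
    intro t ht y
    have h1 : |y| / q0 * q0 = |y| := by field_simp
    have a0 : 0 ≤ |y| / q0 := by positivity
    have e1 : |y| ≤ F (|y| / q0) t := by
      obtain ⟨z, -, e⟩ := mvt t ht 0 (|y| / q0)
      rw [F0, sub_zero, sub_zero] at e
      rw [e]
      have : q0 * (|y| / q0) ≤ q z t * (|y| / q0) := by gcongr; exact (hq t ht z).1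
      linarith
    have e2 : F (-(|y| / q0)) t ≤ -|y| := by
      obtain ⟨z, -, e⟩ := mvt t ht 0 (-(|y| / q0))
      rw [F0, sub_zero, sub_zero] at e
      rw [e]
      have : q0 * (|y| / q0) ≤ q z t * (|y| / q0) := by gcongr; exact (hq t ht z).1
      linarith
    obtain ⟨x, -, hx⟩ := intermediate_value_Icc (show -(|y| / q0) ≤ |y| / q0 by linarith) (Fc t ht).continuousOn
      (show y ∈ Icc (F (-(|y| / q0)) t) (F (|y| / q0) t) from ⟨by linarith [neg_abs_le y], by linarith [le_abs_self y]⟩)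
    exact ⟨x, hx⟩
  have Ft : ∀ t ∈ Ioo ta tb, ∀ w, ∃ d, HasDerivAt (fun t => F w t) d t ∧ |d| ≤ C * |w| := fun t ht w =>
    par_int hC ht hqc (fun z t h t' h' => by simpa using hl t h t' h' z z) (hd t ht) w
  choose! d hd1 hd2 using Ft
  have Flip : ∀ t ∈ Ioo ta tb, ∀ t' ∈ Ioo ta tb, ∀ w, |F w t - F w t'| ≤ C * |w| * |t - t'| := fun t ht t' ht' w =>
    (convex_Ioo ta tb).norm_image_sub_le_of_norm_hasDerivWithin_le (f := fun t => F w t)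
    (fun t ht => (hd1 t ht w).hasDerivWithinAt) (fun t ht => hd2 t ht w) ht' ht
  have hx : ∀ t y, ∃ x, t ∈ Ioo ta tb → F x t = y := by
    intro t y
    by_cases ht : t ∈ Ioo ta tb
    · obtain ⟨x, hx⟩ := surj t ht y; exact ⟨x, fun _ => hx⟩
    · exact ⟨0, fun h => absurd h ht⟩
  choose x' hx' using hx
  set x : ℝ → ℝ → ℝ := fun y t => x' t y with hxdef
  have hFx : ∀ t ∈ Ioo ta tb, ∀ y, F (x y t) t = y := fun t ht y => hx' t y ht
  have xlip : ∀ t ∈ Ioo ta tb, ∀ t' ∈ Ioo ta tb, ∀ y y', q0 * |x y t - x y' t'| ≤ |y - y'| + C * |x y' t'| * |t - t'| := by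
    intro t ht t' ht' y y'
    refine (low t ht _ _).trans ?_
    have : F (x y t) t - F (x y' t') t = (y - y') - (F (x y' t') t - F (x y' t') t') := by
      rw [hFx t ht, hFx t' ht']; ring
    rw [this]
    exact (abs_sub _ _).trans (by gcongr; exact Flip t ht t' ht' _)
  have xcont : ∀ p : ℝ × ℝ, p.2 ∈ Ioo ta tb → ContinuousAt (fun p : ℝ × ℝ => x p.1 p.2) p := by
    intro p hp
    have hnb : ∀ᶠ r : ℝ × ℝ in 𝓝 p, r.2 ∈ Ioo ta tb := continuousAt_snd.eventually (Ioo_mem_nhds hp.1 hp.2)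
    have hT : Tendsto (fun r : ℝ × ℝ => (|r.1 - p.1| + C * |x p.1 p.2| * |r.2 - p.2|) / q0) (𝓝 p) (𝓝 0) := by
      have : Continuous (fun r : ℝ × ℝ => (|r.1 - p.1| + C * |x p.1 p.2| * |r.2 - p.2|) / q0) := by fun_prop
      simpa using this.tendsto p
    rw [ContinuousAt, tendsto_iff_dist_tendsto_zero]
    refine squeeze_zero' (Eventually.of_forall fun _ => dist_nonneg) ?_ hT
    filter_upwards [hnb] with r hr
    rw [Real.dist_eq, le_div_iff₀ hq0, mul_comm]
    exact xlip r.2 hr p.2 hp r.1 p.1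
  refine ⟨F, x, fun y t => -d t (x y t) / q (x y t) t, hFx, ?_, ?_, ?_, ?_, ?_, ?_, ?_, ?_, ?_⟩
  · exact fun t ht w => (smono t ht).injective (hFx t ht _)
  · exact fun t ht => (smono t ht).injective ((hFx t ht 0).trans (F0 t).symm)
  · intro t ht y y' h
    refine (smono t ht).lt_iff_lt.1 ?_
    simp only [hFx t ht]; exact h
  · intro t ht y
    refine HasDerivAt.of_local_left_inverse (f := fun w => F w t) ?_ (Fw t ht _) (hq0.trans_le (hq t ht _).1).ne'
      (Eventually.of_forall fun y => hFx t ht y)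
    exact (xcont (y, t) ht).comp (f := fun y => (y, t)) (by fun_prop)
  · intro j ht y
    have hxc : ContinuousAt (fun t => x y t) j := (xcont (y, j) ht).comp (f := fun t => (y, t)) (by fun_prop)
    have hnb : Ioo ta tb ∈ 𝓝 j := Ioo_mem_nhds ht.1 ht.2
    have hz : ∀ t, ∃ z, t ∈ Ioo ta tb → z ∈ uIcc (x y j) (x y t) ∧ F (x y t) t - F (x y j) t = q z t * (x y t - x y j) := by
      intro t
      by_cases h : t ∈ Ioo ta tb
      · obtain ⟨z, h1, h2⟩ := mvt t h (x y j) (x y t)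
        exact ⟨z, fun _ => ⟨h1, h2⟩⟩
      · exact ⟨0, fun h' => absurd h' h⟩
    choose z hz using hz
    have hq' : Tendsto (fun t => q (z t) t) (𝓝[≠] j) (𝓝 (q (x y j) j)) := by
      refine tendsto_nhdsWithin_of_tendsto_nhds ?_
      have hT : Tendsto (fun t => C * |x y t - x y j| + C * |t - j|) (𝓝 j) (𝓝 0) := by
        have : ContinuousAt (fun t => C * |x y t - x y j| + C * |t - j|) j := by fun_prop
        simpa [ContinuousAt] using this
      rw [tendsto_iff_dist_tendsto_zero]
      refine squeeze_zero' (Eventually.of_forall fun _ => dist_nonneg) ?_ hT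
      filter_upwards [hnb] with t h
      rw [Real.dist_eq]
      refine (hl t h j ht _ _).trans ?_
      gcongr ?_ + _
      gcongr C * ?_
      exact abs_sub_left_of_mem_uIcc (hz t h).1
    rw [hasDerivAt_iff_tendsto_slope]
    have hs := (hasDerivAt_iff_tendsto_slope.1 (hd1 j ht (x y j))).neg.div hq' (hq0.trans_le (hq j ht _).1).ne'
    refine hs.congr' ?_
    filter_upwards [nhdsWithin_le_nhds hnb, self_mem_nhdsWithin] with t h hne
    have hne' : t - j ≠ 0 := sub_ne_zero.2 hne
    have hqz := (hq0.trans_le (hq t h (z t)).1).ne'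
    have e := (hz t h).2
    rw [hFx t h] at e
    have e0 := hFx j ht y
    simp only [Pi.div_apply, Pi.neg_apply, slope_def_field]
    rw [div_eq_div_iff hqz hne', e0]
    field_simp
    linarith
  · intro t ht y
    have h1 := (hq t ht (x y t)).1
    rw [abs_div, abs_neg, abs_of_pos (hq0.trans_le h1)]
    exact div_le_div₀ (by positivity) (hd2 t ht _) hq0 h1
  · intro t ht y
    have := up t ht (x y t)
    rwa [hFx t ht] at this
  · exact fun p hp => (xcont p hp).continuousWithinAt
  · intro hev t ht y
    refine (smono t ht).injective ?_
    have h := intervalIntegral.integral_comp_neg (a := 0) (b := x y t) (fun z => q z t)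
    simp only [hev t ht, neg_zero] at h
    have e := hFx t ht y
    simp only [hFx t ht]
    simp only [hF] at e ⊢
    rw [intervalIntegral.integral_symm, ← h, e]

structure SMod (U Uw Uww Ut p pw : ℝ → ℝ → ℝ) (ta tb κ M B R : ℝ) : Prop where
  hκ : 0 < κ
  hM : 0 ≤ M
  hB : 0 ≤ B
  hR : 0 ≤ R
  dw : ∀ t ∈ Ioo ta tb, ∀ w, HasDerivAt (fun w => U w t) (Uw w t) w
  dww : ∀ t ∈ Ioo ta tb, ∀ w, w ≠ 0 → HasDerivAt (fun w => Uw w t) (Uww w t) w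
  dt : ∀ t ∈ Ioo ta tb, ∀ w, HasDerivAt (fun t => U w t) (Ut w t) t
  cw : ContinuousOn (fun p : ℝ × ℝ => Uw p.1 p.2) {p | p.2 ∈ Ioo ta tb}
  cww : ContinuousOn (fun p : ℝ × ℝ => Uww p.1 p.2) {p | p.1 ≠ 0 ∧ p.2 ∈ Ioo ta tb}
  bU : ∀ t ∈ Ioo ta tb, ∀ w, |U w t| ≤ B
  bUw : ∀ t ∈ Ioo ta tb, ∀ w, |Uw w t| ≤ B
  bUww : ∀ t ∈ Ioo ta tb, ∀ w, |Uww w t| ≤ B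
  bUt : ∀ t ∈ Ioo ta tb, ∀ w, |Ut w t| ≤ B
  eqn : ∀ t ∈ Ioo ta tb, ∀ w, w ≠ 0 → |Ut w t - p w t * Uww w t| ≤ M * (|Uw w t| + |U w t|)
  far : ∀ t ∈ Ioo ta tb, ∀ w, R ≤ |w| → |U w t| = 1
  farw : ∀ t ∈ Ioo ta tb, ∀ w, R ≤ |w| → Uw w t = 0
  zero : ∀ t ∈ Ioo ta tb, U 0 t = 0
  odd : ∀ t ∈ Ioo ta tb, ∀ w, U (-w) t = -U w t
  pl : ∀ t ∈ Ioo ta tb, ∀ w, κ ≤ p w t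
  pu : ∀ t ∈ Ioo ta tb, ∀ w, p w t ≤ B
  even : ∀ t ∈ Ioo ta tb, ∀ w, p (-w) t = p w t
  lipp : ∀ t ∈ Ioo ta tb, ∀ t' ∈ Ioo ta tb, ∀ w w', |p w t - p w' t'| ≤ B * |w - w'| + B * |t - t'|
  dp : ∀ t ∈ Ioo ta tb, ∀ w, w ≠ 0 → HasDerivAt (fun w => p w t) (pw w t) w
  bpw : ∀ t ∈ Ioo ta tb, ∀ w, |pw w t| ≤ B
  cpw : ContinuousOn (fun p : ℝ × ℝ => pw p.1 p.2) {p | p.1 ≠ 0 ∧ p.2 ∈ Ioo ta tb}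
  dpt : ∀ t ∈ Ioo ta tb, ∀ w, w ≠ 0 → ∃ d, HasDerivAt (fun t => p w t) d t

lemma sq_lip {p p' κ : ℝ} (hκ : 0 < κ) (h : κ ≤ p) (h' : κ ≤ p') :
    |(√p)⁻¹ - (√p')⁻¹| ≤ |p - p'| / (κ * √κ) := by
  have k0 := Real.sqrt_pos.2 hκ
  have a := Real.sqrt_le_sqrt h
  have a' := Real.sqrt_le_sqrt h'
  have e := Real.sq_sqrt hκ.le
  have e1 := Real.sq_sqrt (hκ.le.trans h)
  have e2 := Real.sq_sqrt (hκ.le.trans h')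
  set r := √κ
  set x := √p
  set y := √p'
  have hx : 0 < x := k0.trans_le a
  have hy : 0 < y := k0.trans_le a'
  have : x⁻¹ - y⁻¹ = (p' - p) / (x * y * (x + y)) := by
    rw [← e1, ← e2]; field_simp; ring
  rw [this, abs_div, abs_sub_comm p p', abs_of_pos (show 0 < x * y * (x + y) by positivity), ← e]
  gcongr
  · nlinarith
  · linarith

theorem SMod.final {U Uw Uww Ut p pw : ℝ → ℝ → ℝ} {ta tb κ M B R τ : ℝ} (m : SMod U Uw Uww Ut p pw ta tb κ M B R)
    (hτ : ta < τ) :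
    (∀ t ∈ Ioo τ tb, (zs U t).Finite) ∧
    (∀ p ∈ Ioo τ tb, ∀ q ∈ Ioo τ tb, p ≤ q → (zs U q).ncard ≤ (zs U p).ncard) ∧
    (∀ j ∈ Ioo τ tb, (∃ y ∈ zs U j, Uw y j = 0) → ∀ p ∈ Ioo τ tb, ∀ q ∈ Ioo τ tb, p < j → j < q →
      (zs U q).ncard < (zs U p).ncard) := by
  have hB := m.hB
  have hM := m.hM
  have hR := m.hR
  have hκ := m.hκ
  have k0 := Real.sqrt_pos.2 m.hκ
  by_cases hne : (Ioo ta tb).Nonempty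
  swap
  · have : ∀ t ∈ Ioo τ tb, False := fun t ht => hne ⟨t, hτ.trans ht.1, ht.2⟩
    exact ⟨fun t ht => (this t ht).elim, fun t ht => (this t ht).elim, fun t ht => (this t ht).elim⟩
  obtain ⟨t1, ht1⟩ := hne
  have hBκ : κ ≤ B := (m.pl t1 ht1 0).trans (m.pu t1 ht1 0)
  have hB0 : 0 < B := m.hκ.trans_le hBκ
  have pp : ∀ t ∈ Ioo ta tb, ∀ w, 0 < p w t := fun t ht w => m.hκ.trans_le (m.pl t ht w)
  have sp : ∀ t ∈ Ioo ta tb, ∀ w, 0 < √(p w t) := fun t ht w => Real.sqrt_pos.2 (pp t ht w)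
  set C : ℝ := B / (κ * √κ) with hC
  have hC0 : 0 ≤ C := by positivity
  set q0 : ℝ := (√B)⁻¹ with hq0
  have hq0p : 0 < q0 := inv_pos.2 (Real.sqrt_pos.2 hB0)
  obtain ⟨F, x, xt, hFx, hxF, ω, xm, dx, dxt, bxt, xb, xc, xodd⟩ := coord (q := fun w t => (√(p w t))⁻¹)
    (ta := ta) (tb := tb) (C := C) (q0 := q0) (q1 := (√κ)⁻¹) hC0 hq0p
    (fun t ht w => ⟨by
      rw [hq0]; exact inv_anti₀ (sp t ht w) (Real.sqrt_le_sqrt (m.pu t ht w)),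
      inv_anti₀ k0 (Real.sqrt_le_sqrt (m.pl t ht w))⟩)
    (fun t ht t' ht' w w' => by
      refine (sq_lip m.hκ (m.pl t ht w) (m.pl t' ht' w')).trans ?_
      rw [hC, ← mul_add, div_mul_eq_mul_div, mul_add]
      gcongr
      exact m.lipp t ht t' ht' w w')
    (fun t ht w hw => by
      obtain ⟨d, hd⟩ := m.dpt t ht w hw
      exact ⟨_, (hd.sqrt (pp t ht w).ne').inv (sp t ht w).ne'⟩)
  have xodd' := xodd (fun t ht w => by simp only [m.even t ht w])
  have xne : ∀ t ∈ Ioo ta tb, ∀ y, y ≠ 0 → x y t ≠ 0 := fun t ht y hy h => hy (by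
    have := hFx t ht y
    have h0 := hFx t ht 0
    rw [ω t ht] at h0; rw [h, h0] at this; exact this.symm)
  have xpos : ∀ t ∈ Ioo ta tb, ∀ y, 0 ≤ x y t ↔ 0 ≤ y := fun t ht y => by
    have := (xm t ht).le_iff_le (a := 0) (b := y)
    simp only [ω t ht] at this; exact this
  simp only [inv_inv] at dx
  have pair : ContinuousOn (fun z : ℝ × ℝ => (x z.1 z.2, z.2)) {z | z.2 ∈ Ioo ta tb} := xc.prodMk continuousOn_snd
  have cUw : ContinuousOn (fun z : ℝ × ℝ => Uw (x z.1 z.2) z.2) {z | z.2 ∈ Ioo ta tb} :=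
    m.cw.comp pair fun z hz => hz
  have hop : IsOpen {z : ℝ × ℝ | z.2 ∈ Ioo ta tb} := isOpen_Ioo.preimage continuous_snd
  have cp : ContinuousOn (fun z : ℝ × ℝ => p z.1 z.2) {z | z.2 ∈ Ioo ta tb} := by
    intro z hz
    refine ContinuousAt.continuousWithinAt ?_
    have hT : Tendsto (fun r : ℝ × ℝ => B * |r.1 - z.1| + B * |r.2 - z.2|) (𝓝 z) (𝓝 0) := by
      have : Continuous (fun r : ℝ × ℝ => B * |r.1 - z.1| + B * |r.2 - z.2|) := by fun_prop
      simpa using this.tendsto z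
    rw [ContinuousAt, tendsto_iff_dist_tendsto_zero]
    refine squeeze_zero' (Eventually.of_forall fun _ => dist_nonneg) ?_ hT
    filter_upwards [hop.mem_nhds hz] with r hr
    exact m.lipp r.2 hr z.2 hz _ _
  have cpx : ContinuousOn (fun z : ℝ × ℝ => p (x z.1 z.2) z.2) {z | z.2 ∈ Ioo ta tb} :=
    cp.comp pair fun z hz => hz
  have sub : {z : ℝ × ℝ | z.1 ≠ 0 ∧ z.2 ∈ Ioo ta tb} ⊆ {z | z.2 ∈ Ioo ta tb} := fun z hz => hz.2
  have mp : MapsTo (fun z : ℝ × ℝ => (x z.1 z.2, z.2)) {z | z.1 ≠ 0 ∧ z.2 ∈ Ioo ta tb} {z | z.1 ≠ 0 ∧ z.2 ∈ Ioo ta tb} :=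
    fun z hz => ⟨xne z.2 hz.2 z.1 hz.1, hz.2⟩
  have cUww : ContinuousOn (fun z : ℝ × ℝ => Uww (x z.1 z.2) z.2) {z | z.1 ≠ 0 ∧ z.2 ∈ Ioo ta tb} :=
    m.cww.comp (pair.mono sub) mp
  have cpw : ContinuousOn (fun z : ℝ × ℝ => pw (x z.1 z.2) z.2) {z | z.1 ≠ 0 ∧ z.2 ∈ Ioo ta tb} :=
    m.cpw.comp (pair.mono sub) mp
  set K : ℝ := C * R / q0 with hK
  have hK0 : 0 ≤ K := by positivity
  have hUx : ∀ t ∈ Ioo ta tb, ∀ y, |Uw (x y t) t * xt y t| ≤ K * |Uw (x y t) t| := by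
    intro t ht y
    by_cases h : R ≤ |x y t|
    · rw [m.farw t ht _ h]; simp
    · rw [abs_mul, mul_comm]
      gcongr
      refine (bxt t ht y).trans ?_
      rw [hK]; gcongr; exact (not_le.1 h).le
  have hsB : ∀ t ∈ Ioo ta tb, ∀ w, √(p w t) ≤ √B := fun t ht w => Real.sqrt_le_sqrt (m.pu t ht w)
  have hsκ : ∀ t ∈ Ioo ta tb, ∀ w, √κ ≤ √(p w t) := fun t ht w => Real.sqrt_le_sqrt (m.pl t ht w)
  have sB0 := Real.sqrt_nonneg B
  have P : PMod (fun y t => U (x y t) t) (fun y t => Uw (x y t) t * √(p (x y t) t))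
      (fun y t => Uww (x y t) t * p (x y t) t + Uw (x y t) t * (pw (x y t) t / 2))
      (fun y t => Uw (x y t) t * xt y t + Ut (x y t) t) ta tb (M + (K + M + B) / √κ)
      (K * B + B + B * √B + B * B + B * B) ((√κ)⁻¹ * R) := by
    constructor
    · positivity
    · positivity
    · positivity
    · intro t ht y
      exact (m.dw t ht (x y t)).comp y (dx t ht y)
    · intro t ht y hy
      have h1 := (m.dww t ht _ (xne t ht y hy)).comp y (dx t ht y)
      have h2' := (m.dp t ht _ (xne t ht y hy)).comp y (dx t ht y)
      have h2 := h2'.sqrt (show p (x y t) t ≠ 0 from (pp t ht _).ne')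
      refine (h1.mul h2).congr_deriv ?_
      have e := Real.sq_sqrt (pp t ht (x y t)).le
      have := sp t ht (x y t)
      simp only [Function.comp]
      set r := √(p (x y t) t)
      rw [← e]; field_simp
    · intro t ht y
      have hnb : ∀ᶠ z : ℝ × ℝ in 𝓝 (x y t, t), z.2 ∈ Ioo ta tb := hop.mem_nhds ht
      have := chain2 (f := U) (fx := Uw) (ω := x y t) (j := t) (ft := Ut (x y t) t) (p := fun t => x y t) (q := fun t => t)
        (p' := xt y t) (q' := 1) (s0 := t)
        (by filter_upwards [hnb] with z hz using m.dw z.2 hz z.1)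
        (m.cw.continuousAt (hop.mem_nhds ht)) (m.dt t ht _) (dxt t ht y) (hasDerivAt_id t) rfl rfl
      simpa using this
    · exact cUw.mul cpx.sqrt
    · exact (cUww.mul (cpx.mono sub)).add ((cUw.mono sub).mul (cpw.div_const _))
    · intro t ht y
      have := m.bU t ht (x y t)
      have h1 : 0 ≤ K * B := by positivity
      have h2 : 0 ≤ B * √B := by positivity
      have h3 : 0 ≤ B * B := by positivity
      linarith
    · intro t ht y
      have h1 : 0 ≤ K * B := by positivity
      have h3 : 0 ≤ B * B := by positivity
      have : |Uw (x y t) t * √(p (x y t) t)| ≤ B * √B := by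
        rw [abs_mul, abs_of_pos (sp t ht _)]
        exact mul_le_mul (m.bUw t ht _) (hsB t ht _) (sp t ht _).le hB
      linarith
    · intro t ht y
      have h1 : 0 ≤ K * B := by positivity
      have h2 : 0 ≤ B * √B := by positivity
      have e1 : |Uww (x y t) t * p (x y t) t| ≤ B * B := by
        rw [abs_mul, abs_of_pos (pp t ht _)]
        exact mul_le_mul (m.bUww t ht _) (m.pu t ht _) (pp t ht _).le hB
      have e2 : |Uw (x y t) t * (pw (x y t) t / 2)| ≤ B * B := by
        rw [abs_mul, abs_div]
        refine mul_le_mul (m.bUw t ht _) ?_ (by positivity) hB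
        have := m.bpw t ht (x y t)
        rw [abs_two]; linarith [abs_nonneg (pw (x y t) t)]
      exact (abs_add_le _ _).trans (by linarith)
    · intro t ht y
      have h3 : 0 ≤ B * B := by positivity
      have h2 : 0 ≤ B * √B := by positivity
      have e1 : |Uw (x y t) t * xt y t| ≤ K * B := (hUx t ht y).trans (by gcongr; exact m.bUw t ht _)
      exact (abs_add_le _ _).trans (by linarith [m.bUt t ht (x y t)])
    · intro t ht y hy
      have e1 := hUx t ht y
      have e2 := m.eqn t ht _ (xne t ht y hy)
      have e3 : |Uw (x y t) t * (pw (x y t) t / 2)| ≤ B * |Uw (x y t) t| := by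
        rw [abs_mul, mul_comm]
        gcongr
        have := m.bpw t ht (x y t)
        rw [abs_div, abs_two]; linarith [abs_nonneg (pw (x y t) t)]
      have e4 : |Uw (x y t) t| ≤ |Uw (x y t) t * √(p (x y t) t)| / √κ := by
        rw [le_div_iff₀ k0, abs_mul, abs_of_pos (sp t ht _)]
        gcongr; exact m.pl t ht _
      have e5 : |(Uw (x y t) t * xt y t + Ut (x y t) t) - (Uww (x y t) t * p (x y t) t + Uw (x y t) t * (pw (x y t) t / 2))|
          ≤ (K + M + B) * |Uw (x y t) t| + M * |U (x y t) t| := by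
        have : (Uw (x y t) t * xt y t + Ut (x y t) t) - (Uww (x y t) t * p (x y t) t + Uw (x y t) t * (pw (x y t) t / 2))
          = Uw (x y t) t * xt y t + (Ut (x y t) t - p (x y t) t * Uww (x y t) t) - Uw (x y t) t * (pw (x y t) t / 2) := by ring
        rw [this]
        refine (abs_sub _ _).trans ?_
        have := abs_add_le (Uw (x y t) t * xt y t) (Ut (x y t) t - p (x y t) t * Uww (x y t) t)
        linarith
      refine e5.trans ?_
      have e6 : (K + M + B) * |Uw (x y t) t| ≤ (K + M + B) / √κ * |Uw (x y t) t * √(p (x y t) t)| := by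
        rw [div_mul_eq_mul_div, ← mul_div_assoc']; gcongr
      have e7 : 0 ≤ M * |Uw (x y t) t * √(p (x y t) t)| := by positivity
      have e8 : 0 ≤ (K + M + B) / √κ * |U (x y t) t| := by positivity
      linarith
    · intro t ht y hy
      refine m.far t ht _ ?_
      have := hy.trans (xb t ht y)
      exact le_of_mul_le_mul_left this (inv_pos.2 k0)
    · intro t ht; simp only [ω t ht]; exact m.zero t ht
  have zsE : ∀ t ∈ Ioo ta tb, zs U t = (fun y => x y t) '' zs (fun y t => U (x y t) t) t := by
    intro t ht
    ext w
    constructor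
    · rintro ⟨h1, h2⟩
      refine ⟨F w t, ⟨?_, ?_⟩, hxF t ht w⟩
      · rw [← xpos t ht, hxF t ht]; exact h1
      · simp only [hxF t ht]; exact h2
    · rintro ⟨y, ⟨h1, h2⟩, rfl⟩
      exact ⟨(xpos t ht y).2 h1, h2⟩
  have zsN : ∀ t ∈ Ioo ta tb, (zs U t).ncard = (zs (fun y t => U (x y t) t) t).ncard := by
    intro t ht
    rw [zsE t ht]; exact ncard_image_of_injective _ (xm t ht).injective
  have hI : ∀ t ∈ Ioo τ tb, t ∈ Ioo ta tb := fun t ht => ⟨hτ.trans ht.1, ht.2⟩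
  obtain ⟨f1, f2, f3⟩ := P.final (fun t ht y => by simp only [xodd' t ht, m.odd t ht]) hτ
  refine ⟨fun t ht => ?_, fun a ha b hb hab => ?_, ?_⟩
  · rw [zsE t (hI t ht)]; exact (f1 t ht).image _
  · rw [zsN a (hI a ha), zsN b (hI b hb)]; exact f2 a ha b hb hab
  · rintro j ht ⟨w, hw, hw'⟩ a ha b hb h1 h2
    rw [zsN a (hI a ha), zsN b (hI b hb)]
    rw [zsE j (hI j ht)] at hw
    obtain ⟨y, hy, rfl⟩ := hw
    exact f3 j ht ⟨y, hy, by simp only at hw' ⊢; rw [hw', zero_mul]⟩ a ha b hb h1 h2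

structure HalfMod (f fw fww ft p pw : ℝ → ℝ → ℝ) (ta tb κ M B R : ℝ) : Prop where
  hκ : 0 < κ
  hM : 0 ≤ M
  hB : 0 ≤ B
  hR : 0 < R
  dw : ∀ t ∈ Ioo ta tb, ∀ w, 0 ≤ w → HasDerivAt (fun w => f w t) (fw w t) w
  dww : ∀ t ∈ Ioo ta tb, ∀ w, 0 < w → HasDerivAt (fun w => fw w t) (fww w t) w
  dt : ∀ t ∈ Ioo ta tb, ∀ w, 0 < w → HasDerivAt (fun t => f w t) (ft w t) t
  cw : ContinuousOn (fun p : ℝ × ℝ => fw p.1 p.2) {p | 0 ≤ p.1 ∧ p.2 ∈ Ioo ta tb}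
  cww : ContinuousOn (fun p : ℝ × ℝ => fww p.1 p.2) {p | 0 < p.1 ∧ p.2 ∈ Ioo ta tb}
  bf : ∀ t ∈ Ioo ta tb, ∀ w, 0 ≤ w → |f w t| ≤ B
  bfw : ∀ t ∈ Ioo ta tb, ∀ w, 0 ≤ w → |fw w t| ≤ B
  bfww : ∀ t ∈ Ioo ta tb, ∀ w, 0 < w → |fww w t| ≤ B
  bft : ∀ t ∈ Ioo ta tb, ∀ w, 0 < w → |ft w t| ≤ B
  eqn : ∀ t ∈ Ioo ta tb, ∀ w, 0 < w → |ft w t - p w t * fww w t| ≤ M * (|fw w t| + |f w t|)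
  far : ∀ t ∈ Ioo ta tb, ∀ w, R ≤ w → |f w t| = 1
  farw : ∀ t ∈ Ioo ta tb, ∀ w, R ≤ w → fw w t = 0
  zero : ∀ t ∈ Ioo ta tb, f 0 t = 0
  pl : ∀ t ∈ Ioo ta tb, ∀ w, 0 ≤ w → κ ≤ p w t
  pu : ∀ t ∈ Ioo ta tb, ∀ w, 0 ≤ w → p w t ≤ B
  lipp : ∀ t ∈ Ioo ta tb, ∀ t' ∈ Ioo ta tb, ∀ w w', 0 ≤ w → 0 ≤ w' → |p w t - p w' t'| ≤ B * |w - w'| + B * |t - t'|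
  dp : ∀ t ∈ Ioo ta tb, ∀ w, 0 < w → HasDerivAt (fun w => p w t) (pw w t) w
  bpw : ∀ t ∈ Ioo ta tb, ∀ w, 0 < w → |pw w t| ≤ B
  cpw : ContinuousOn (fun p : ℝ × ℝ => pw p.1 p.2) {p | 0 < p.1 ∧ p.2 ∈ Ioo ta tb}
  dpt : ∀ t ∈ Ioo ta tb, ∀ w, 0 < w → ∃ d, HasDerivAt (fun t => p w t) d t

noncomputable def sg (w : ℝ) : ℝ := w / |w|

lemma sg_pos {w : ℝ} (h : 0 < w) : sg w = 1 := by rw [sg, abs_of_pos h, div_self h.ne']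
lemma sg_of_neg {w : ℝ} (h : w < 0) : sg w = -1 := by rw [sg, abs_of_neg h, div_neg, div_self h.ne]
lemma sg_zero : sg 0 = 0 := by simp [sg]
lemma sg_neg (w : ℝ) : sg (-w) = -sg w := by simp [sg, neg_div]
lemma sg_sq {w : ℝ} (h : w ≠ 0) : sg w * sg w = 1 := by
  rcases lt_or_gt_of_ne h with h | h
  · rw [sg_of_neg h]; norm_num
  · rw [sg_pos h]; norm_num
lemma sg_abs {w : ℝ} (h : w ≠ 0) : |sg w| = 1 := by
  rcases lt_or_gt_of_ne h with h | h
  · rw [sg_of_neg h]; norm_num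
  · rw [sg_pos h]; norm_num
lemma sg_deriv {w : ℝ} (h : w ≠ 0) : HasDerivAt sg 0 w := by
  rcases lt_or_gt_of_ne h with h | h
  · exact (hasDerivAt_const w (-1 : ℝ)).congr_of_eventuallyEq (by
      filter_upwards [eventually_lt_nhds h] with y hy using sg_of_neg hy)
  · exact (hasDerivAt_const w (1 : ℝ)).congr_of_eventuallyEq (by
      filter_upwards [eventually_gt_nhds h] with y hy using sg_pos hy)
lemma abs_deriv_sg {w : ℝ} (h : w ≠ 0) : HasDerivAt (fun y => |y|) (sg w) w := by
  rcases lt_or_gt_of_ne h with h | h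
  · rw [sg_of_neg h]; exact hasDerivAt_abs_neg h
  · rw [sg_pos h]; exact hasDerivAt_abs_pos h

theorem HalfMod.toS {f fw fww ft p pw : ℝ → ℝ → ℝ} {ta tb κ M B R : ℝ} (m : HalfMod f fw fww ft p pw ta tb κ M B R) :
    SMod (fun w t => sg w * f |w| t) (fun w t => fw |w| t) (fun w t => sg w * fww |w| t) (fun w t => sg w * ft |w| t)
      (fun w t => p |w| t) (fun w t => sg w * pw |w| t) ta tb κ M B R := by
  have hB := m.hB
  have csg : ContinuousOn (fun z : ℝ × ℝ => sg z.1) {z | z.1 ≠ 0 ∧ z.2 ∈ Ioo ta tb} := fun z hz =>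
    ((sg_deriv hz.1).continuousAt.comp continuousAt_fst).continuousWithinAt
  have cab : Continuous (fun z : ℝ × ℝ => (|z.1|, z.2)) := by fun_prop
  have b1 : ∀ {g : ℝ → ℝ → ℝ}, (∀ t ∈ Ioo ta tb, ∀ w, 0 < w → |g w t| ≤ B) → ∀ t ∈ Ioo ta tb, ∀ w, |sg w * g |w| t| ≤ B := by
    intro g hg t ht w
    by_cases h : w = 0
    · rw [h, sg_zero]; simpa using hB
    · rw [abs_mul, sg_abs h, one_mul]; exact hg t ht _ (abs_pos.2 h)
  constructor
  · exact m.hκ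
  · exact m.hM
  · exact hB
  · exact m.hR.le
  · intro t ht w
    by_cases h : w = 0
    · subst h
      have d0 := m.dw t ht 0 le_rfl
      have h1 : HasDerivWithinAt (fun w => sg w * f |w| t) (fw |0| t) (Ici 0) 0 := by
        rw [abs_zero]
        refine d0.hasDerivWithinAt.congr_of_mem (fun y hy => ?_) self_mem_Ici
        rcases (mem_Ici.1 hy).eq_or_lt with h | h
        · rw [← h, sg_zero, m.zero t ht, zero_mul]
        · rw [sg_pos h, abs_of_pos h, one_mul]
      have h2 : HasDerivWithinAt (fun w => sg w * f |w| t) (fw |0| t) (Iic 0) 0 := by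
        rw [abs_zero]
        have d1 : HasDerivAt (fun w => f w t) (fw 0 t) (-0) := by rwa [neg_zero]
        have d2 : HasDerivAt (fun w => -f (-w) t) (fw 0 t) 0 := by
          have := (d1.comp (0 : ℝ) (hasDerivAt_neg (0 : ℝ))).neg
          exact this.congr_deriv (by ring)
        refine d2.hasDerivWithinAt.congr_of_mem (fun y hy => ?_) self_mem_Iic
        rcases (mem_Iic.1 hy).eq_or_lt with h | h
        · rw [h, sg_zero, neg_zero, m.zero t ht, zero_mul, neg_zero]
        · rw [sg_of_neg h, abs_of_neg h, neg_one_mul]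
      have := h1.union h2
      rwa [Ici_union_Iic, hasDerivWithinAt_univ] at this
    · have := (sg_deriv h).mul ((m.dw t ht |w| (abs_nonneg w)).comp w (abs_deriv_sg h))
      refine this.congr_deriv ?_
      rw [zero_mul, zero_add, mul_left_comm, sg_sq h, mul_one]
  · intro t ht w h
    refine ((m.dww t ht |w| (abs_pos.2 h)).comp w (abs_deriv_sg h)).congr_deriv (mul_comm _ _)
  · intro t ht w
    by_cases h : w = 0
    · subst h; simp only [sg_zero, zero_mul]; exact hasDerivAt_const _ _
    · exact (m.dt t ht |w| (abs_pos.2 h)).const_mul _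
  · exact m.cw.comp cab.continuousOn fun z hz => ⟨abs_nonneg _, hz⟩
  · exact csg.mul (m.cww.comp cab.continuousOn fun z hz => ⟨abs_pos.2 hz.1, hz.2⟩)
  · exact b1 fun t ht w hw => m.bf t ht w hw.le
  · exact fun t ht w => m.bfw t ht _ (abs_nonneg w)
  · exact b1 m.bfww
  · exact b1 m.bft
  · intro t ht w h
    have := m.eqn t ht |w| (abs_pos.2 h)
    have e : sg w * ft |w| t - p |w| t * (sg w * fww |w| t) = sg w * (ft |w| t - p |w| t * fww |w| t) := by ring
    rw [e, abs_mul, abs_mul, sg_abs h, one_mul, one_mul]; exact this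
  · intro t ht w h
    have h0 : w ≠ 0 := abs_pos.1 (m.hR.trans_le h)
    rw [abs_mul, sg_abs h0, one_mul]; exact m.far t ht _ h
  · exact fun t ht w h => m.farw t ht _ h
  · intro t ht; rw [sg_zero, zero_mul]
  · intro t ht w; rw [sg_neg, abs_neg, neg_mul]
  · exact fun t ht w => m.pl t ht _ (abs_nonneg w)
  · exact fun t ht w => m.pu t ht _ (abs_nonneg w)
  · intro t ht w; rw [abs_neg]
  · intro t ht t' ht' w w'
    refine (m.lipp t ht t' ht' _ _ (abs_nonneg w) (abs_nonneg w')).trans ?_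
    gcongr ?_ + _
    gcongr B * ?_
    exact abs_abs_sub_abs_le _ _
  · intro t ht w h
    exact ((m.dp t ht |w| (abs_pos.2 h)).comp w (abs_deriv_sg h)).congr_deriv (mul_comm _ _)
  · exact b1 m.bpw
  · exact csg.mul (m.cpw.comp cab.continuousOn fun z hz => ⟨abs_pos.2 hz.1, hz.2⟩)
  · exact fun t ht w h => m.dpt t ht _ (abs_pos.2 h)

theorem HalfMod.final {f fw fww ft p pw : ℝ → ℝ → ℝ} {ta tb κ M B R τ : ℝ} (m : HalfMod f fw fww ft p pw ta tb κ M B R)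
    (hτ : ta < τ) :
    (∀ t ∈ Ioo τ tb, (zs f t).Finite) ∧
    (∀ p ∈ Ioo τ tb, ∀ q ∈ Ioo τ tb, p ≤ q → (zs f q).ncard ≤ (zs f p).ncard) ∧
    (∀ j ∈ Ioo τ tb, (∃ y ∈ zs f j, fw y j = 0) → ∀ p ∈ Ioo τ tb, ∀ q ∈ Ioo τ tb, p < j → j < q →
      (zs f q).ncard < (zs f p).ncard) := by
  have e : ∀ t ∈ Ioo τ tb, zs (fun w t => sg w * f |w| t) t = zs f t := by
    intro t ht
    ext w
    refine and_congr_right fun h => ?_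
    show sg w * f |w| t = 0 ↔ f w t = 0
    rcases h.eq_or_lt with h | h
    · rw [← h, sg_zero, zero_mul, m.zero t ⟨hτ.trans ht.1, ht.2⟩]
    · rw [sg_pos h, abs_of_pos h, one_mul]
  obtain ⟨f1, f2, f3⟩ := m.toS.final hτ
  refine ⟨fun t ht => ?_, fun a ha b hb hab => ?_, ?_⟩
  · rw [← e t ht]; exact f1 t ht
  · rw [← e a ha, ← e b hb]; exact f2 a ha b hb hab
  · rintro j ht ⟨w, hw, hw'⟩ a ha b hb h1 h2
    rw [← e a ha, ← e b hb]
    exact f3 j ht ⟨w, by rw [e j ht]; exact hw, by rw [abs_of_nonneg hw.1]; exact hw'⟩ a ha b hb h1 h2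

structure Cutoff (φ φ1 φ2 : ℝ → ℝ) (K L1 L2 : ℝ) : Prop where
  hK : 0 ≤ K
  d1 : ∀ w, HasDerivAt φ (φ1 w) w
  d2 : ∀ w, HasDerivAt φ1 (φ2 w) w
  c2 : Continuous φ2
  b1 : ∀ w, |φ1 w| ≤ K
  b2 : ∀ w, |φ2 w| ≤ K
  l0 : ∀ w ≤ L1, φ w = 1
  l1 : ∀ w ≤ L1, φ1 w = 0
  l2 : ∀ w ≤ L1, φ2 w = 0
  r0 : ∀ w, L2 ≤ w → φ w = 0
  r1 : ∀ w, L2 ≤ w → φ1 w = 0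
  r2 : ∀ w, L2 ≤ w → φ2 w = 0
  nn : ∀ w, 0 ≤ φ w
  le1 : ∀ w, φ w ≤ 1

lemma exists_cutoff {L1 L2 : ℝ} (h : L1 < L2) : ∃ φ φ1 φ2 K, Cutoff φ φ1 φ2 K L1 L2 := by
  set m1 := (2 * L1 + L2) / 3 with hm1
  set m2 := (L1 + 2 * L2) / 3 with hm2
  have a1 : L1 < m1 := by rw [hm1]; linarith
  have a2 : m1 < m2 := by rw [hm1, hm2]; linarith
  have a3 : m2 < L2 := by rw [hm2]; linarith
  set φ : ℝ → ℝ := fun w => Real.smoothTransition ((m2 - w) / (m2 - m1)) with hφ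
  have hs : ContDiff ℝ 2 φ := Real.smoothTransition.contDiff.comp (by fun_prop)
  have hs1 : ContDiff ℝ 1 (deriv φ) := (contDiff_succ_iff_deriv.1 (show ContDiff ℝ (1 + 1) φ by norm_num; exact hs)).2.2
  have hs2 : Continuous (deriv (deriv φ)) := hs1.continuous_deriv le_rfl
  have l0 : ∀ w ≤ m1, φ w = 1 := fun w hw => Real.smoothTransition.one_of_one_le (by
    rw [one_le_div (by linarith)]; linarith)
  have r0 : ∀ w, m2 ≤ w → φ w = 0 := fun w hw => Real.smoothTransition.zero_of_nonpos (
    div_nonpos_of_nonpos_of_nonneg (by linarith) (by linarith))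
  have l1 : ∀ w < m1, deriv φ w = 0 := fun w hw => by
    have : φ =ᶠ[𝓝 w] fun _ => 1 := by filter_upwards [eventually_lt_nhds hw] with y hy using l0 y hy.le
    rw [this.deriv_eq, deriv_const]
  have r1 : ∀ w, m2 < w → deriv φ w = 0 := fun w hw => by
    have : φ =ᶠ[𝓝 w] fun _ => 0 := by filter_upwards [eventually_gt_nhds hw] with y hy using r0 y hy.le
    rw [this.deriv_eq, deriv_const]
  have l2 : ∀ w < m1, deriv (deriv φ) w = 0 := fun w hw => by
    have : deriv φ =ᶠ[𝓝 w] fun _ => 0 := by filter_upwards [eventually_lt_nhds hw] with y hy using l1 y hy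
    rw [this.deriv_eq, deriv_const]
  have r2 : ∀ w, m2 < w → deriv (deriv φ) w = 0 := fun w hw => by
    have : deriv φ =ᶠ[𝓝 w] fun _ => 0 := by filter_upwards [eventually_gt_nhds hw] with y hy using r1 y hy
    rw [this.deriv_eq, deriv_const]
  obtain ⟨K1, hK1⟩ := (isCompact_Icc (a := m1) (b := m2)).exists_bound_of_continuousOn hs1.continuous.continuousOn
  obtain ⟨K2, hK2⟩ := (isCompact_Icc (a := m1) (b := m2)).exists_bound_of_continuousOn hs2.continuousOn
  have bd : ∀ (g : ℝ → ℝ) (K' : ℝ), (∀ w ∈ Icc m1 m2, ‖g w‖ ≤ K') → (∀ w < m1, g w = 0) → (∀ w, m2 < w → g w = 0) →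
      K' ≤ max K1 K2 → ∀ w, |g w| ≤ max K1 K2 := by
    intro g K' h1 h2 h3 h4 w
    have hp : 0 ≤ max K1 K2 := (norm_nonneg _).trans ((h1 m1 ⟨le_rfl, a2.le⟩).trans h4)
    by_cases c1 : w < m1
    · rw [h2 w c1, abs_zero]; exact hp
    · by_cases c2 : m2 < w
      · rw [h3 w c2, abs_zero]; exact hp
      · exact (h1 w ⟨not_lt.1 c1, not_lt.1 c2⟩).trans h4
  refine ⟨φ, deriv φ, deriv (deriv φ), max K1 K2, ?_, ?_, ?_, hs2, ?_, ?_, ?_, ?_, ?_, ?_, ?_, ?_, ?_, ?_⟩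
  · exact (norm_nonneg _).trans ((hK1 m1 ⟨le_rfl, a2.le⟩).trans (le_max_left _ _))
  · exact fun w => (hs.differentiable (by norm_num) w).hasDerivAt
  · exact fun w => (hs1.differentiable (by norm_num) w).hasDerivAt
  · exact bd _ K1 hK1 l1 r1 (le_max_left _ _)
  · exact bd _ K2 hK2 l2 r2 (le_max_right _ _)
  · exact fun w hw => l0 w (by linarith)
  · exact fun w hw => l1 w (by linarith)
  · exact fun w hw => l2 w (by linarith)
  · exact fun w hw => r0 w (by linarith)
  · exact fun w hw => r1 w (by linarith)
  · exact fun w hw => r2 w (by linarith)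
  · exact fun w => Real.smoothTransition.nonneg _
  · exact fun w => Real.smoothTransition.le_one _

structure LocMod (f fw fww ft p pw : ℝ → ℝ → ℝ) (ta tb κ M B L1 L2 L3 σ : ℝ) : Prop where
  hκ : 0 < κ
  hκ1 : κ ≤ 1
  hM : 0 ≤ M
  hB : 0 ≤ B
  hL1 : 0 < L1
  hL2 : L1 < L2
  hL3 : L2 < L3
  hσ : |σ| = 1
  dw : ∀ t ∈ Ioo ta tb, ∀ w, 0 ≤ w → w < L3 → HasDerivAt (fun w => f w t) (fw w t) w
  dww : ∀ t ∈ Ioo ta tb, ∀ w, 0 ≤ w → w < L3 → HasDerivAt (fun w => fw w t) (fww w t) w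
  dt : ∀ t ∈ Ioo ta tb, ∀ w, 0 < w → w < L3 → HasDerivAt (fun t => f w t) (ft w t) t
  cww : ContinuousOn (fun p : ℝ × ℝ => fww p.1 p.2) {p | (0 ≤ p.1 ∧ p.2 ∈ Ioo ta tb) ∧ p.1 < L3}
  cw : ContinuousOn (fun p : ℝ × ℝ => fw p.1 p.2) {p | (0 ≤ p.1 ∧ p.2 ∈ Ioo ta tb) ∧ p.1 < L3}
  cf : ContinuousOn (fun p : ℝ × ℝ => f p.1 p.2) {p | (0 ≤ p.1 ∧ p.2 ∈ Ioo ta tb) ∧ p.1 < L3}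
  bf : ∀ t ∈ Ioo ta tb, ∀ w, 0 ≤ w → w < L3 → |f w t| ≤ B
  bfw : ∀ t ∈ Ioo ta tb, ∀ w, 0 ≤ w → w < L3 → |fw w t| ≤ B
  bfww : ∀ t ∈ Ioo ta tb, ∀ w, 0 ≤ w → w < L3 → |fww w t| ≤ B
  bft : ∀ t ∈ Ioo ta tb, ∀ w, 0 ≤ w → w < L3 → |ft w t| ≤ B
  eqn : ∀ t ∈ Ioo ta tb, ∀ w, 0 ≤ w → w < L3 → |ft w t - p w t * fww w t| ≤ M * (|fw w t| + |f w t|)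
  sgn : ∀ t ∈ Ioo ta tb, ∀ w, L1 ≤ w → w < L3 → κ ≤ σ * f w t
  zero : ∀ t ∈ Ioo ta tb, f 0 t = 0
  pl : ∀ t ∈ Ioo ta tb, ∀ w, 0 ≤ w → w < L3 → κ ≤ p w t
  pu : ∀ t ∈ Ioo ta tb, ∀ w, 0 ≤ w → w < L3 → p w t ≤ B
  lipp : ∀ t ∈ Ioo ta tb, ∀ t' ∈ Ioo ta tb, ∀ w w', 0 ≤ w → 0 ≤ w' → w < L3 → w' < L3 →
    |p w t - p w' t'| ≤ B * |w - w'| + B * |t - t'|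
  dp : ∀ t ∈ Ioo ta tb, ∀ w, 0 < w → w < L3 → HasDerivAt (fun w => p w t) (pw w t) w
  bpw : ∀ t ∈ Ioo ta tb, ∀ w, 0 < w → w < L3 → |pw w t| ≤ B
  cpw : ContinuousOn (fun p : ℝ × ℝ => pw p.1 p.2) {p | (0 < p.1 ∧ p.2 ∈ Ioo ta tb) ∧ p.1 < L3}
  dpt : ∀ t ∈ Ioo ta tb, ∀ w, 0 < w → w < L3 → ∃ d, HasDerivAt (fun t => p w t) d t

lemma cut_deriv {G : ℝ → ℝ} {G' w L2 L3 k : ℝ} (h3 : L2 < L3) (h : w < L3 → HasDerivAt G G' w) (h0 : ∀ w, L2 ≤ w → G w = k)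
    (h1 : L2 ≤ w → G' = 0) : HasDerivAt G G' w := by
  rcases lt_or_ge w L3 with c | c
  · exact h c
  · have : L2 < w := h3.trans_le c
    rw [h1 this.le]
    exact (hasDerivAt_const w k).congr_of_eventuallyEq (by filter_upwards [eventually_gt_nhds this] with y hy using h0 y hy.le)

lemma cut_cont {G : ℝ × ℝ → ℝ} {S : Set (ℝ × ℝ)} {L2 L3 k : ℝ} (h3 : L2 < L3) (h : ContinuousOn G {z | z ∈ S ∧ z.1 < L3})
    (h0 : ∀ z, L2 ≤ z.1 → G z = k) : ContinuousOn G S := by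
  intro z hz
  rcases lt_or_ge z.1 L3 with c | c
  · refine (h z ⟨hz, c⟩).mono_of_mem_nhdsWithin ?_
    have : ∀ᶠ y : ℝ × ℝ in 𝓝 z, y.1 < L3 := continuousAt_fst.eventually (eventually_lt_nhds c)
    filter_upwards [self_mem_nhdsWithin, nhdsWithin_le_nhds this] with y h1 h2 using ⟨h1, h2⟩
  · have c' : L2 < z.1 := h3.trans_le c
    have : ∀ᶠ y : ℝ × ℝ in 𝓝 z, L2 < y.1 := continuousAt_fst.eventually (eventually_gt_nhds c')
    refine ContinuousAt.continuousWithinAt ?_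
    exact (continuousAt_const (y := k)).congr (by filter_upwards [this] with y hy using (h0 y hy.le).symm)

theorem LocMod.toHalf {f fw fww ft p pw : ℝ → ℝ → ℝ} {ta tb κ M B L1 L2 L3 σ K : ℝ} {φ φ1 φ2 : ℝ → ℝ}
    (m : LocMod f fw fww ft p pw ta tb κ M B L1 L2 L3 σ) (c : Cutoff φ φ1 φ2 K L1 L2) :
    HalfMod (fun w t => φ w * (f w t - σ) + σ) (fun w t => φ w * fw w t + φ1 w * (f w t - σ))
      (fun w t => φ w * fww w t + 2 * (φ1 w * fw w t) + φ2 w * (f w t - σ)) (fun w t => φ w * ft w t)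
      (fun w t => φ w * (p w t - 1) + 1) (fun w t => φ w * pw w t + φ1 w * (p w t - 1)) ta tb κ
      (M + ((B + 1) * (1 + 3 * K) + ((B + 1) * (1 + 3 * K)) * ((B + 1) * (1 + 3 * K))) / κ) ((B + 1) * (1 + 3 * K)) L2 := by
  have hB := m.hB
  have hK := c.hK
  have hM := m.hM
  have hκ := m.hκ
  have h3 := m.hL3
  have hL1 := m.hL1
  have hL2 := m.hL2
  have hKB : 0 ≤ K * B := by positivity
  set D := (B + 1) * (1 + 3 * K) with hD
  have hD0 : 0 ≤ D := by positivity
  have eD : D = B + 1 + 3 * (K * B) + 3 * K := by rw [hD]; ring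
  have φa : ∀ w, |φ w| ≤ 1 := fun w => abs_le.2 ⟨by linarith [c.nn w], c.le1 w⟩
  have φc : Continuous φ := continuous_iff_continuousAt.2 fun w => (c.d1 w).continuousAt
  have φ1c : Continuous φ1 := continuous_iff_continuousAt.2 fun w => (c.d2 w).continuousAt
  have cc : ∀ {g : ℝ → ℝ} {S : Set (ℝ × ℝ)}, Continuous g → ContinuousOn (fun z : ℝ × ℝ => g z.1) S := fun hg =>
    (hg.comp continuous_fst).continuousOn
  -- bound of products
  have pb : ∀ {x y X Y : ℝ}, |x| ≤ X → |y| ≤ Y → |x * y| ≤ X * Y := fun {x y X Y} hx hy => by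
    rw [abs_mul]; exact mul_le_mul hx hy (abs_nonneg _) ((abs_nonneg _).trans hx)
  have fσ : ∀ t ∈ Ioo ta tb, ∀ w, 0 ≤ w → w < L3 → |f w t - σ| ≤ B + 1 := fun t ht w h0 hw =>
    (abs_sub _ _).trans (by linarith [m.bf t ht w h0 hw, m.hσ.le])
  have pσ : ∀ t ∈ Ioo ta tb, ∀ w, 0 ≤ w → w < L3 → |p w t - 1| ≤ B + 1 := fun t ht w h0 hw => by
    have h1 := m.pl t ht w h0 hw
    have h2 := m.pu t ht w h0 hw
    rw [abs_le]; constructor <;> linarith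
  have bww : ∀ t ∈ Ioo ta tb, ∀ w, 0 ≤ w → |φ w * fww w t + 2 * (φ1 w * fw w t) + φ2 w * (f w t - σ)| ≤ D := by
    intro t ht w hw
    rcases lt_or_ge w L3 with h | h
    · have e1 := pb (φa w) (m.bfww t ht w hw h)
      have e2 := pb (c.b1 w) (m.bfw t ht w hw h)
      have e3 := pb (c.b2 w) (fσ t ht w hw h)
      rw [abs_le] at *
      constructor <;> nlinarith
    · have h' : L2 ≤ w := h3.le.trans h
      rw [c.r0 w h', c.r1 w h', c.r2 w h']; simpa using hD0
  have bt : ∀ t ∈ Ioo ta tb, ∀ w, 0 ≤ w → |φ w * ft w t| ≤ D := by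
    intro t ht w hw
    rcases lt_or_ge w L3 with h | h
    · have e1 := pb (φa w) (m.bft t ht w hw h)
      linarith
    · have h' : L2 ≤ w := h3.le.trans h
      rw [c.r0 w h']; simpa using hD0
  have pu : ∀ t ∈ Ioo ta tb, ∀ w, 0 ≤ w → κ ≤ φ w * (p w t - 1) + 1 ∧ φ w * (p w t - 1) + 1 ≤ D := by
    intro t ht w hw
    rcases lt_or_ge w L3 with h | h
    · have h1 := m.pl t ht w hw h
      have h2 := m.pu t ht w hw h
      constructor
      · nlinarith [c.nn w, c.le1 w, m.hκ1, mul_nonneg (c.nn w) (sub_nonneg.2 h1),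
          mul_nonneg (sub_nonneg.2 (c.le1 w)) (sub_nonneg.2 m.hκ1)]
      · nlinarith [c.nn w, c.le1 w, mul_nonneg (c.nn w) (sub_nonneg.2 h2), mul_nonneg (sub_nonneg.2 (c.le1 w)) hB]
    · have h' : L2 ≤ w := h3.le.trans h
      rw [c.r0 w h', zero_mul, zero_add]; exact ⟨m.hκ1, by linarith⟩
  have φl : ∀ w w', |φ w - φ w'| ≤ K * |w - w'| := fun w w' =>
    convex_univ.norm_image_sub_le_of_norm_hasDerivWithin_le (f := φ) (fun x _ => (c.d1 x).hasDerivWithinAt)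
      (fun x _ => c.b1 x) (mem_univ w') (mem_univ w)
  have φbig : ∀ t ∈ Ioo ta tb, ∀ w, L1 ≤ w → κ ≤ |φ w * (f w t - σ) + σ| := by
    intro t ht w hw
    have e : |φ w * (f w t - σ) + σ| = |σ * (φ w * (f w t - σ) + σ)| := by rw [abs_mul, m.hσ, one_mul]
    rw [e]
    refine le_trans ?_ (le_abs_self _)
    have s2 : σ * σ = 1 := by rw [← abs_mul_abs_self, m.hσ, one_mul]
    rcases lt_or_ge w L3 with h | h
    · have h1 := m.sgn t ht w hw h
      have : σ * (φ w * (f w t - σ) + σ) = φ w * (σ * f w t) + (1 - φ w) * (σ * σ) := by ring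
      rw [this, s2]
      nlinarith [c.nn w, c.le1 w, m.hκ1, mul_nonneg (c.nn w) (sub_nonneg.2 h1),
          mul_nonneg (sub_nonneg.2 (c.le1 w)) (sub_nonneg.2 m.hκ1)]
    · have h' : L2 ≤ w := h3.le.trans h
      rw [c.r0 w h', zero_mul, zero_add, s2]; exact m.hκ1
  constructor
  · exact hκ
  · positivity
  · exact hD0
  · linarith
  · intro t ht w hw
    refine cut_deriv (k := σ) h3 (fun h => ?_) (fun w h => ?_) (fun h => ?_)
    · exact (((c.d1 w).mul ((m.dw t ht w hw h).sub_const σ)).add_const σ).congr_deriv (by ring)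
    · rw [c.r0 w h]; ring
    · rw [c.r0 w h, c.r1 w h]; ring
  · intro t ht w hw
    refine cut_deriv (k := 0) h3 (fun h => ?_) (fun w h => ?_) (fun h => ?_)
    · exact (((c.d1 w).mul (m.dww t ht w hw.le h)).add ((c.d2 w).mul ((m.dw t ht w hw.le h).sub_const σ))).congr_deriv (by ring)
    · rw [c.r0 w h, c.r1 w h]; ring
    · rw [c.r0 w h, c.r1 w h, c.r2 w h]; ring
  · intro t ht w hw
    rcases lt_or_ge w L3 with h | h
    · exact (((m.dt t ht w hw h).sub_const σ).const_mul (φ w)).add_const σ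
    · have h' : L2 ≤ w := h3.le.trans h
      simp only [c.r0 w h', zero_mul, zero_add]; exact hasDerivAt_const _ _
  · refine cut_cont (k := 0) h3 ?_ (fun z h => ?_)
    · exact ((cc φc).mul m.cw).add ((cc φ1c).mul (m.cf.sub continuousOn_const))
    · rw [c.r0 _ h, c.r1 _ h]; ring
  · have sub : {p : ℝ × ℝ | p ∈ {p : ℝ × ℝ | 0 < p.1 ∧ p.2 ∈ Ioo ta tb} ∧ p.1 < L3} ⊆
        {p | (0 ≤ p.1 ∧ p.2 ∈ Ioo ta tb) ∧ p.1 < L3} := fun z hz => ⟨⟨hz.1.1.le, hz.1.2⟩, hz.2⟩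
    refine cut_cont (k := 0) h3 ?_ (fun z h => ?_)
    · exact (((cc φc).mul (m.cww.mono sub)).add (continuousOn_const.mul ((cc φ1c).mul (m.cw.mono sub)))).add
        ((cc c.c2).mul ((m.cf.mono sub).sub continuousOn_const))
    · rw [c.r0 _ h, c.r1 _ h, c.r2 _ h]; ring
  · intro t ht w hw
    rcases lt_or_ge w L3 with h | h
    · have h1 := abs_le.1 (m.bf t ht w hw h)
      have h2 := abs_le.1 m.hσ.le
      have e : φ w * (f w t - σ) + σ = φ w * f w t + (1 - φ w) * σ := by ring
      have e1 := pb (φa w) (m.bf t ht w hw h)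
      have e2 : |(1 - φ w) * σ| ≤ 1 * 1 := pb (by rw [abs_le]; constructor <;> linarith [c.nn w, c.le1 w]) m.hσ.le
      rw [e]
      exact (abs_add_le _ _).trans (by linarith)
    · have h' : L2 ≤ w := h3.le.trans h
      rw [c.r0 w h', zero_mul, zero_add, m.hσ]; linarith
  · intro t ht w hw
    rcases lt_or_ge w L3 with h | h
    · have e1 := pb (φa w) (m.bfw t ht w hw h)
      have e2 := pb (c.b1 w) (fσ t ht w hw h)
      exact (abs_add_le _ _).trans (by linarith)
    · have h' : L2 ≤ w := h3.le.trans h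
      rw [c.r0 w h', c.r1 w h']; simpa using hD0
  · exact fun t ht w hw => bww t ht w hw.le
  · exact fun t ht w hw => bt t ht w hw.le
  · intro t ht w hw
    rcases le_or_gt w L1 with h | h
    · have hw3 : w < L3 := by linarith
      rw [c.l0 w h, c.l1 w h, c.l2 w h]
      have := m.eqn t ht w hw.le hw3
      have e1 : 1 * ft w t - (1 * (p w t - 1) + 1) * (1 * fww w t + 2 * (0 * fw w t) + 0 * (f w t - σ)) = ft w t - p w t * fww w t := by ring
      have e2 : 1 * fw w t + 0 * (f w t - σ) = fw w t := by ring
      have e3 : 1 * (f w t - σ) + σ = f w t := by ring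
      rw [e1, e2, e3]
      refine this.trans ?_
      gcongr
      have : 0 ≤ (D + D * D) / κ := by positivity
      linarith
    · have e1 := φbig t ht w h.le
      have e2 : |φ w * ft w t - (φ w * (p w t - 1) + 1) * (φ w * fww w t + 2 * (φ1 w * fw w t) + φ2 w * (f w t - σ))| ≤ D + D * D := by
        refine (abs_sub _ _).trans ?_
        gcongr
        · exact bt t ht w hw.le
        · refine pb ?_ (bww t ht w hw.le)
          have := pu t ht w hw.le
          rw [abs_le]; constructor <;> linarith
      refine e2.trans ?_
      have e3 : D + D * D ≤ (D + D * D) / κ * |φ w * (f w t - σ) + σ| := by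
        rw [div_mul_eq_mul_div, le_div_iff₀ hκ]; gcongr
      have e4 : 0 ≤ (M + (D + D * D) / κ) * |φ w * fw w t + φ1 w * (f w t - σ)| := by positivity
      have e5 : 0 ≤ M * |φ w * (f w t - σ) + σ| := by positivity
      linarith
  · intro t ht w h
    rw [c.r0 w h, zero_mul, zero_add, m.hσ]
  · intro t ht w h
    rw [c.r0 w h, c.r1 w h]; ring
  · intro t ht
    rw [c.l0 0 hL1.le, m.zero t ht]; ring
  · exact fun t ht w hw => (pu t ht w hw).1
  · exact fun t ht w hw => (pu t ht w hw).2
  · intro t ht t' ht' w w' hw hw'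
    have hs : ∀ t ∈ Ioo ta tb, ∀ w w', 0 ≤ w → 0 ≤ w' → w < L3 → L3 ≤ w' →
        |φ w * (p w t - 1)| ≤ D * |w - w'| := by
      intro t ht w w' hw hw' h h'
      have e : φ w = φ w - φ w' := by rw [c.r0 w' (h3.le.trans h')]; ring
      rw [e]
      refine (pb (φl w w') (pσ t ht w hw h)).trans ?_
      have : K * |w - w'| * (B + 1) = (K * B + K) * |w - w'| := by ring
      rw [this]; gcongr; linarith
    have n1 : 0 ≤ D * |w - w'| := by positivity
    have n2 : 0 ≤ D * |t - t'| := by positivity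
    rcases lt_or_ge w L3 with h | h <;> rcases lt_or_ge w' L3 with h' | h'
    · have e : φ w * (p w t - 1) + 1 - (φ w' * (p w' t' - 1) + 1) = φ w * (p w t - p w' t') + (φ w - φ w') * (p w' t' - 1) := by ring
      rw [e]
      have e1 := pb (φa w) (m.lipp t ht t' ht' w w' hw hw' h h')
      have e2 := pb (φl w w') (pσ t' ht' w' hw' h')
      refine (abs_add_le _ _).trans ?_
      have n3 : 0 ≤ (1 + 2 * (K * B) + 2 * K) * |w - w'| := by positivity
      have n4 : 0 ≤ (1 + 3 * (K * B) + 3 * K) * |t - t'| := by positivity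
      rw [eD]; nlinarith
    · have := hs t ht w w' hw hw' h h'
      have e : φ w * (p w t - 1) + 1 - (φ w' * (p w' t' - 1) + 1) = φ w * (p w t - 1) := by
        rw [c.r0 w' (h3.le.trans h')]; ring
      rw [e]; linarith
    · have := hs t' ht' w' w hw' hw h' h
      have e : φ w * (p w t - 1) + 1 - (φ w' * (p w' t' - 1) + 1) = -(φ w' * (p w' t' - 1)) := by
        rw [c.r0 w (h3.le.trans h)]; ring
      rw [abs_sub_comm w' w] at this
      rw [e, abs_neg]; linarith
    · rw [c.r0 w (h3.le.trans h), c.r0 w' (h3.le.trans h')]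
      simp only [zero_mul, sub_self, abs_zero]; linarith
  · intro t ht w hw
    refine cut_deriv (k := 1) h3 (fun h => ?_) (fun w h => ?_) (fun h => ?_)
    · exact (((c.d1 w).mul ((m.dp t ht w hw h).sub_const 1)).add_const 1).congr_deriv (by ring)
    · rw [c.r0 w h]; ring
    · rw [c.r0 w h, c.r1 w h]; ring
  · intro t ht w hw
    rcases lt_or_ge w L3 with h | h
    · have e1 := pb (φa w) (m.bpw t ht w hw h)
      have e2 := pb (c.b1 w) (pσ t ht w hw.le h)
      exact (abs_add_le _ _).trans (by linarith)
    · have h' : L2 ≤ w := h3.le.trans h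
      rw [c.r0 w h', c.r1 w h']; simpa using hD0
  · have cp : ContinuousOn (fun z : ℝ × ℝ => p z.1 z.2) {p | (0 < p.1 ∧ p.2 ∈ Ioo ta tb) ∧ p.1 < L3} := by
      intro z hz
      have hT : Tendsto (fun r : ℝ × ℝ => B * |r.1 - z.1| + B * |r.2 - z.2|) (𝓝 z) (𝓝 0) := by
        have : Continuous (fun r : ℝ × ℝ => B * |r.1 - z.1| + B * |r.2 - z.2|) := by fun_prop
        simpa using this.tendsto z
      rw [ContinuousWithinAt, tendsto_iff_dist_tendsto_zero]
      refine squeeze_zero' (Eventually.of_forall fun _ => dist_nonneg) ?_ (hT.mono_left nhdsWithin_le_nhds)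
      filter_upwards [self_mem_nhdsWithin] with r hr
      exact m.lipp r.2 hr.1.2 z.2 hz.1.2 _ _ hr.1.1.le hz.1.1.le hr.2 hz.2
    refine cut_cont (k := 0) h3 ?_ (fun z h => ?_)
    · exact ((cc φc).mul m.cpw).add ((cc φ1c).mul (cp.sub continuousOn_const))
    · rw [c.r0 _ h, c.r1 _ h]; ring
  · intro t ht w hw
    rcases lt_or_ge w L3 with h | h
    · obtain ⟨d, hd⟩ := m.dpt t ht w hw h
      exact ⟨_, ((hd.sub_const 1).const_mul (φ w)).add_const 1⟩
    · have h' : L2 ≤ w := h3.le.trans h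
      exact ⟨0, by simp only [c.r0 w h', zero_mul, zero_add]; exact hasDerivAt_const _ _⟩

theorem LocMod.final {f fw fww ft p pw : ℝ → ℝ → ℝ} {ta tb κ M B L1 L2 L3 σ τ : ℝ}
    (m : LocMod f fw fww ft p pw ta tb κ M B L1 L2 L3 σ) (hτ : ta < τ) {zl : ℝ → Set ℝ}
    (hz : ∀ t, zl t = {w | 0 ≤ w ∧ w < L1 ∧ f w t = 0}) :
    (∀ t ∈ Ioo τ tb, (zl t).Finite) ∧
    (∀ p ∈ Ioo τ tb, ∀ q ∈ Ioo τ tb, p ≤ q → (zl q).ncard ≤ (zl p).ncard) ∧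
    (∀ j ∈ Ioo τ tb, (∃ y ∈ zl j, fw y j = 0) → ∀ p ∈ Ioo τ tb, ∀ q ∈ Ioo τ tb, p < j → j < q →
      (zl q).ncard < (zl p).ncard) := by
  obtain ⟨φ, φ1, φ2, K, c⟩ := exists_cutoff m.hL2
  have H := m.toHalf c
  have e : ∀ t ∈ Ioo τ tb, zs (fun w t => φ w * (f w t - σ) + σ) t = zl t := by
    intro t ht
    have ht' : t ∈ Ioo ta tb := ⟨hτ.trans ht.1, ht.2⟩
    rw [hz]
    ext w
    refine and_congr_right fun h => ?_
    show φ w * (f w t - σ) + σ = 0 ↔ _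
    rcases lt_or_ge w L1 with h1 | h1
    · rw [c.l0 w h1.le, one_mul, sub_add_cancel]; simp [h1]
    · constructor
      · intro h0
        have s2 : σ * σ = 1 := by rw [← abs_mul_abs_self, m.hσ, one_mul]
        have h2 : φ w * (σ * f w t) + (1 - φ w) * (σ * σ) = 0 := by
          have : φ w * (σ * f w t) + (1 - φ w) * (σ * σ) = σ * (φ w * (f w t - σ) + σ) := by ring
          rw [this, h0, mul_zero]
        rw [s2] at h2
        rcases lt_or_ge w L3 with h3 | h3
        · have := m.sgn t ht' w h1 h3
          have := m.hκ
          have := m.hκ1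
          nlinarith [c.nn w, c.le1 w, m.hκ1, mul_nonneg (c.nn w) (sub_nonneg.2 (m.sgn t ht' w h1 h3)),
            mul_nonneg (sub_nonneg.2 (c.le1 w)) (sub_nonneg.2 m.hκ1)]
        · rw [c.r0 w (m.hL3.le.trans h3)] at h2; norm_num at h2
      · rintro ⟨h0, -⟩; linarith
  obtain ⟨f1, f2, f3⟩ := H.final hτ
  refine ⟨fun t ht => ?_, fun a ha b hb hab => ?_, ?_⟩
  · rw [← e t ht]; exact f1 t ht
  · rw [← e a ha, ← e b hb]; exact f2 a ha b hb hab
  · rintro j ht ⟨w, hw, hw'⟩ a ha b hb h1 h2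
    rw [← e a ha, ← e b hb]
    refine f3 j ht ⟨w, by rw [e j ht]; exact hw, ?_⟩ a ha b hb h1 h2
    rw [hz] at hw
    show φ w * fw w j + φ1 w * (f w j - σ) = 0
    rw [c.l1 w hw.2.1.le, hw']; ring

lemma joint_cont {a ax axx at' : ℝ → ℝ → ℝ} {ω j M : ℝ} (hM : 0 ≤ M)
    (h : ∀ᶠ z : ℝ × ℝ in 𝓝 (ω, j), HasDerivAt (fun y => a y z.2) (ax z.1 z.2) z.1 ∧
      HasDerivAt (fun y => ax y z.2) (axx z.1 z.2) z.1 ∧ HasDerivAt (fun t => a z.1 t) (at' z.1 z.2) z.2 ∧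
      |axx z.1 z.2| ≤ M ∧ |at' z.1 z.2| ≤ M) :
    ContinuousAt (fun z : ℝ × ℝ => ax z.1 z.2) (ω, j) := by
  obtain ⟨ρ, hρ, hb⟩ := Metric.eventually_nhds_iff_ball.1 h
  have mem : ∀ x t, |x - ω| < ρ → |t - j| < ρ → (x, t) ∈ Metric.ball (ω, j) ρ := by
    intro x t h1 h2
    rw [Metric.mem_ball, Prod.dist_eq]; exact max_lt h1 h2
  have axl : ∀ t, |t - j| < ρ → ∀ x x', |x - ω| < ρ → |x' - ω| < ρ → |ax x t - ax x' t| ≤ M * |x - x'| := by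
    intro t ht x x' hx hx'
    exact (convex_ball ω ρ).norm_image_sub_le_of_norm_hasDerivWithin_le (f := fun y => ax y t)
      (fun y hy => ((hb _ (mem y t hy ht)).2.1).hasDerivWithinAt) (fun y hy => (hb _ (mem y t hy ht)).2.2.2.1) hx' hx
  have tl : ∀ x, |x - ω| < ρ → ∀ t, |t - j| < ρ → |a x t - a x j| ≤ M * |t - j| := by
    intro x hx t ht
    exact (convex_ball j ρ).norm_image_sub_le_of_norm_hasDerivWithin_le (f := fun t => a x t)
      (fun y hy => ((hb _ (mem x y hx hy)).2.2.1).hasDerivWithinAt) (fun y hy => (hb _ (mem x y hx hy)).2.2.2.2)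
      (Metric.mem_ball_self hρ) ht
  rw [Metric.continuousAt_iff']
  intro ε hε
  set k := min (ρ / 2) (ε / (8 * (M + 1))) with hk
  have hk0 : 0 < k := lt_min (by positivity) (by positivity)
  have hk1 : k ≤ ρ / 2 := min_le_left _ _
  have hk2 : 2 * M * k < ε / 2 := by
    have : k ≤ ε / (8 * (M + 1)) := min_le_right _ _
    rw [le_div_iff₀ (by positivity)] at this
    nlinarith
  have tay : ∀ t, |t - j| < ρ → |k * ax ω t - (a (ω + k) t - a ω t)| ≤ M * k * k := by
    intro t ht
    have mm : ∀ z ∈ Icc ω (ω + k), |z - ω| < ρ := fun z hz => by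
      rw [abs_of_nonneg (by linarith [hz.1])]; linarith [hz.2]
    obtain ⟨η, hη, e⟩ := exists_hasDerivAt_eq_slope (fun y => a y t) (fun y => ax y t) (show ω < ω + k by linarith)
      (fun z hz => ((hb _ (mem z t (mm z hz) ht)).1).continuousAt.continuousWithinAt)
      (fun z hz => (hb _ (mem z t (mm z (Ioo_subset_Icc_self hz)) ht)).1)
    have e' : a (ω + k) t - a ω t = k * ax η t := by
      simp only [add_sub_cancel_left] at e
      rw [e]; field_simp
    rw [e', ← mul_sub, abs_mul, abs_of_pos hk0]
    have := axl t ht ω η (by simpa using hρ) (mm η (Ioo_subset_Icc_self hη))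
    have h2 : |ω - η| ≤ k := by rw [abs_sub_comm, abs_of_nonneg (by linarith [hη.1])]; linarith [hη.2]
    calc k * |ax ω t - ax η t| ≤ k * (M * k) := by gcongr; exact this.trans (by gcongr)
      _ = M * k * k := by ring
  have lim : Tendsto (fun z : ℝ × ℝ => M * |z.1 - ω| + 2 * M * k + 2 * M * |z.2 - j| / k) (𝓝 (ω, j)) (𝓝 (2 * M * k)) := by
    have : Continuous (fun z : ℝ × ℝ => M * |z.1 - ω| + 2 * M * k + 2 * M * |z.2 - j| / k) := by fun_prop
    simpa using this.tendsto (ω, j)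
  filter_upwards [lim.eventually (eventually_lt_nhds (show 2 * M * k < ε by linarith)), Metric.ball_mem_nhds (ω, j) hρ] with z h1 h2
  rw [Metric.mem_ball, Prod.dist_eq, max_lt_iff] at h2
  have z1 : |z.1 - ω| < ρ := h2.1
  have z2 : |z.2 - j| < ρ := h2.2
  have q1 := axl z.2 z2 z.1 ω z1 (by simpa using hρ)
  have q2 := tay z.2 z2
  have q3 := tay j (by simpa using hρ)
  have q4 := tl ω (by simpa using hρ) z.2 z2
  have q5 := tl (ω + k) (by rw [add_sub_cancel_left, abs_of_pos hk0]; linarith) z.2 z2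
  have q6 : |ax ω z.2 - ax ω j| ≤ 2 * M * k + 2 * M * |z.2 - j| / k := by
    have e : 2 * M * k + 2 * M * |z.2 - j| / k = (2 * (M * k * k) + 2 * (M * |z.2 - j|)) / k := by field_simp
    rw [e, le_div_iff₀ hk0, ← abs_of_pos hk0, ← abs_mul, abs_of_pos hk0]
    rw [abs_le] at *
    constructor <;> nlinarith
  rw [Real.dist_eq]
  have : ax z.1 z.2 - ax ω j = (ax z.1 z.2 - ax ω z.2) + (ax ω z.2 - ax ω j) := by ring
  rw [this]
  exact (abs_add_le _ _).trans_lt (by linarith)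

lemma geo {T X : ℝ} {xi1 : ℝ → ℝ} {u : ℝ → ℝ → ℝ} {s ε₂ : ℝ}
    (hxlt : ∀ t ∈ Icc (0:ℝ) T, xi1 t < X)
    (hcont : ContinuousOn (fun p : ℝ × ℝ => u p.1 p.2) (domCl xi1 (fun _ => X) T))
    (hX : ∀ t ∈ Icc (0:ℝ) T, u X t ≠ 0)
    (hε₂ : 0 < ε₂) (hsub : Icc (s - ε₂) (s + ε₂) ⊆ Icc (0:ℝ) T)
    (hC1 : ContDiffOn ℝ 1 xi1 (Icc (s - ε₂) (s + ε₂))) :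
    ∃ ε > 0, ε < ε₂ ∧ ∃ L1 L2 L3 σ κ M1 : ℝ, 0 < L1 ∧ L1 < L2 ∧ L2 < L3 ∧ |σ| = 1 ∧ 0 < κ ∧
      (∀ t ∈ Icc (s - ε) (s + ε), HasDerivAt xi1 (deriv xi1 t) t ∧ |deriv xi1 t| ≤ M1 ∧ xi1 t + L3 < X) ∧
      (∀ t ∈ Icc (s - ε) (s + ε), ∀ x, xi1 t + L1 ≤ x → x ≤ X → κ ≤ σ * u x t) := by
  have hs : s ∈ Icc 0 T := hsub ⟨by linarith, by linarith⟩
  have hd : ∀ t ∈ Ioo (s - ε₂) (s + ε₂), HasDerivAt xi1 (deriv xi1 t) t := fun t ht =>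
    ((hC1.differentiableOn (by norm_num) t (Ioo_subset_Icc_self ht)).differentiableAt (Icc_mem_nhds ht.1 ht.2)).hasDerivAt
  have hcd : ContinuousOn (fun t => derivWithin xi1 (Icc (s - ε₂) (s + ε₂)) t) (Icc (s - ε₂) (s + ε₂)) :=
    hC1.continuousOn_derivWithin (uniqueDiffOn_Icc (by linarith)) le_rfl
  obtain ⟨M1, hM1⟩ := isCompact_Icc.exists_bound_of_continuousOn hcd
  have hM1' : ∀ t ∈ Ioo (s - ε₂) (s + ε₂), |deriv xi1 t| ≤ M1 := fun t ht => by
    have := hM1 t (Ioo_subset_Icc_self ht)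
    rwa [derivWithin_of_mem_nhds (Icc_mem_nhds ht.1 ht.2), Real.norm_eq_abs] at this
  have hu0 : 0 < |u X s| := abs_pos.2 (hX s hs)
  set d := X - xi1 s with hdd
  have hd0 : 0 < d := sub_pos.2 (hxlt s hs)
  have hXs : (X, s) ∈ domCl xi1 (fun _ => X) T := ⟨hs, (hxlt s hs).le, le_rfl⟩
  obtain ⟨r0, hr0, hr⟩ := Metric.continuousOn_iff.1 hcont (X, s) hXs (|u X s| / 2) (by positivity)
  set r := min r0 d with hrd
  have hrp : 0 < r := lt_min hr0 hd0
  have hr1 : r ≤ r0 := min_le_left _ _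
  have hr2 : r ≤ d := min_le_right _ _
  have hξc := (hd s ⟨by linarith, by linarith⟩).continuousAt
  obtain ⟨ρ, hρ, hξ⟩ := Metric.continuousAt_iff.1 hξc (r / 8) (by positivity)
  set ε := min (min (ρ / 2) (ε₂ / 2)) (r0 / 2) with hε
  have hεp : 0 < ε := lt_min (lt_min (by positivity) (by positivity)) (by positivity)
  have e1 : ε ≤ ρ / 2 := (min_le_left _ _).trans (min_le_left _ _)
  have e2 : ε ≤ ε₂ / 2 := (min_le_left _ _).trans (min_le_right _ _)
  have e3 : ε ≤ r0 / 2 := min_le_right _ _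
  have hξ' : ∀ t ∈ Icc (s - ε) (s + ε), |xi1 t - xi1 s| < r / 8 := fun t ht => hξ (by
    rw [Real.dist_eq]
    exact lt_of_le_of_lt (abs_le.2 ⟨by linarith [ht.1], by linarith [ht.2]⟩) (show ε < ρ by linarith))
  have hI : ∀ t ∈ Icc (s - ε) (s + ε), t ∈ Ioo (s - ε₂) (s + ε₂) := fun t ht => ⟨by linarith [ht.1], by linarith [ht.2]⟩
  refine ⟨ε, hεp, by linarith, d - 3 * r / 4, d - r / 2, d - r / 4, sg (u X s), |u X s| / 2, M1, by linarith, by linarith,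
    by linarith, sg_abs (hX s hs), by positivity, ?_, ?_⟩
  · intro t ht
    refine ⟨hd t (hI t ht), hM1' t (hI t ht), ?_⟩
    have := abs_lt.1 (hξ' t ht)
    linarith [this.2]
  · intro t ht x hx hxX
    have h1 := abs_lt.1 (hξ' t ht)
    have ht' : t ∈ Icc 0 T := hsub (Ioo_subset_Icc_self (hI t ht))
    have := hr (x, t) ⟨ht', by linarith, hxX⟩ (by
      rw [Prod.dist_eq]
      refine max_lt ?_ ?_
      · rw [Real.dist_eq, abs_lt]; simp only; constructor <;> linarith
      · rw [Real.dist_eq, abs_lt]; simp only; constructor <;> linarith [ht.1, ht.2])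
    rw [Real.dist_eq] at this
    simp only at this
    rw [abs_lt] at this
    rcases lt_or_gt_of_ne (hX s hs) with h | h
    · rw [sg_of_neg h]; rw [abs_of_neg h] at *; linarith
    · rw [sg_pos h]; rw [abs_of_pos h] at *; linarith

lemma loc_mod {T X : ℝ} {xi1 : ℝ → ℝ} {a b c u : ℝ → ℝ → ℝ} {ta tb L1 L2 L3 σ κ M1 : ℝ}
    (hsol : IsClassicalSolution a b c xi1 (fun _ => X) T u)
    (hreg : Reg12 a b c xi1 (fun _ => X) T)
    (hlt : ta < tb) (hT : Icc ta tb ⊆ Ioo 0 T)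
    (hZZ : ∀ t ∈ Icc ta tb, u (xi1 t) t = 0)
    (hL1 : 0 < L1) (hL2 : L1 < L2) (hL3 : L2 < L3) (hσ : |σ| = 1) (hκ : 0 < κ)
    (hξ : ∀ t ∈ Icc ta tb, HasDerivAt xi1 (deriv xi1 t) t ∧ |deriv xi1 t| ≤ M1 ∧ xi1 t + L3 < X)
    (hsgn : ∀ t ∈ Icc ta tb, ∀ x, xi1 t + L1 ≤ x → x ≤ X → κ ≤ σ * u x t) :
    ∃ κ' M B, LocMod (fun w t => u (xi1 t + w) t) (fun w t => pdx u (xi1 t + w) t) (fun w t => pdxx u (xi1 t + w) t)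
      (fun w t => pdx u (xi1 t + w) t * deriv xi1 t + pdt u (xi1 t + w) t) (fun w t => a (xi1 t + w) t)
      (fun w t => pdx a (xi1 t + w) t) ta tb κ' M B L1 L2 L3 σ := by
  obtain ⟨N0, hN0⟩ := hreg
  have hM1 : 0 ≤ M1 := (abs_nonneg _).trans (hξ ta ⟨le_rfl, hlt.le⟩).2.1
  set N := max N0 1 with hN
  have hN1 : 1 ≤ N := le_max_right _ _
  have hNN : N0 ≤ N := le_max_left _ _
  have hL0 : 0 < L3 := by linarith
  set Ω := domLat xi1 (fun _ => X) T with hΩ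
  have mem : ∀ t ∈ Icc ta tb, ∀ w, 0 ≤ w → w ≤ L3 → (xi1 t + w, t) ∈ Ω := fun t ht w h0 h1 =>
    ⟨Ioo_subset_Ioc_self (hT ht), by simp only; linarith, by simp only; linarith [(hξ t ht).2.2]⟩
  have nb : ∀ t ∈ Ioo ta tb, ∀ w, 0 < w → w < L3 → ∀ᶠ z in 𝓝 (xi1 t + w, t), z ∈ Ω := by
    intro t ht w h0 h1
    have hc : ContinuousAt xi1 t := (hξ t (Ioo_subset_Icc_self ht)).1.continuousAt
    have hb := hT (Ioo_subset_Icc_self ht)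
    have hX := (hξ t (Ioo_subset_Icc_self ht)).2.2
    have q1 : ∀ᶠ z : ℝ × ℝ in 𝓝 (xi1 t + w, t), z.2 ∈ Ioo 0 T :=
      continuousAt_snd.eventually (Ioo_mem_nhds hb.1 hb.2)
    have q2 : ∀ᶠ z : ℝ × ℝ in 𝓝 (xi1 t + w, t), xi1 z.2 < z.1 :=
      Tendsto.eventually_lt (ContinuousAt.comp (x := (xi1 t + w, t)) (g := xi1) (f := Prod.snd) hc continuousAt_snd)
        (continuousAt_fst (p := (xi1 t + w, t))) (by simp only [Function.comp]; linarith)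
    have q3 : ∀ᶠ z : ℝ × ℝ in 𝓝 (xi1 t + w, t), z.1 < X :=
      continuousAt_fst.eventually (eventually_lt_nhds (by simp only; linarith))
    filter_upwards [q1, q2, q3] with z h1 h2 h3 using ⟨Ioo_subset_Ioc_self h1, h2.le, h3.le⟩
  -- continuity in straightened coordinates
  have ξc : ContinuousOn xi1 (Icc ta tb) := fun t ht => (hξ t ht).1.continuousAt.continuousWithinAt
  have Ψc : ContinuousOn (fun z : ℝ × ℝ => (xi1 z.2 + z.1, z.2)) (Icc 0 L3 ×ˢ Icc ta tb) :=
    ((ξc.comp continuousOn_snd fun z hz => hz.2).add continuousOn_fst).prodMk continuousOn_snd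
  have Ψm : MapsTo (fun z : ℝ × ℝ => (xi1 z.2 + z.1, z.2)) (Icc 0 L3 ×ˢ Icc ta tb) Ω := fun z hz =>
    mem z.2 hz.2 z.1 hz.1.1 hz.1.2
  have sub1 : Ω ⊆ domCl xi1 (fun _ => X) T := fun z hz => ⟨Ioc_subset_Icc_self hz.1, hz.2⟩
  have cu := (hsol.cont.mono sub1).comp Ψc Ψm
  have cux := hsol.cont_x.comp Ψc Ψm
  have cuxx := hsol.cont_xx.comp Ψc Ψm
  have cut := hsol.cont_t.comp Ψc Ψm
  have cpt : IsCompact (Icc 0 L3 ×ˢ Icc ta tb : Set (ℝ × ℝ)) := isCompact_Icc.prod isCompact_Icc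
  obtain ⟨B0, hB0⟩ := cpt.exists_bound_of_continuousOn cu
  obtain ⟨B1, hB1⟩ := cpt.exists_bound_of_continuousOn cux
  obtain ⟨B2, hB2⟩ := cpt.exists_bound_of_continuousOn cuxx
  obtain ⟨B3, hB3⟩ := cpt.exists_bound_of_continuousOn cut
  have p0 : ((0 : ℝ), ta) ∈ (Icc 0 L3 ×ˢ Icc ta tb : Set (ℝ × ℝ)) := ⟨⟨le_rfl, hL0.le⟩, le_rfl, hlt.le⟩
  have n0 := (norm_nonneg _).trans (hB0 _ p0)
  have n1 := (norm_nonneg _).trans (hB1 _ p0)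
  have n2 := (norm_nonneg _).trans (hB2 _ p0)
  have n3 := (norm_nonneg _).trans (hB3 _ p0)
  have sub2 : {p : ℝ × ℝ | (0 ≤ p.1 ∧ p.2 ∈ Ioo ta tb) ∧ p.1 < L3} ⊆ Icc 0 L3 ×ˢ Icc ta tb := fun z hz =>
    ⟨⟨hz.1.1, hz.2.le⟩, Ioo_subset_Icc_self hz.1.2⟩
  have hd : ∀ {g : ℝ → ℝ → ℝ} {t w : ℝ}, DifferentiableAt ℝ (fun y => g y t) (xi1 t + w) →
      HasDerivAt (fun w => g (xi1 t + w) t) (pdx g (xi1 t + w) t) w := fun h => h.hasDerivAt.comp_const_add _ _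
  have ma : ∀ t ∈ Ioo ta tb, ∀ w, 0 ≤ w → w < L3 → (xi1 t + w, t) ∈ Ω := fun t ht w h0 h1 =>
    mem t (Ioo_subset_Icc_self ht) w h0 h1.le
  have dtg : ∀ {g : ℝ → ℝ → ℝ} {t w : ℝ}, t ∈ Ioo ta tb → 0 < w → w < L3 →
      (∀ p ∈ Ω, DifferentiableAt ℝ (fun y => g y p.2) p.1) → (∀ p ∈ Ω, DifferentiableAt ℝ (fun s => g p.1 s) p.2) →
      ContinuousAt (fun z : ℝ × ℝ => pdx g z.1 z.2) (xi1 t + w, t) →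
      HasDerivAt (fun t => g (xi1 t + w) t) (pdx g (xi1 t + w) t * deriv xi1 t + pdt g (xi1 t + w) t) t := by
    intro g t w ht h0 h1 k1 k2 k3
    have := chain2 (f := g) (fx := pdx g) (ω := xi1 t + w) (j := t) (ft := pdt g (xi1 t + w) t)
      (p := fun t => xi1 t + w) (q := fun t => t) (p' := deriv xi1 t) (q' := 1) (s0 := t)
      (by filter_upwards [nb t ht w h0 h1] with z hz using (k1 z hz).hasDerivAt) k3
      ((k2 _ (ma t ht w h0.le h1)).hasDerivAt) ((hξ t (Ioo_subset_Icc_self ht)).1.add_const w) (hasDerivAt_id t) rfl rfl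
    simpa using this
  have cax : ∀ t ∈ Ioo ta tb, ∀ w, 0 < w → w < L3 → ContinuousAt (fun z : ℝ × ℝ => pdx a z.1 z.2) (xi1 t + w, t) := by
    intro t ht w h0 h1
    refine joint_cont (a := a) (ax := pdx a) (axx := pdxx a) (at' := pdt a) (M := N) (by linarith) ?_
    filter_upwards [nb t ht w h0 h1] with z hz
    obtain ⟨-, k1, k2, k3, -, -, -, -, k4, -, k5, -⟩ := hN0 z hz
    exact ⟨k1.hasDerivAt, k2.hasDerivAt, k3.hasDerivAt, k5.trans hNN, k4.trans hNN⟩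
  have dta : ∀ t ∈ Ioo ta tb, ∀ w, 0 < w → w < L3 →
      HasDerivAt (fun t => a (xi1 t + w) t) (pdx a (xi1 t + w) t * deriv xi1 t + pdt a (xi1 t + w) t) t :=
    fun t ht w h0 h1 => dtg ht h0 h1 (fun p hp => (hN0 p hp).2.1) (fun p hp => (hN0 p hp).2.2.2.1) (cax t ht w h0 h1)
  have bta : ∀ t ∈ Ioo ta tb, ∀ w, 0 ≤ w → w < L3 → |pdx a (xi1 t + w) t * deriv xi1 t + pdt a (xi1 t + w) t| ≤ N * M1 + N := by
    intro t ht w h0 h1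
    obtain ⟨-, -, -, -, -, -, -, -, k4, k6, -⟩ := hN0 _ (ma t ht w h0 h1)
    refine (abs_add_le _ _).trans ?_
    rw [abs_mul]
    gcongr
    · exact k6.trans hNN
    · exact (hξ t (Ioo_subset_Icc_self ht)).2.1
    · exact k4.trans hNN
  have lw : ∀ t ∈ Ioo ta tb, ∀ w w', 0 ≤ w → 0 ≤ w' → w < L3 → w' < L3 →
      |a (xi1 t + w) t - a (xi1 t + w') t| ≤ N * |w - w'| := by
    intro t ht w w' h0 h0' h1 h1'
    refine (convex_Ico 0 L3).norm_image_sub_le_of_norm_hasDerivWithin_le (f := fun w => a (xi1 t + w) t)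
      (f' := fun w => pdx a (xi1 t + w) t)
      (fun y hy => (hd (hN0 _ (ma t ht y hy.1 hy.2)).2.1).hasDerivWithinAt) (fun y hy => ?_) ⟨h0', h1'⟩ ⟨h0, h1⟩
    obtain ⟨-, -, -, -, -, -, -, -, -, k6, -⟩ := hN0 _ (ma t ht y hy.1 hy.2)
    exact k6.trans hNN
  have lt1 : ∀ t ∈ Ioo ta tb, ∀ t' ∈ Ioo ta tb, ∀ w, 0 < w → w < L3 →
      |a (xi1 t + w) t - a (xi1 t' + w) t'| ≤ (N * M1 + N) * |t - t'| := by
    intro t ht t' ht' w h0 h1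
    exact (convex_Ioo ta tb).norm_image_sub_le_of_norm_hasDerivWithin_le (f := fun t => a (xi1 t + w) t)
      (fun y hy => (dta y hy w h0 h1).hasDerivWithinAt) (fun y hy => bta y hy w h0.le h1) ht' ht
  have lt2 : ∀ t ∈ Ioo ta tb, ∀ t' ∈ Ioo ta tb, ∀ w, 0 ≤ w → w < L3 →
      |a (xi1 t + w) t - a (xi1 t' + w) t'| ≤ (N * M1 + N) * |t - t'| := by
    intro t ht t' ht' w h0 h1
    refine le_of_forall_pos_le_add fun e he => ?_
    set h := min (e / (2 * N)) ((L3 - w) / 2) with hh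
    have hp : 0 < h := lt_min (by positivity) (by linarith)
    have h2 : h ≤ (L3 - w) / 2 := min_le_right _ _
    have h3 : N * h ≤ e / 2 := by
      have : h ≤ e / (2 * N) := min_le_left _ _
      rw [le_div_iff₀ (by positivity)] at this
      linarith
    have q1 := lw t ht w (w + h) h0 (by linarith) h1 (by linarith)
    have q2 := lw t' ht' w (w + h) h0 (by linarith) h1 (by linarith)
    have q3 := lt1 t ht t' ht' (w + h) (by linarith) (by linarith)
    have e1 : |w - (w + h)| = h := by rw [sub_add_cancel_left, abs_neg, abs_of_pos hp]
    rw [e1] at q1 q2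
    rw [abs_le] at *
    constructor <;> linarith
  set κ' := min (min κ 1) N⁻¹ with hκ'
  have k1 : κ' ≤ κ := (min_le_left _ _).trans (min_le_left _ _)
  have k2 : κ' ≤ 1 := (min_le_left _ _).trans (min_le_right _ _)
  have k3 : κ' ≤ N⁻¹ := min_le_right _ _
  have hκp : 0 < κ' := lt_min (lt_min hκ one_pos) (by positivity)
  have nM : 0 ≤ B1 * M1 := mul_nonneg n1 hM1
  have nN : 0 ≤ N * M1 := by positivity
  refine ⟨κ', M1 + N, B0 + B1 + B2 + B3 + B1 * M1 + N * M1 + N, ?_⟩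
  constructor
  · exact hκp
  · exact k2
  · positivity
  · positivity
  · exact hL1
  · exact hL2
  · exact hL3
  · exact hσ
  · exact fun t ht w h0 h1 => hd (hsol.diff_x _ (ma t ht w h0 h1))
  · exact fun t ht w h0 h1 => hd (hsol.diff_xx _ (ma t ht w h0 h1))
  · exact fun t ht w h0 h1 => dtg ht h0 h1 hsol.diff_x hsol.diff_t (hsol.cont_x.continuousAt (nb t ht w h0 h1))
  · exact cuxx.mono sub2
  · exact cux.mono sub2
  · exact cu.mono sub2
  · intro t ht w h0 h1
    have := hB0 (w, t) ⟨⟨h0, h1.le⟩, Ioo_subset_Icc_self ht⟩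
    have this' : |u (xi1 t + w) t| ≤ B0 := this
    linarith
  · intro t ht w h0 h1
    have := hB1 (w, t) ⟨⟨h0, h1.le⟩, Ioo_subset_Icc_self ht⟩
    have this' : |pdx u (xi1 t + w) t| ≤ B1 := this
    linarith
  · intro t ht w h0 h1
    have := hB2 (w, t) ⟨⟨h0, h1.le⟩, Ioo_subset_Icc_self ht⟩
    have this' : |pdxx u (xi1 t + w) t| ≤ B2 := this
    linarith
  · intro t ht w h0 h1
    have e1 := hB1 (w, t) ⟨⟨h0, h1.le⟩, Ioo_subset_Icc_self ht⟩
    have e1' : |pdx u (xi1 t + w) t| ≤ B1 := e1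
    have e2 := hB3 (w, t) ⟨⟨h0, h1.le⟩, Ioo_subset_Icc_self ht⟩
    have e2' : |pdt u (xi1 t + w) t| ≤ B3 := e2
    have e3 : |pdx u (xi1 t + w) t * deriv xi1 t| ≤ B1 * M1 := by
      rw [abs_mul]; exact mul_le_mul e1' (hξ t (Ioo_subset_Icc_self ht)).2.1 (abs_nonneg _) n1
    exact (abs_add_le _ _).trans (by linarith)
  · intro t ht w h0 h1
    have hm := ma t ht w h0 h1
    obtain ⟨-, -, -, -, -, -, -, -, -, -, -, kb, -, -, kc⟩ := hN0 _ hm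
    have e := hsol.eqn _ hm
    simp only at e kb kc
    have hx := (hξ t (Ioo_subset_Icc_self ht)).2.1
    have e' : pdx u (xi1 t + w) t * deriv xi1 t + pdt u (xi1 t + w) t - a (xi1 t + w) t * pdxx u (xi1 t + w) t =
      (deriv xi1 t + b (xi1 t + w) t) * pdx u (xi1 t + w) t + c (xi1 t + w) t * u (xi1 t + w) t := by rw [e]; ring
    rw [e']
    refine (abs_add_le _ _).trans ?_
    rw [abs_mul, abs_mul, mul_add]
    gcongr
    · exact (abs_add_le _ _).trans (by linarith)
    · linarith
  · intro t ht w h0 h1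
    have ht' := Ioo_subset_Icc_self ht
    exact k1.trans (hsgn t ht' _ (by linarith) (by linarith [(hξ t ht').2.2]))
  · intro t ht
    simp only [add_zero]; exact hZZ t (Ioo_subset_Icc_self ht)
  · intro t ht w h0 h1
    obtain ⟨kp, -, -, -, -, -, -, ki, -⟩ := hN0 _ (ma t ht w h0 h1)
    simp only at kp ki
    refine k3.trans ?_
    rw [inv_le_comm₀ (by positivity) kp]
    exact (le_abs_self _).trans (ki.trans hNN)
  · intro t ht w h0 h1
    obtain ⟨-, -, -, -, -, -, ka, -⟩ := hN0 _ (ma t ht w h0 h1)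
    have := (le_abs_self _).trans (ka.trans hNN)
    linarith
  · intro t ht t' ht' w w' h0 h0' h1 h1'
    have q1 := lw t ht w w' h0 h0' h1 h1'
    have q2 := lt2 t ht t' ht' w' h0' h1'
    have e : a (xi1 t + w) t - a (xi1 t' + w') t' = (a (xi1 t + w) t - a (xi1 t + w') t) + (a (xi1 t + w') t - a (xi1 t' + w') t') := by ring
    rw [e]
    refine (abs_add_le _ _).trans (add_le_add (q1.trans ?_) (q2.trans ?_))
    · gcongr; linarith
    · gcongr; linarith
  · exact fun t ht w h0 h1 => hd (hN0 _ (ma t ht w h0.le h1)).2.1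
  · intro t ht w h0 h1
    obtain ⟨-, -, -, -, -, -, -, -, -, k6, -⟩ := hN0 _ (ma t ht w h0.le h1)
    simp only at k6
    linarith
  · intro z hz
    have h := cax z.2 hz.1.2 z.1 hz.1.1 hz.2
    have hξz := (hξ z.2 (Ioo_subset_Icc_self hz.1.2)).1.continuousAt
    refine ContinuousAt.continuousWithinAt (ContinuousAt.comp (g := fun z : ℝ × ℝ => pdx a z.1 z.2)
      (f := fun z : ℝ × ℝ => (xi1 z.2 + z.1, z.2)) h ?_)
    exact ((ContinuousAt.comp (g := xi1) (f := Prod.snd) hξz continuousAt_snd).add continuousAt_fst).prodMk continuousAt_snd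
  · exact fun t ht w h0 h1 => ⟨_, dta t ht w h0 h1⟩

/-- Lemma 2.1 (ZZZ-moment case): in the one-boundary setting, near a ZZZ-moment `s` of
`w₁(t) = u(ξ₁(t),t)` (with `ξ₁` of class `C¹` on the surrounding Z-interval) the
conclusions of Theorem A hold on some interval `(s-ε, s+ε)`. -/
theorem one_boundary_ZZZ_moment
    (T X : ℝ) (xi1 : ℝ → ℝ) (a b c u : ℝ → ℝ → ℝ)
    (hT : 0 < T)
    (hxc : ContinuousOn xi1 (Icc 0 T)) (hxlt : ∀ t ∈ Icc (0:ℝ) T, xi1 t < X)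
    (hsol : IsClassicalSolution a b c xi1 (fun _ => X) T u)
    (hreg : Reg12 a b c xi1 (fun _ => X) T)
    (hX : ∀ t ∈ Icc (0:ℝ) T, u X t ≠ 0)
    (s : ℝ) (hs : s ∈ Ioo (0:ℝ) T)
    (ε₂ : ℝ) (hε₂ : 0 < ε₂) (hsub : Icc (s - ε₂) (s + ε₂) ⊆ Icc (0:ℝ) T)
    (hZZ : ∀ t ∈ Icc (s - ε₂) (s + ε₂), u (xi1 t) t = 0)
    (hC1 : ContDiffOn ℝ 1 xi1 (Icc (s - ε₂) (s + ε₂))) :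
    ∃ ε > 0, Ioo (s - ε) (s + ε) ⊆ Ioo (0:ℝ) T ∧
      (∀ t ∈ Ioo (s - ε) (s + ε), Znum u xi1 (fun _ => X) t < ⊤) ∧
      (∀ t₁ ∈ Ioo (s - ε) (s + ε), ∀ t₂ ∈ Ioo (s - ε) (s + ε), t₁ ≤ t₂ →
        Znum u xi1 (fun _ => X) t₂ ≤ Znum u xi1 (fun _ => X) t₁) ∧
      (∀ τ ∈ Ioo (s - ε) (s + ε), HasMultipleZero u xi1 (fun _ => X) τ →
        ∀ t₁ t₂ : ℝ, s - ε < t₁ → t₁ < τ → τ < t₂ → t₂ < s + ε →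
          Znum u xi1 (fun _ => X) t₂ < Znum u xi1 (fun _ => X) t₁) := by
  obtain ⟨ε, hε, hεε, L1, L2, L3, σ, κ, M1, hL1, hL2, hL3, hσ, hκ, hξ, hsgn⟩ := geo hxlt hsol.cont hX hε₂ hsub hC1
  have hb1 : 0 ≤ s - ε₂ := (hsub ⟨le_rfl, by linarith⟩).1
  have hb2 : s + ε₂ ≤ T := (hsub ⟨by linarith, le_rfl⟩).2
  have hTT : Icc (s - ε) (s + ε) ⊆ Ioo 0 T := fun t ht => ⟨by linarith [ht.1], by linarith [ht.2]⟩
  have hZ' : ∀ t ∈ Icc (s - ε) (s + ε), u (xi1 t) t = 0 := fun t ht =>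
    hZZ t ⟨by linarith [ht.1], by linarith [ht.2]⟩
  obtain ⟨κ', M, B, m⟩ := loc_mod hsol hreg (by linarith : s - ε < s + ε) hTT hZ' hL1 hL2 hL3 hσ hκ hξ hsgn
  obtain ⟨f1, f2, f3⟩ := m.final (τ := s - ε / 2) (by linarith)
    (zl := fun t => {w | 0 ≤ w ∧ w < L1 ∧ u (xi1 t + w) t = 0}) (fun t => rfl)
  have hI : ∀ t ∈ Ioo (s - ε / 2) (s + ε / 2), t ∈ Icc (s - ε) (s + ε) ∧ t ∈ Ioo (s - ε / 2) (s + ε) :=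
    fun t ht => ⟨⟨by linarith [ht.1], by linarith [ht.2]⟩, ⟨ht.1, by linarith [ht.2]⟩⟩
  have key : ∀ t ∈ Icc (s - ε) (s + ε), ∀ x ∈ Icc (xi1 t) X, u x t = 0 → x - xi1 t < L1 := by
    intro t ht x hx hx0
    by_contra! hc
    have := hsgn t ht x (by linarith) hx.2
    rw [hx0] at this
    linarith
  have hz : ∀ t ∈ Icc (s - ε) (s + ε), zeroSet u xi1 (fun _ => X) t
      = (fun w => xi1 t + w) '' {w | 0 ≤ w ∧ w < L1 ∧ u (xi1 t + w) t = 0} := by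
    intro t ht
    ext x
    constructor
    · rintro ⟨h1, h2⟩
      refine ⟨x - xi1 t, ⟨by linarith [h1.1], key t ht x h1 h2, ?_⟩, by simp⟩
      simpa using h2
    · rintro ⟨w, ⟨h1, h2, h3⟩, rfl⟩
      exact ⟨⟨by simpa using h1, by have := (hξ t ht).2.2; simp only; linarith⟩, h3⟩
  have hZn : ∀ t ∈ Ioo (s - ε / 2) (s + ε / 2), Znum u xi1 (fun _ => X) t
      = (({w | 0 ≤ w ∧ w < L1 ∧ u (xi1 t + w) t = 0} : Set ℝ).ncard : ℕ∞) := by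
    intro t ht
    unfold Znum
    rw [hz t (hI t ht).1, (add_right_injective (xi1 t)).encard_image, (f1 t (hI t ht).2).cast_ncard_eq]
  refine ⟨ε / 2, by linarith, fun t ht => hTT (hI t ht).1, ?_, ?_, ?_⟩
  · intro t ht
    rw [hZn t ht]
    exact ENat.natCast_lt_top _
  · intro t1 h1 t2 h2 h12
    rw [hZn t1 h1, hZn t2 h2]
    exact Nat.cast_le.2 (f2 t1 (hI t1 h1).2 t2 (hI t2 h2).2 h12)
  · intro τ hτ hm t1 t2 h1 h2 h3 h4
    have k1 : t1 ∈ Ioo (s - ε / 2) (s + ε / 2) := ⟨h1, by linarith [hτ.2]⟩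
    have k2 : t2 ∈ Ioo (s - ε / 2) (s + ε / 2) := ⟨by linarith [hτ.1], h4⟩
    rw [hZn t1 k1, hZn t2 k2]
    obtain ⟨x, hx, hx0, hx1⟩ := hm
    refine Nat.cast_lt.2 (f3 τ (hI τ hτ).2 ⟨x - xi1 τ, ⟨by linarith [hx.1], key τ (hI τ hτ).1 x hx hx0, by simpa using hx0⟩, by simpa using hx1⟩
      t1 (hI t1 k1).2 t2 (hI t2 k2).2 h2 h3)
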